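/- arXiv:2009.07072 — 2 statements merged into one kernel-verified Lean document; each statement's English description precedes it below -/
import Mathlib

section
/- For every integer d ≥ 1 with d ≠ 3, the hypercube graph Q_d is ⌊(d+1)/2⌋-linked. -/
/-- The hypercube graph `Q_d`: vertices are functions `Fin d → Bool`, two vertices
being adjacent iff they differ in exactly one coordinate. -/
def cubeGraph (d : ℕ) : SimpleGraph (Fin d → Bool) where
  Adj x y := hammingDist x y = 1
  symm := ⟨fun x y h => by rwa [hammingDist_comm]⟩
  loopless := ⟨fun x h => by simp [hammingDist_self] at h⟩

/-- A graph `G` is `k`-linked if it has at least `2k` vertices and, for every choice of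
`2k` distinct vertices `s 0, …, s (k-1), t 0, …, t (k-1)`, there exist `k` pairwise
vertex-disjoint paths, the `i`-th joining `s i` to `t i`. -/
def IsLinked {V : Type*} (G : SimpleGraph V) (k : ℕ) : Prop :=
  2 * k ≤ Nat.card V ∧
    ∀ s t : Fin k → V, Function.Injective (Sum.elim s t) →
      ∃ P : (i : Fin k) → G.Walk (s i) (t i),
        (∀ i, (P i).IsPath) ∧
        ∀ i j, i ≠ j → ∀ v, v ∈ (P i).support → v ∉ (P j).support

namespace SimpleGraph

variable {V V' : Type} {G : SimpleGraph V} {G' : SimpleGraph V'} {C D : Set V} {u v w : V} {n : ℕ}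

/-- `u` and `v` are joined by a walk of `G` that stays inside `C`. -/
def ReachIn (G : SimpleGraph V) (C : Set V) (u v : V) : Prop :=
  ∃ p : G.Walk u v, ∀ x ∈ p.support, x ∈ C

namespace ReachIn

lemma refl (h : u ∈ C) : G.ReachIn C u u := ⟨.nil, by simpa using h⟩

lemma symm (h : G.ReachIn C u v) : G.ReachIn C v u := by
  obtain ⟨p, hp⟩ := h
  exact ⟨p.reverse, by simpa using hp⟩

lemma trans (h : G.ReachIn C u v) (h' : G.ReachIn C v w) : G.ReachIn C u w := by
  obtain ⟨p, hp⟩ := h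
  obtain ⟨q, hq⟩ := h'
  refine ⟨p.append q, fun x hx => ?_⟩
  rcases Walk.mem_support_append_iff _ _ |>.1 hx with hx | hx
  exacts [hp x hx, hq x hx]

lemma mono (h : G.ReachIn C u v) (hCD : C ⊆ D) : G.ReachIn D u v := by
  obtain ⟨p, hp⟩ := h
  exact ⟨p, fun x hx => hCD (hp x hx)⟩

lemma of_adj (h : G.Adj u v) (hu : u ∈ C) (hv : v ∈ C) : G.ReachIn C u v :=
  ⟨h.toWalk, by simp [hu, hv]⟩

lemma mem_left (h : G.ReachIn C u v) : u ∈ C := by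
  obtain ⟨p, hp⟩ := h
  exact hp _ p.start_mem_support

lemma mem_right (h : G.ReachIn C u v) : v ∈ C := h.symm.mem_left

lemma map (f : G →g G') {C' : Set V'} (h : G.ReachIn C u v) (hC : ∀ x ∈ C, f x ∈ C') :
    G'.ReachIn C' (f u) (f v) := by
  obtain ⟨p, hp⟩ := h
  refine ⟨p.map f, fun x hx => ?_⟩
  rw [Walk.support_map, List.mem_map] at hx
  obtain ⟨y, hy, rfl⟩ := hx
  exact hC y (hp y hy)

end ReachIn

/-- The pairs `f (k, false)`, `f (k, true)` can be joined inside pairwise disjoint vertex sets,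
all of them disjoint from `O`. -/
def HasLinkage {κ : Type} (G : SimpleGraph V) (O : Set V) (f : κ × Bool → V) : Prop :=
  ∃ C : κ → Set V, Pairwise (Function.onFun Disjoint C) ∧ (∀ k, Disjoint (C k) O) ∧
    ∀ k, G.ReachIn (C k) (f (k, false)) (f (k, true))

lemma HasLinkage.mono {κ : Type} {O O' : Set V} {f : κ × Bool → V} (h : G.HasLinkage O f)
    (hO : O' ⊆ O) : G.HasLinkage O' f := by
  obtain ⟨C, h1, h2, h3⟩ := h
  exact ⟨C, h1, fun k => (h2 k).mono_right hO, h3⟩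

lemma HasLinkage.of_iso {κ : Type} {O : Set V} {f : κ × Bool → V} (e : G ≃g G')
    (h : G'.HasLinkage (e '' O) (e ∘ f)) : G.HasLinkage O f := by
  obtain ⟨C, h1, h2, h3⟩ := h
  refine ⟨fun k => e ⁻¹' C k, fun k l hkl => (h1 hkl).preimage e, fun k => ?_, fun k => ?_⟩
  · refine Set.disjoint_left.2 fun x hx hxO => Set.disjoint_left.1 (h2 k) hx ⟨x, hxO, rfl⟩
  · simpa using (h3 k).map (C' := e ⁻¹' C k) e.symm.toHom (by simp)

/-- The prism over `G`: two copies of `G`, joined by a perfect matching. -/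
abbrev prism (G : SimpleGraph V) : SimpleGraph (Bool × V) := (⊤ : SimpleGraph Bool) □ G

lemma prism_adj_side (a : Bool) (h : G.Adj u v) : G.prism.Adj (a, u) (a, v) := by
  simp [boxProd_adj, h]

lemma prism_adj_cross {a b : Bool} (h : a ≠ b) (u : V) : G.prism.Adj (a, u) (b, u) := by
  simp [boxProd_adj, h]

lemma ReachIn.prism (a : Bool) {C' : Set (Bool × V)} (h : G.ReachIn C u v)
    (hC : ∀ x ∈ C, (a, x) ∈ C') : G.prism.ReachIn C' (a, u) (a, v) :=
  h.map (⟨fun x => (a, x), prism_adj_side a⟩ : G →g G.prism) hC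

/-- A way of moving vertices `X j` of the prism over `G` to the side opposite to `a`: the vertex
`X j` moves to the column `Y j`, which is its own column or an adjacent one, and then across. -/
structure IsShift {τ : Type} (G : SimpleGraph V) (a : Bool) (O : Finset V) (X : τ → Bool × V)
    (Y : τ → V) : Prop where
  inj : Function.Injective Y
  eq_of_ne : ∀ j, (X j).1 ≠ a → Y j = (X j).2
  eq_or_adj : ∀ j, Y j = (X j).2 ∨ G.Adj (X j).2 (Y j)
  notMem : ∀ j, (X j).1 = a → Y j ∉ O
  ne : ∀ j l, (X j).1 = a → l ≠ j → Y j ≠ (X l).2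
  exists_of_ne : ∀ j, Y j ≠ (X j).2 → ∃ l, (X l).1 ≠ a ∧ (X l).2 = (X j).2

/-- A linkage of the shifted columns in `G` gives a linkage of the original vertices of the
prism. -/
lemma IsShift.linkage {κ : Type} {a : Bool} {O : Finset V} {X : κ × Bool → Bool × V}
    {Y : κ × Bool → V} (hY : IsShift G a O X Y) (hX : Function.Injective X) {C : κ → Set V}
    (hC : Pairwise (Function.onFun Disjoint C))
    (hCY : ∀ k, G.ReachIn (C k) (Y (k, false)) (Y (k, true))) :
    ∃ D : κ → Set (Bool × V), Pairwise (Function.onFun Disjoint D) ∧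
      (∀ k, G.prism.ReachIn (D k) (X (k, false)) (X (k, true))) ∧
      (∀ k x, (a, x) ∈ D k → ∃ j, (X j).1 = a ∧ (x = (X j).2 ∨ x = Y j)) ∧
      ∀ k x, (!a, x) ∈ D k → x ∈ C k := by
  let D : κ → Set (Bool × V) := fun k => {w | (w.1 = a ∧ ∃ c, (X (k, c)).1 = a ∧
    (w.2 = (X (k, c)).2 ∨ w.2 = Y (k, c))) ∨ (w.1 ≠ a ∧ w.2 ∈ C k)}
  have hYC : ∀ k c, Y (k, c) ∈ C k := by
    rintro k (_ | _)
    exacts [(hCY k).mem_left, (hCY k).mem_right]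
  have hmove : ∀ k c, G.prism.ReachIn (D k) (X (k, c)) (!a, Y (k, c)) := by
    intro k c
    have hend : (!a, Y (k, c)) ∈ D k := Or.inr ⟨by simp, hYC k c⟩
    by_cases ha : (X (k, c)).1 = a
    · have h1 : X (k, c) ∈ D k := Or.inl ⟨ha, c, ha, Or.inl rfl⟩
      have h2 : (a, Y (k, c)) ∈ D k := Or.inl ⟨rfl, c, ha, Or.inr rfl⟩
      have h3 : X (k, c) = (a, (X (k, c)).2) := Prod.ext ha rfl
      refine ReachIn.trans (v := (a, Y (k, c))) ?_ (.of_adj (prism_adj_cross (by simp) _) h2 hend)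
      rcases hY.eq_or_adj (k, c) with h | h
      · rw [h, ← h3]
        exact .refl h1
      · rw [h3] at h1 ⊢
        exact .of_adj (prism_adj_side a h) h1 h2
    · have h : X (k, c) = (!a, Y (k, c)) := by
        refine Prod.ext ?_ (hY.eq_of_ne _ ha).symm
        cases h : (X (k, c)).1 <;> cases a <;> simp_all
      rw [h]
      exact .refl hend
  refine ⟨D, ?_, ?_, ?_, ?_⟩
  · intro k l hkl
    refine Set.disjoint_left.2 ?_
    rintro ⟨b, x⟩ (⟨rfl, c, hc, h⟩ | ⟨hb, hx⟩) (⟨h', c', hc', h''⟩ | ⟨hb', hx'⟩)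
    · have hne : (k, c) ≠ (l, c') := by simp [hkl]
      rcases h with rfl | rfl <;> rcases h'' with h'' | h''
      · exact hne (hX (Prod.ext (hc.trans hc'.symm) h''))
      · exact hY.ne _ _ hc' hne h''.symm
      · exact hY.ne _ _ hc hne.symm h''
      · exact hne (hY.inj h'')
    · exact hb' rfl
    · exact hb h'
    · exact Set.disjoint_left.1 (hC hkl) hx hx'
  · intro k
    refine ((hmove k false).trans ?_).trans (hmove k true).symm
    exact (hCY k).prism (!a) fun x hx => Or.inr ⟨by simp, hx⟩
  · rintro k x (⟨-, c, h⟩ | ⟨h, -⟩)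
    · exact ⟨(k, c), h⟩
    · exact absurd rfl h
  · rintro k x (⟨h, -⟩ | ⟨-, h⟩)
    · simp at h
    · exact h

/-- The properties of the `n`-dimensional cube used in linking: it is triangle-free, has minimum
degree `n`, and removing at most `n` vertices leaves all non-isolated vertices connected. -/
structure CubeLike [Fintype V] (G : SimpleGraph V) (n : ℕ) : Prop where
  two_le : 2 ≤ n
  lt_card : n + 1 < Fintype.card V
  exists_adj : ∀ x (S : Finset V), S.card < n → ∃ y, G.Adj x y ∧ y ∉ S
  no_triangle : ∀ x y z, G.Adj x y → G.Adj y z → ¬ G.Adj x z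
  reachIn : ∀ S : Finset V, S.card ≤ n → ∀ s t, s ∉ S → t ∉ S →
    (∃ u, G.Adj s u ∧ u ∉ S) → (∃ u, G.Adj t u ∧ u ∉ S) → G.ReachIn (↑S)ᶜ s t

namespace CubeLike

variable [Fintype V]

lemma exists_adj_of_not_adj (hG : G.CubeLike n) {x z : V} {S : Finset V} (hS : S.card ≤ n)
    (hz : z ∈ S) (hxz : ¬ G.Adj x z) : ∃ y, G.Adj x y ∧ y ∉ S := by
  classical
  have := Finset.card_erase_lt_of_mem hz
  obtain ⟨y, hy, hyS⟩ := hG.exists_adj x (S.erase z) (by omega)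
  refine ⟨y, hy, fun h => hyS (Finset.mem_erase.2 ⟨?_, h⟩)⟩
  rintro rfl
  exact hxz hy

lemma reachIn_of_card_lt (hG : G.CubeLike n) {S : Finset V} (hS : S.card < n) {s t : V}
    (hs : s ∉ S) (ht : t ∉ S) : G.ReachIn (↑S)ᶜ s t :=
  hG.reachIn S hS.le s t hs ht (hG.exists_adj s S hS) (hG.exists_adj t S hS)

lemma of_iso [Fintype V'] (e : G ≃g G') (hG : G.CubeLike n) : G'.CubeLike n where
  two_le := hG.two_le
  lt_card := by rw [← Fintype.card_congr e.toEquiv]; exact hG.lt_card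
  exists_adj x S hS := by
    classical
    obtain ⟨y, hy, hyS⟩ := hG.exists_adj (e.symm x) (S.image e.symm)
      (Finset.card_image_le.trans_lt hS)
    refine ⟨e y, ?_, fun h => hyS (Finset.mem_image.2 ⟨_, h, by simp⟩)⟩
    simpa using e.map_adj_iff.2 hy
  no_triangle x y z h1 h2 h3 := hG.no_triangle _ _ _ (e.symm.map_adj_iff.2 h1)
    (e.symm.map_adj_iff.2 h2) (e.symm.map_adj_iff.2 h3)
  reachIn S hS s t hs ht hsu htu := by
    classical
    have key : ∀ x, e.symm x ∈ S.image e.symm ↔ x ∈ S := by simp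
    have := hG.reachIn (S.image e.symm) (Finset.card_image_le.trans hS) (e.symm s) (e.symm t)
      (by rwa [key]) (by rwa [key])
      (by
        obtain ⟨u, hu, huS⟩ := hsu
        exact ⟨e.symm u, e.symm.map_adj_iff.2 hu, by rwa [key]⟩)
      (by
        obtain ⟨u, hu, huS⟩ := htu
        exact ⟨e.symm u, e.symm.map_adj_iff.2 hu, by rwa [key]⟩)
    have := this.map (C' := (↑S)ᶜ) e.toHom (fun x hx => by
      simp only [Set.mem_compl_iff, Finset.mem_coe] at hx ⊢
      intro h
      exact hx (Finset.mem_image.2 ⟨_, h, by simp⟩))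
    simpa using this

/-- The prism over an `n`-cube-like graph is `(n + 1)`-cube-like. -/
lemma prism (hG : G.CubeLike n) : G.prism.CubeLike (n + 1) where
  two_le := by have := hG.two_le; omega
  lt_card := by
    have := hG.lt_card
    simp only [Fintype.card_prod, Fintype.card_bool]
    omega
  exists_adj x S hS := by
    classical
    obtain ⟨a, x⟩ := x
    by_cases h : (!a, x) ∈ S
    · obtain ⟨y, hy, hyS⟩ := hG.exists_adj x ((S.erase (!a, x)).image Prod.snd) (by
        have := Finset.card_erase_lt_of_mem h
        have := Finset.card_image_le (s := S.erase (!a, x)) (f := Prod.snd)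
        omega)
      refine ⟨(a, y), prism_adj_side a hy, fun h' => hyS ?_⟩
      exact Finset.mem_image.2 ⟨(a, y), Finset.mem_erase.2 ⟨by simp, h'⟩, rfl⟩
    · exact ⟨(!a, x), prism_adj_cross (by simp) x, h⟩
  no_triangle := by
    rintro ⟨a, x⟩ ⟨b, y⟩ ⟨c, z⟩ h1 h2 h3
    simp only [boxProd_adj, top_adj] at h1 h2 h3
    have := hG.no_triangle x y z
    rcases h1 with ⟨h1, rfl⟩ | ⟨h1, rfl⟩ <;> rcases h2 with ⟨h2, rfl⟩ | ⟨h2, rfl⟩ <;>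
      rcases h3 with ⟨h3, h4⟩ | ⟨h3, h4⟩ <;> simp_all
    cases a <;> cases b <;> cases c <;> simp_all
  reachIn S hS := by
    classical
    have h2 := hG.two_le
    let T : Bool → Finset V := fun b => (S.filter (·.1 = b)).image Prod.snd
    have hT : ∀ b x, x ∈ T b ↔ (b, x) ∈ S := by
      intro b x
      simp only [T, Finset.mem_image, Finset.mem_filter]
      constructor
      · rintro ⟨⟨c, y⟩, ⟨h, rfl⟩, rfl⟩
        exact h
      · exact fun h => ⟨_, ⟨h, rfl⟩, rfl⟩
    have hcard : ∀ c, (T c).card + (T (!c)).card ≤ n + 1 := by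
      intro c
      refine le_trans (add_le_add Finset.card_image_le Finset.card_image_le) ?_
      have : S.filter (·.1 = !c) = S.filter (fun x => ¬ x.1 = c) := by
        refine Finset.filter_congr fun x _ => ?_
        cases x.1 <;> cases c <;> simp
      rw [this, Finset.card_filter_add_card_filter_not]
      exact hS
    have hside : ∀ c, (T c).card < n → ∀ x y, (c, x) ∉ S → (c, y) ∉ S →
        G.prism.ReachIn (↑S)ᶜ (c, x) (c, y) := by
      intro c hc x y hx hy
      refine (hG.reachIn_of_card_lt hc (by rwa [hT]) (by rwa [hT])).prism c fun z hz => ?_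
      simpa [hT] using hz
    obtain ⟨c, hc, key⟩ : ∃ c, (T c).card < n ∧ ∀ x, (!c, x) ∉ S →
        (∃ u, G.prism.Adj (!c, x) u ∧ u ∉ S) →
        ∃ z, (c, z) ∉ S ∧ G.prism.ReachIn (↑S)ᶜ (!c, x) (c, z) := by
      by_cases hall : ∀ c, (T c).card < n
      · refine ⟨false, hall _, fun x hx _ => ?_⟩
        obtain ⟨z, hz⟩ : ∃ z, z ∉ T false ∪ T true := by
          by_contra! h
          have h1 : (T false ∪ T true) = Finset.univ := Finset.eq_univ_iff_forall.2 h
          have h3 := Finset.card_union_le (T false) (T true)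
          rw [h1, Finset.card_univ] at h3
          have := hcard false
          have := hG.lt_card
          simp only [Bool.not_false] at *
          omega
        simp only [Finset.mem_union, hT, not_or] at hz
        exact ⟨z, hz.1, (hside _ (hall _) _ _ hx hz.2).trans
          (.of_adj (prism_adj_cross (by simp) z) hz.2 hz.1)⟩
      · push Not at hall
        obtain ⟨b, hb⟩ := hall
        have hcb := hcard b
        refine ⟨!b, by omega, fun x hx hu => ?_⟩
        rw [Bool.not_not] at *
        by_cases hxb : (!b, x) ∈ S
        · obtain ⟨⟨d, y⟩, hadj, hyS⟩ := hu
          simp only [boxProd_adj, top_adj] at hadj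
          rcases hadj with ⟨hbd, rfl⟩ | ⟨hxy, rfl⟩
          · obtain rfl : d = !b := by cases b <;> cases d <;> simp_all
            exact absurd hxb hyS
          · have hy : (!b, y) ∉ S := by
              intro hy
              have : (T (!b)).card ≤ 1 := by omega
              exact hxy.ne (Finset.card_le_one.1 this x ((hT _ _).2 hxb) y ((hT _ _).2 hy))
            exact ⟨y, hy, .trans (.of_adj (prism_adj_side b hxy) hx hyS)
              (.of_adj (prism_adj_cross (by simp) y) hyS hy)⟩
        · exact ⟨x, hxb, .of_adj (prism_adj_cross (by simp) x) hx hxb⟩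
    have key' : ∀ s, s ∉ S → (∃ u, G.prism.Adj s u ∧ u ∉ S) →
        ∃ z, (c, z) ∉ S ∧ G.prism.ReachIn (↑S)ᶜ s (c, z) := by
      rintro ⟨d, x⟩ hs hu
      by_cases hd : d = c
      · subst hd
        exact ⟨x, hs, .refl hs⟩
      · obtain rfl : d = !c := by cases c <;> cases d <;> simp_all
        exact key x hs hu
    intro s t hs ht hsu htu
    obtain ⟨x, hx, hsx⟩ := key' s hs hsu
    obtain ⟨y, hy, hty⟩ := key' t ht htu
    exact (hsx.trans (hside c hc x y hx hy)).trans hty.symm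

/-- In a cube-like graph, the vertices of `B ⊆ F` can be matched to neighbours outside `F`. -/
lemma exists_matching (hG : G.CubeLike n) {F B : Finset V} (hBF : B ⊆ F)
    (hcard : F.card + B.card ≤ n + 2) (hfree : ∀ x ∈ B, ∃ y, G.Adj x y ∧ y ∉ F) :
    ∃ y : V → V, Set.InjOn y B ∧ ∀ x ∈ B, G.Adj x (y x) ∧ y x ∉ F := by
  classical
  suffices h : ∀ T ⊆ B, ∃ y : V → V, Set.InjOn y T ∧ ∀ x ∈ T, G.Adj x (y x) ∧ y x ∉ F from
    h B subset_rfl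
  intro T
  induction T using Finset.induction_on with
  | empty => exact fun _ => ⟨id, by simp⟩
  | insert x T hxT ih =>
    intro hT
    obtain ⟨y, hinj, hy⟩ := ih ((Finset.subset_insert _ _).trans hT)
    have hxB : x ∈ B := hT (Finset.mem_insert_self _ _)
    obtain ⟨z, hxz, hzF, hzT⟩ : ∃ z, G.Adj x z ∧ z ∉ F ∧ z ∉ T.image y := by
      rcases T.eq_empty_or_nonempty with rfl | ⟨w, hw⟩
      · simpa using hfree x hxB
      · have hS : (F.erase x ∪ T.image y).card ≤ n := by
          have h1 := Finset.card_union_le (F.erase x) (T.image y)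
          have h2 := Finset.card_erase_lt_of_mem (hBF hxB)
          have h3 := Finset.card_image_le (s := T) (f := y)
          have h4 := Finset.card_le_card hT
          rw [Finset.card_insert_of_notMem hxT] at h4
          omega
        have hwF : w ∈ F := hBF (hT (Finset.mem_insert_of_mem hw))
        have hwx : w ≠ x := by
          rintro rfl
          exact hxT hw
        obtain ⟨k, hk, hkx⟩ : ∃ k ∈ F.erase x ∪ T.image y, ¬ G.Adj x k := by
          by_contra! h
          have h1 := h w (by simp [hwF, hwx])
          have h2 := h (y w) (Finset.mem_union_right _ (Finset.mem_image_of_mem _ hw))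
          exact hG.no_triangle _ _ _ h1 (hy w hw).1 h2
        obtain ⟨z, hz, hzS⟩ := hG.exists_adj_of_not_adj hS hk hkx
        rw [Finset.mem_union, not_or, Finset.mem_erase, not_and] at hzS
        exact ⟨z, hz, hzS.1 hz.ne', hzS.2⟩
    refine ⟨Function.update y x z, ?_, ?_⟩
    · rw [Finset.coe_insert, Set.injOn_insert (by simpa using hxT)]
      have heq : Set.EqOn (Function.update y x z) y T := fun u hu =>
        Function.update_of_ne (by rintro rfl; exact hxT hu) _ _
      refine ⟨heq.injOn_iff.2 hinj, ?_⟩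
      rw [Function.update_self, heq.image_eq, ← Finset.coe_image, Finset.mem_coe]
      exact hzT
    · intro u hu
      rcases Finset.mem_insert.1 hu with rfl | huT
      · simpa using ⟨hxz, hzF⟩
      · rw [Function.update_of_ne (by rintro rfl; exact hxT huT)]
        exact hy u huT

lemma exists_shift (hG : G.CubeLike n) {τ : Type} [Fintype τ] (a : Bool) (O : Finset V)
    (X : τ → Bool × V) (hX : Function.Injective X) (hO : ∀ j, (X j).1 = a → (X j).2 ∉ O)
    (hcard : Fintype.card τ + O.card ≤ n + 2)
    (hfree : ∀ j l, (X j).1 = a → (X l).1 ≠ a → (X l).2 = (X j).2 →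
      ∃ y, G.Adj (X j).2 y ∧ (∀ q, (X q).2 ≠ y) ∧ y ∉ O) :
    ∃ Y : τ → V, IsShift G a O X Y := by
  classical
  let J : Finset τ := Finset.univ.filter fun j => (X j).1 = a ∧ ∃ l, (X l).1 ≠ a ∧ (X l).2 = (X j).2
  have hJ : ∀ j, j ∈ J ↔ (X j).1 = a ∧ ∃ l, (X l).1 ≠ a ∧ (X l).2 = (X j).2 := by simp [J]
  let Z : Finset V := Finset.univ.image fun j => (X j).2
  let B : Finset V := J.image fun j => (X j).2
  have hZ : ∀ x, x ∈ Z ↔ ∃ j, (X j).2 = x := by simp [Z]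
  have hZ' : Z ⊆ Jᶜ.image fun j => (X j).2 := by
    intro x hx
    obtain ⟨j, rfl⟩ := (hZ x).1 hx
    by_cases hj : j ∈ J
    · obtain ⟨-, l, hl, hlj⟩ := (hJ j).1 hj
      exact Finset.mem_image.2 ⟨l, by simp [hJ, hl], hlj⟩
    · exact Finset.mem_image.2 ⟨j, by simpa using hj, rfl⟩
  have hZcard : Z.card + J.card ≤ Fintype.card τ := by
    have h1 := (Finset.card_le_card hZ').trans Finset.card_image_le
    rw [Finset.card_compl] at h1
    have := Finset.card_le_univ J
    omega
  have hBcard : B.card ≤ J.card := Finset.card_image_le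
  have hBZ : B ⊆ Z := Finset.image_subset_image (Finset.subset_univ _)
  obtain ⟨y, hyinj, hy⟩ := hG.exists_matching (F := Z ∪ O) (B := B)
    (hBZ.trans Finset.subset_union_left)
    (by have := Finset.card_union_le Z O; omega)
    (by
      intro x hx
      obtain ⟨j, hj, rfl⟩ := Finset.mem_image.1 hx
      obtain ⟨hja, l, hl, hlj⟩ := (hJ j).1 hj
      obtain ⟨z, hz, hz', hzO⟩ := hfree j l hja hl hlj
      refine ⟨z, hz, ?_⟩
      rw [Finset.mem_union, not_or, hZ, not_exists]
      exact ⟨hz', hzO⟩)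
  have hyJ : ∀ j ∈ J, G.Adj (X j).2 (y (X j).2) ∧ (∀ q, (X q).2 ≠ y (X j).2) ∧
      y (X j).2 ∉ O := by
    intro j hj
    have := hy (X j).2 (Finset.mem_image_of_mem _ hj)
    rwa [Finset.mem_union, not_or, hZ, not_exists] at this
  have hcol : ∀ j l, (X j).1 = a → l ≠ j → j ∉ J → (X j).2 ≠ (X l).2 := by
    intro j l hja hlj hj h
    rw [hJ, not_and, not_exists] at hj
    refine hj hja l ⟨fun hla => hlj (hX (Prod.ext (hla.trans hja.symm) h.symm)), h.symm⟩
  refine ⟨fun j => if j ∈ J then y (X j).2 else (X j).2, ?_, ?_, ?_, ?_, ?_, ?_⟩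
  · intro j l hjl
    by_cases hj : j ∈ J <;> by_cases hl : l ∈ J
    · simp only [hj, hl, if_true] at hjl
      have := hyinj (Finset.mem_coe.2 (Finset.mem_image_of_mem _ hj))
        (Finset.mem_coe.2 (Finset.mem_image_of_mem _ hl)) hjl
      exact hX (Prod.ext (((hJ j).1 hj).1.trans ((hJ l).1 hl).1.symm) this)
    · simp only [hj, hl, if_true, if_false] at hjl
      exact absurd hjl.symm ((hyJ j hj).2.1 l)
    · simp only [hj, hl, if_true, if_false] at hjl
      exact absurd hjl ((hyJ l hl).2.1 j)
    · simp only [hj, hl, if_false] at hjl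
      by_contra hne
      by_cases hja : (X j).1 = a
      · exact hcol j l hja (Ne.symm hne) hj hjl
      · by_cases hla : (X l).1 = a
        · exact hcol l j hla hne hl hjl.symm
        · refine hne (hX (Prod.ext ?_ hjl))
          cases h1 : (X j).1 <;> cases h2 : (X l).1 <;> cases a <;> simp_all
  · intro j hj
    have : j ∉ J := fun h => hj ((hJ j).1 h).1
    simp [this]
  · intro j
    by_cases hj : j ∈ J
    · simp [hj, (hyJ j hj).1]
    · simp [hj]
  · intro j hja
    by_cases hj : j ∈ J
    · simpa [hj] using (hyJ j hj).2.2
    · simpa [hj] using hO j hja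
  · intro j l hja hlj
    by_cases hj : j ∈ J
    · simpa [hj] using ((hyJ j hj).2.1 l).symm
    · simpa [hj] using hcol j l hja hlj hj
  · intro j hne
    by_cases hj : j ∈ J
    · exact ((hJ j).1 hj).2
    · simp [hj] at hne

/-- If a linkage in `G` can always avoid one further vertex, then in the prism over `G` one can
join `s` to `t` within the side `a` and simultaneously link the pairs given by `X`. -/
lemma exists_path_and_linkage (hG : G.CubeLike n) {κ : Type} [Fintype κ] (a : Bool) {s t : V}
    {X : κ × Bool → Bool × V} (hX : Function.Injective X) (hs : ∀ j, X j ≠ (a, s))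
    (ht : ∀ j, X j ≠ (a, t)) (hcard : Fintype.card κ * 2 ≤ n)
    (hfree : ∀ j l, (X j).1 = a → (X l).1 ≠ a → (X l).2 = (X j).2 →
      ∃ y, G.Adj (X j).2 y ∧ (∀ q, (X q).2 ≠ y) ∧ y ≠ s ∧ y ≠ t)
    (hns : (∀ j, (X j).1 = a) → ∃ y, G.Adj s y ∧ ∀ j, (X j).2 ≠ y)
    (hnt : (∀ j, (X j).1 = a) → ∃ y, G.Adj t y ∧ ∀ j, (X j).2 ≠ y)
    (hlink : ∀ g : κ × Bool → V, Function.Injective g → ∀ v, (∀ j, g j ≠ v) →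
      G.HasLinkage {v} g) :
    ∃ (C : Set (Bool × V)) (D : κ → Set (Bool × V)), G.prism.ReachIn C (a, s) (a, t) ∧
      (∀ w ∈ C, w.1 = a) ∧ Pairwise (Function.onFun Disjoint D) ∧ (∀ k, Disjoint C (D k)) ∧
      (∀ k, G.prism.ReachIn (D k) (X (k, false)) (X (k, true))) ∧
      ((∀ j, X j ≠ (!a, s)) → ∀ k, (!a, s) ∉ D k) := by
  classical
  have hτ : Fintype.card (κ × Bool) ≤ n := by simpa using hcard
  have hst : ∀ j, (X j).1 = a → (X j).2 ∉ ({s, t} : Finset V) := by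
    intro j hj h
    rcases Finset.mem_insert.1 h with h | h
    · exact hs j (Prod.ext hj h)
    · exact ht j (Prod.ext hj (Finset.mem_singleton.1 h))
  obtain ⟨Y, hY⟩ := hG.exists_shift a {s, t} X hX hst
    (by have := Finset.card_le_two (a := s) (b := t); omega)
    (fun j l h1 h2 h3 => by simpa using hfree j l h1 h2 h3)
  let A : Finset (κ × Bool) := Finset.univ.filter fun j => (X j).1 = a
  have hA : ∀ j, j ∈ A ↔ (X j).1 = a := by simp [A]
  let W : Finset V := A.image (fun j => (X j).2) ∪ A.image Y
  have hWX : ∀ j ∈ A, (X j).2 ∈ W := fun j hj =>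
    Finset.mem_union_left _ (Finset.mem_image_of_mem (fun j => (X j).2) hj)
  have hWY : ∀ j ∈ A, Y j ∈ W := fun j hj =>
    Finset.mem_union_right _ (Finset.mem_image_of_mem _ hj)
  have hWcases : ∀ x ∈ W, ∃ j ∈ A, x = (X j).2 ∨ x = Y j := by
    intro x hx
    rcases Finset.mem_union.1 hx with h | h <;> obtain ⟨j, hj, rfl⟩ := Finset.mem_image.1 h
    exacts [⟨j, hj, Or.inl rfl⟩, ⟨j, hj, Or.inr rfl⟩]
  have hWcard : W.card ≤ n := by
    let J := A.filter fun j => Y j ≠ (X j).2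
    have h1 : W ⊆ A.image (fun j => (X j).2) ∪ J.image Y := by
      intro x hx
      obtain ⟨j, hj, rfl | rfl⟩ := hWcases x hx
      · exact Finset.mem_union_left _ (Finset.mem_image_of_mem (fun j => (X j).2) hj)
      · by_cases h : Y j = (X j).2
        · rw [h]
          exact Finset.mem_union_left _ (Finset.mem_image_of_mem (fun j => (X j).2) hj)
        · exact Finset.mem_union_right _ (Finset.mem_image_of_mem _ (Finset.mem_filter.2 ⟨hj, h⟩))
    have h2 : J.card ≤ Aᶜ.card := by
      have hinj : Set.InjOn (fun j => (X j).2) J := by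
        intro j hj l hl hjl
        have hj' := (hA j).1 (Finset.mem_filter.1 hj).1
        have hl' := (hA l).1 (Finset.mem_filter.1 hl).1
        exact hX (Prod.ext (hj'.trans hl'.symm) hjl)
      rw [← Finset.card_image_of_injOn hinj]
      refine (Finset.card_le_card ?_).trans (Finset.card_image_le (f := fun j => (X j).2))
      intro x hx
      obtain ⟨j, hj, rfl⟩ := Finset.mem_image.1 hx
      obtain ⟨l, hl, hlj⟩ := hY.exists_of_ne j (Finset.mem_filter.1 hj).2
      exact Finset.mem_image.2 ⟨l, by simp [hA, hl], hlj⟩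
    have h3 := (Finset.card_le_card h1).trans (Finset.card_union_le _ _)
    have h4 := Finset.card_image_le (s := A) (f := fun j => (X j).2)
    have h5 := Finset.card_image_le (s := J) (f := Y)
    have h6 := Finset.card_compl_add_card A
    omega
  have hnbr : ∀ x, ((∀ j, (X j).1 = a) → ∃ y, G.Adj x y ∧ ∀ j, (X j).2 ≠ y) →
      ∃ u, G.Adj x u ∧ u ∉ W := by
    intro x hx
    by_contra! h
    have hWadj : ∀ w ∈ W, G.Adj x w := by
      intro w hw
      by_contra hxw
      obtain ⟨y, hy, hyW⟩ := hG.exists_adj_of_not_adj hWcard hw hxw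
      exact hyW (h y hy)
    have hYX : ∀ j ∈ A, Y j = (X j).2 := fun j hj => (hY.eq_or_adj j).resolve_right fun hadj =>
      hG.no_triangle _ _ _ (hWadj _ (hWX j hj)) hadj (hWadj _ (hWY j hj))
    have hWA : W ⊆ A.image fun j => (X j).2 := by
      intro w hw
      obtain ⟨j, hj, rfl | rfl⟩ := hWcases w hw
      · exact Finset.mem_image_of_mem (fun j => (X j).2) hj
      · rw [hYX j hj]
        exact Finset.mem_image_of_mem (fun j => (X j).2) hj
    have hnW : n ≤ W.card := by
      by_contra! hlt
      obtain ⟨y, hy, hyW⟩ := hG.exists_adj x W hlt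
      exact hyW (h y hy)
    have hAuniv : A = Finset.univ := by
      rw [← Finset.card_eq_iff_eq_univ]
      have h1 := (Finset.card_le_card hWA).trans Finset.card_image_le
      have h2 := Finset.card_le_univ A
      omega
    obtain ⟨y, hy, hyX⟩ := hx fun j => (hA j).1 (hAuniv ▸ Finset.mem_univ j)
    obtain ⟨j, -, hj⟩ := Finset.mem_image.1 (hWA (h y hy))
    exact hyX j hj
  have hW : ∀ x, (∀ j, X j ≠ (a, x)) → x ∈ ({s, t} : Finset V) → x ∉ W := by
    intro x hx hxO hxW
    obtain ⟨j, hj, rfl | rfl⟩ := hWcases x hxW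
    · exact hx j (Prod.ext ((hA j).1 hj) rfl)
    · exact hY.notMem j ((hA j).1 hj) hxO
  have hL := hG.reachIn W hWcard s t (hW s hs (by simp)) (hW t ht (by simp)) (hnbr s hns)
    (hnbr t hnt)
  obtain ⟨v, hvY, hvs⟩ : ∃ v, (∀ j, Y j ≠ v) ∧ ((∀ j, X j ≠ (!a, s)) → v = s) := by
    by_cases h : ∀ j, X j ≠ (!a, s)
    · refine ⟨s, fun j hj => ?_, fun _ => rfl⟩
      by_cases hja : (X j).1 = a
      · exact hY.notMem j hja (by simp [hj])
      · refine h j (Prod.ext ?_ ((hY.eq_of_ne j hja).symm.trans hj))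
        cases h : (X j).1 <;> cases a <;> simp_all
    · obtain ⟨v, hv⟩ : ∃ v, v ∉ Finset.univ.image Y := by
        by_contra! hall
        have h1 := Finset.card_image_le (s := Finset.univ) (f := Y)
        rw [Finset.eq_univ_iff_forall.2 hall, Finset.card_univ, Finset.card_univ] at h1
        have := hG.lt_card
        omega
      exact ⟨v, by simpa using hv, fun h' => absurd h' h⟩
  obtain ⟨C, hC, hCv, hCY⟩ := hlink Y hY.inj v hvY
  obtain ⟨D, hD, hDX, hDa, hDb⟩ := hY.linkage hX hC hCY
  refine ⟨{w | w.1 = a ∧ w.2 ∉ W}, D, hL.prism a fun x hx => ⟨rfl, hx⟩, fun w hw => hw.1, hD,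
    fun k => Set.disjoint_left.2 ?_, hDX, fun h k hk => ?_⟩
  · rintro ⟨b, x⟩ ⟨rfl, hx⟩ hxD
    obtain ⟨j, hj, hxj⟩ := hDa k x hxD
    rcases hxj with rfl | rfl
    · exact hx (hWX j ((hA j).2 hj))
    · exact hx (hWY j ((hA j).2 hj))
  · have := hDb k s hk
    rw [hvs h] at hCv
    exact Set.disjoint_left.1 (hCv k) this rfl

/-- Linkages in `G` yield linkages in the prism over `G` that avoid a prescribed vertex. -/
lemma hasLinkage_prism (hG : G.CubeLike n) {κ : Type} [Fintype κ] (a : Bool) (v : V)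
    {X : κ × Bool → Bool × V} (hX : Function.Injective X) (hv : ∀ j, X j ≠ (a, v))
    (hcard : Fintype.card κ * 2 ≤ n + 1)
    (hfree : ∀ j l, (X j).1 = a → (X l).1 ≠ a → (X l).2 = (X j).2 →
      ∃ y, G.Adj (X j).2 y ∧ (∀ q, (X q).2 ≠ y) ∧ y ≠ v)
    (hlink : ∀ g : κ × Bool → V, Function.Injective g → G.HasLinkage ∅ g) :
    G.prism.HasLinkage {(a, v)} X := by
  obtain ⟨Y, hY⟩ := hG.exists_shift a {v} X hX
    (fun j hj h => hv j (Prod.ext hj (Finset.mem_singleton.1 h)))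
    (by simpa using hcard) (fun j l h1 h2 h3 => by simpa using hfree j l h1 h2 h3)
  obtain ⟨C, hC, -, hCY⟩ := hlink Y hY.inj
  obtain ⟨D, hD, hDX, hDa, -⟩ := hY.linkage hX hC hCY
  refine ⟨D, hD, fun k => Set.disjoint_singleton_right.2 fun hk => ?_, hDX⟩
  obtain ⟨j, hj, rfl | rfl⟩ := hDa k v hk
  · exact hv j (Prod.ext hj rfl)
  · exact hY.notMem j hj (Finset.mem_singleton_self _)

end CubeLike

/-- `s` can be joined to `t`, and `x` to `y`, inside disjoint vertex sets avoiding `v`. -/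
def TwoLinked (G : SimpleGraph V) (v s t x y : V) : Prop :=
  ∃ C D : Set V, Disjoint C D ∧ v ∉ C ∧ v ∉ D ∧ G.ReachIn C s t ∧ G.ReachIn D x y

namespace TwoLinked

variable {s t x y : V}

lemma swap (h : G.TwoLinked v x y s t) : G.TwoLinked v s t x y := by
  obtain ⟨C, D, h1, h2, h3, h4, h5⟩ := h
  exact ⟨D, C, h1.symm, h3, h2, h5, h4⟩

lemma symm_left (h : G.TwoLinked v t s x y) : G.TwoLinked v s t x y := by
  obtain ⟨C, D, h1, h2, h3, h4, h5⟩ := h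
  exact ⟨C, D, h1, h2, h3, h4.symm, h5⟩

lemma symm_right (h : G.TwoLinked v s t y x) : G.TwoLinked v s t x y :=
  h.swap.symm_left.swap

lemma of_iso (e : G ≃g G') (h : G'.TwoLinked (e v) (e s) (e t) (e x) (e y)) :
    G.TwoLinked v s t x y := by
  obtain ⟨C, D, h1, h2, h3, h4, h5⟩ := h
  refine ⟨e ⁻¹' C, e ⁻¹' D, h1.preimage e, h2, h3, ?_, ?_⟩
  · simpa using h4.map (C' := e ⁻¹' C) e.symm.toHom (by simp)
  · simpa using h5.map (C' := e ⁻¹' D) e.symm.toHom (by simp)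

end TwoLinked

namespace CubeLike

lemma exists_reachIn_opposite (a : Bool) {x v : Bool × V} {Q : Finset (Bool × V)} (hxQ : x ∈ Q)
    (hxv : x ≠ v) (h : x.1 = a → (!a, x.2) ≠ v) :
    ∃ z, (!a, z) ≠ v ∧ G.prism.ReachIn {w | (w.1 ≠ a ∨ w ∈ Q) ∧ w ≠ v} x (!a, z) := by
  obtain ⟨b, x⟩ := x
  by_cases hb : b = a
  · subst hb
    exact ⟨x, h rfl, .of_adj (prism_adj_cross (by simp) x) ⟨Or.inr hxQ, hxv⟩
      ⟨Or.inl (by simp), h rfl⟩⟩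
  · obtain rfl : b = !a := by cases a <;> cases b <;> simp_all
    exact ⟨x, hxv, .refl ⟨Or.inr hxQ, hxv⟩⟩

variable [Fintype V]

/-- If `Q` blocks neither `s` nor `t` on the side `a`, and `x`, `y` can reach the opposite side
through `Q`, then the pairs `s`, `t` and `x`, `y` are linked. -/
lemma twoLinked_of_separate (hG : G.CubeLike 3) (a : Bool) {s t : V} {x y v : Bool × V}
    (Q : Finset (Bool × V)) (hQ : Q.card ≤ 3) (hs : (a, s) ∉ Q) (ht : (a, t) ∉ Q)
    (hv : v.1 = a → v ∈ Q) (hns : ∃ u, G.Adj s u ∧ (a, u) ∉ Q) (hnt : ∃ u, G.Adj t u ∧ (a, u) ∉ Q)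
    (hx : ∃ z, (!a, z) ≠ v ∧ G.prism.ReachIn {w | (w.1 ≠ a ∨ w ∈ Q) ∧ w ≠ v} x (!a, z))
    (hy : ∃ z, (!a, z) ≠ v ∧ G.prism.ReachIn {w | (w.1 ≠ a ∨ w ∈ Q) ∧ w ≠ v} y (!a, z)) :
    G.prism.TwoLinked v (a, s) (a, t) x y := by
  classical
  let W : Finset V := Finset.univ.filter fun z => (a, z) ∈ Q
  have hW : ∀ z, z ∈ W ↔ (a, z) ∈ Q := by simp [W]
  have hWcard : W.card ≤ 3 := by
    refine le_trans ?_ hQ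
    exact Finset.card_le_card_of_injOn (fun z => (a, z)) (fun z hz => (hW z).1 hz)
      fun z _ z' _ h => congrArg Prod.snd h
  refine ⟨{w | w.1 = a ∧ w ∉ Q}, {w | (w.1 ≠ a ∨ w ∈ Q) ∧ w ≠ v}, ?_, ?_, by simp, ?_, ?_⟩
  · refine Set.disjoint_left.2 ?_
    rintro w ⟨h1, h2⟩ ⟨h3 | h3, -⟩
    exacts [h3 h1, h2 h3]
  · rintro ⟨h1, h2⟩
    exact h2 (hv h1)
  · refine (hG.reachIn W hWcard s t (by rwa [hW]) (by rwa [hW]) (by simpa [hW] using hns)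
      (by simpa [hW] using hnt)).prism a fun z hz => ⟨rfl, ?_⟩
    simpa [hW] using hz
  · obtain ⟨z, hz, hxz⟩ := hx
    obtain ⟨z', hz', hyz⟩ := hy
    refine (hxz.trans ?_).trans hyz.symm
    let S : Finset V := Finset.univ.filter fun z => (!a, z) = v
    have hS : S.card ≤ 1 := by
      refine Finset.card_le_one.2 fun p hp q hq => ?_
      simp only [S, Finset.mem_filter, Finset.mem_univ, true_and] at hp hq
      exact congrArg Prod.snd (hp.trans hq.symm)
    refine (hG.reachIn_of_card_lt (S := S) (by omega) (by simpa [S] using hz)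
      (by simpa [S] using hz')).prism (!a) fun w hw => ⟨Or.inl (by simp), ?_⟩
    simpa [S] using hw

lemma twoLinked_of_obstacle_opposite (hG : G.CubeLike 3) (a : Bool) {s t x : V} {y : Bool × V}
    (hsx : s ≠ x) (htx : t ≠ x) (hsy : (a, s) ≠ y) (hty : (a, t) ≠ y) (hxy : (a, x) ≠ y)
    (hyx : y ≠ (!a, x)) (hadj : ¬ G.prism.Adj (a, x) y) :
    G.prism.TwoLinked (!a, x) (a, s) (a, t) (a, x) y := by
  classical
  obtain ⟨z, hxz, hzs, hzt, hzy⟩ : ∃ z, G.Adj x z ∧ z ≠ s ∧ z ≠ t ∧ (a, z) ≠ y := by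
    by_cases hya : y.1 = a
    · obtain ⟨z, hxz, hz⟩ := hG.exists_adj_of_not_adj (x := x) (z := y.2) (S := {s, t, y.2})
        Finset.card_le_three (by simp) (fun h => hadj (by
          have := prism_adj_side a h
          rwa [← hya] at this ⊢))
      simp only [Finset.mem_insert, Finset.mem_singleton, not_or] at hz
      exact ⟨z, hxz, hz.1, hz.2.1, fun h => hz.2.2 (by rw [← h])⟩
    · obtain ⟨z, hxz, hz⟩ := hG.exists_adj x {s, t}
        (lt_of_le_of_lt Finset.card_le_two (by norm_num))
      simp only [Finset.mem_insert, Finset.mem_singleton, not_or] at hz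
      exact ⟨z, hxz, hz.1, hz.2, fun h => hya (by rw [← h])⟩
  have hnbr : ∀ r, ∃ u, G.Adj r u ∧ (a, u) ∉ ({(a, x), y, (a, z)} : Finset (Bool × V)) := by
    intro r
    have hr : ∃ u, G.Adj r u ∧ u ∉ ({x, y.2, z} : Finset V) := by
      by_cases h1 : G.Adj r x
      · exact hG.exists_adj_of_not_adj (z := z) Finset.card_le_three (by simp)
          (hG.no_triangle _ _ _ h1 hxz)
      · exact hG.exists_adj_of_not_adj (z := x) Finset.card_le_three (by simp) h1
    obtain ⟨u, hu, huS⟩ := hr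
    simp only [Finset.mem_insert, Finset.mem_singleton, not_or] at huS
    refine ⟨u, hu, ?_⟩
    simp only [Finset.mem_insert, Finset.mem_singleton, not_or, Prod.mk.injEq, true_and]
    exact ⟨huS.1, fun h => huS.2.1 (by rw [← h]), huS.2.2⟩
  refine hG.twoLinked_of_separate a {(a, x), y, (a, z)} Finset.card_le_three ?_ ?_ (by simp)
    (hnbr s) (hnbr t) ?_ ?_
  · simp [hsx, hsy, hzs.symm]
  · simp [htx, hty, hzt.symm]
  · have h1 : (a, z) ∈ {w : Bool × V | (w.1 ≠ a ∨ w ∈ ({(a, x), y, (a, z)} : Finset (Bool × V))) ∧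
        w ≠ (!a, x)} := by simp
    refine ⟨z, by simpa using hxz.ne', .trans (.of_adj (prism_adj_side a hxz) (by simp) h1)
      (.of_adj (prism_adj_cross (by simp) z) h1 (by simpa using hxz.ne'))⟩
  · refine exists_reachIn_opposite a (by simp) hyx fun hya h => hxy ?_
    exact Prod.ext hya.symm (congrArg Prod.snd h).symm

lemma twoLinked_of_free_nbrs (hG : G.CubeLike 3) (a : Bool) {s t : V} {x y v : Bool × V}
    (hsx : (a, s) ≠ x) (htx : (a, t) ≠ x) (hsy : (a, s) ≠ y) (hty : (a, t) ≠ y)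
    (hsv : (a, s) ≠ v) (htv : (a, t) ≠ v) (hxy : x ≠ y) (hxv : x ≠ v) (hyv : y ≠ v)
    (hadj : ¬ G.prism.Adj x y)
    (hns : ∃ u, G.Adj s u ∧ (a, u) ≠ x ∧ (a, u) ≠ y ∧ (a, u) ≠ v)
    (hnt : ∃ u, G.Adj t u ∧ (a, u) ≠ x ∧ (a, u) ≠ y ∧ (a, u) ≠ v) :
    G.prism.TwoLinked v (a, s) (a, t) x y := by
  classical
  by_cases hx : x.1 = a ∧ (!a, x.2) = v
  · obtain ⟨b, x⟩ := x
    obtain ⟨rfl, rfl⟩ := hx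
    exact hG.twoLinked_of_obstacle_opposite b (by simpa using hsx) (by simpa using htx) hsy hty
      hxy hyv hadj
  by_cases hy : y.1 = a ∧ (!a, y.2) = v
  · obtain ⟨b, y⟩ := y
    obtain ⟨rfl, rfl⟩ := hy
    exact (hG.twoLinked_of_obstacle_opposite b (by simpa using hsy) (by simpa using hty) hsx htx
      hxy.symm hxv fun h => hadj h.symm).symm_right
  refine hG.twoLinked_of_separate a {x, y, v} Finset.card_le_three ?_ ?_ (by simp) ?_ ?_ ?_ ?_
  · simp [hsx, hsy, hsv]
  · simp [htx, hty, htv]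
  · simpa using hns
  · simpa using hnt
  · exact exists_reachIn_opposite a (by simp) hxv fun h h' => hx ⟨h, h'⟩
  · exact exists_reachIn_opposite a (by simp) hyv fun h h' => hy ⟨h, h'⟩

lemma twoLinked_of_same_side (hG : G.CubeLike 3) (a : Bool) {s t : V} {x y v : Bool × V}
    (hst : s ≠ t)
    (hsx : (a, s) ≠ x) (htx : (a, t) ≠ x) (hsy : (a, s) ≠ y) (hty : (a, t) ≠ y)
    (hsv : (a, s) ≠ v) (htv : (a, t) ≠ v) (hxy : x ≠ y) (hxv : x ≠ v) (hyv : y ≠ v)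
    (hadj : ¬ G.prism.Adj x y) (hadj' : ¬ G.Adj s t) :
    G.prism.TwoLinked v (a, s) (a, t) x y := by
  classical
  have main : ∀ s t : V, s ≠ t →
      (a, s) ≠ x → (a, t) ≠ x → (a, s) ≠ y → (a, t) ≠ y → (a, s) ≠ v → (a, t) ≠ v →
      ¬ G.Adj s t → (¬ ∃ u, G.Adj s u ∧ (a, u) ≠ x ∧ (a, u) ≠ y ∧ (a, u) ≠ v) →
      G.prism.TwoLinked v (a, s) (a, t) x y := by
    intro s t hst hsx htx hsy hty hsv htv hadj' hns
    have side : ∀ p q r : Bool × V, (¬ ∃ u, G.Adj s u ∧ (a, u) ≠ p ∧ (a, u) ≠ q ∧ (a, u) ≠ r) →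
        p.1 = a ∧ G.Adj s p.2 := by
      intro p q r h
      constructor
      · by_contra hp
        obtain ⟨u, hu, hu'⟩ := hG.exists_adj s {q.2, r.2}
          (lt_of_le_of_lt Finset.card_le_two (by norm_num))
        simp only [Finset.mem_insert, Finset.mem_singleton, not_or] at hu'
        refine h ⟨u, hu, ?_, ?_, ?_⟩ <;> rintro rfl <;> simp_all
      · by_contra hp
        obtain ⟨u, hu, hu'⟩ := hG.exists_adj_of_not_adj (x := s) (z := p.2) (S := {p.2, q.2, r.2})
          Finset.card_le_three (by simp) hp
        simp only [Finset.mem_insert, Finset.mem_singleton, not_or] at hu'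
        refine h ⟨u, hu, ?_, ?_, ?_⟩ <;> rintro rfl <;> simp_all
    obtain ⟨hx1, hx2⟩ := side x y v hns
    obtain ⟨hy1, hy2⟩ := side y x v fun ⟨u, h1, h2, h3, h4⟩ => hns ⟨u, h1, h3, h2, h4⟩
    obtain ⟨hv1, hv2⟩ := side v x y fun ⟨u, h1, h2, h3, h4⟩ => hns ⟨u, h1, h3, h4, h2⟩
    obtain ⟨b, x⟩ := x
    obtain ⟨c, y⟩ := y
    obtain ⟨d, v⟩ := v
    dsimp only at hx1 hx2 hy1 hy2 hv1 hv2
    subst hx1 hy1 hv1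
    have hnbr : ∀ r, G.Adj s r →
        ∃ u, G.Adj r u ∧ (d, u) ≠ (d, s) ∧ (d, u) ≠ (d, t) ∧ (d, u) ≠ (d, v) := by
      intro r hr
      obtain ⟨u, hu, hu'⟩ := hG.exists_adj_of_not_adj (x := r) (z := v) (S := {s, t, v})
        Finset.card_le_three (by simp) (fun h => hG.no_triangle _ _ _ hr h hv2)
      refine ⟨u, hu, ?_⟩
      simpa using hu'
    refine (hG.twoLinked_of_free_nbrs d hsx.symm hsy.symm htx.symm hty.symm hxv hyv ?_ hsv htv
      ?_ (hnbr x hx2) (hnbr y hy2)).swap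
    · simpa using hst
    · simpa [boxProd_adj] using hadj'
  by_cases hns : ∃ u, G.Adj s u ∧ (a, u) ≠ x ∧ (a, u) ≠ y ∧ (a, u) ≠ v
  · by_cases hnt : ∃ u, G.Adj t u ∧ (a, u) ≠ x ∧ (a, u) ≠ y ∧ (a, u) ≠ v
    · exact hG.twoLinked_of_free_nbrs a hsx htx hsy hty hsv htv hxy hxv hyv hadj hns hnt
    · exact (main t s hst.symm htx hsx hty hsy htv hsv (fun h => hadj' h.symm) hnt).symm_left
  · exact main s t hst hsx htx hsy hty hsv htv hadj' hns

lemma twoLinked_of_opposite_sides (hG : G.CubeLike 3) (a : Bool) {s t x y v : V}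
    (hsx : s ≠ x) (hsy : s ≠ y) (htx : t ≠ x) (hty : t ≠ y) (hsv : s ≠ v) (hxv : x ≠ v) :
    G.prism.TwoLinked (a, v) (a, s) (!a, t) (a, x) (!a, y) := by
  classical
  have main : ∀ s t x y : V, s ≠ x → s ≠ y → t ≠ y → s ≠ v → x ≠ v → y ≠ v →
      G.prism.TwoLinked (a, v) (a, s) (!a, t) (a, x) (!a, y) := by
    intro s t x y hsx hsy hty hsv hxv hyv
    refine ⟨{w | w = (a, s) ∨ (w.1 = !a ∧ w.2 ≠ y)},
      {w | w = (!a, y) ∨ (w.1 = a ∧ w.2 ≠ s ∧ w.2 ≠ v)}, ?_, ?_, ?_, ?_, ?_⟩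
    · refine Set.disjoint_left.2 ?_
      rintro ⟨b, w⟩ (h | h) (h' | h') <;> simp_all
    · simpa using hsv.symm
    · simp
    · refine ReachIn.trans (v := (!a, s)) (.of_adj (prism_adj_cross (by simp) s) (by simp)
        (by simpa using hsy)) ?_
      refine (hG.reachIn_of_card_lt (S := {y}) (by simp) (by simpa) (by simpa)).prism (!a)
        fun w hw => ?_
      simpa using hw
    · refine ReachIn.trans (v := (a, y)) ?_ (.of_adj (prism_adj_cross (by simp) y)
        (by simpa using ⟨hsy.symm, hyv⟩) (by simp))
      refine (hG.reachIn_of_card_lt (S := {s, v})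
        (lt_of_le_of_lt Finset.card_le_two (by norm_num)) (by simp [hsx.symm, hxv])
        (by simp [hsy.symm, hyv])).prism a fun w hw => ?_
      simpa using hw
  by_cases hyv : y = v
  · exact (main x y s t hsx.symm htx.symm hty.symm hxv hsv (hyv ▸ hty)).swap
  · exact main s t x y hsx hsy hty hsv hxv hyv

end CubeLike

end SimpleGraph

open SimpleGraph

variable {n : ℕ}

lemma cubeGraph_adj_iff_insertNth (i : Fin (n + 1)) (x y : Fin (n + 1) → Bool) :
    (cubeGraph (n + 1)).Adj x y ↔ (x i ≠ y i ∧ i.removeNth x = i.removeNth y) ∨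
      (cubeGraph n).Adj (i.removeNth x) (i.removeNth y) ∧ x i = y i := by
  have key : hammingDist x y =
      (if x i ≠ y i then 1 else 0) + hammingDist (i.removeNth x) (i.removeNth y) := by
    simp only [hammingDist, Finset.card_filter]
    rw [Fin.sum_univ_succAbove _ i]
    rfl
  change hammingDist x y = 1 ↔ _ ∨ hammingDist _ _ = 1 ∧ _
  rw [key, ← hammingDist_eq_zero]
  split_ifs with h <;> (simp [h]; try tauto)

/-- The `(n + 1)`-cube as the prism over the `n`-cube, in direction `i`. -/
def cubeSplit (i : Fin (n + 1)) : cubeGraph (n + 1) ≃g (cubeGraph n).prism where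
  toEquiv := (Fin.insertNthEquiv (fun _ => Bool) i).symm
  map_rel_iff' {x y} := by
    rw [cubeGraph_adj_iff_insertNth i]
    rfl

lemma cubeSplit_apply (i : Fin (n + 1)) (x : Fin (n + 1) → Bool) :
    cubeSplit i x = (x i, i.removeNth x) := rfl

/-- The vertex of the cube obtained by flipping coordinate `i`. -/
def flipBit {n : ℕ} (i : Fin n) (x : Fin n → Bool) : Fin n → Bool := Function.update x i (!x i)

lemma flipBit_apply_self (i : Fin n) (x : Fin n → Bool) : flipBit i x i = !x i := by simp [flipBit]

lemma flipBit_apply_of_ne {i j : Fin n} (h : j ≠ i) (x : Fin n → Bool) : flipBit i x j = x j := by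
  simp [flipBit, h]

lemma eq_flipBit_iff {i : Fin n} {x y : Fin n → Bool} :
    y = flipBit i x ↔ y i ≠ x i ∧ ∀ j ≠ i, y j = x j := by
  constructor
  · rintro rfl
    exact ⟨by simp [flipBit], fun j hj => flipBit_apply_of_ne hj x⟩
  · rintro ⟨h1, h2⟩
    funext j
    by_cases h : j = i
    · subst h
      rw [flipBit_apply_self]
      cases h : x j <;> simp_all
    · rw [h2 j h, flipBit_apply_of_ne h]

lemma flipBit_flipBit (i : Fin n) (x : Fin n → Bool) : flipBit i (flipBit i x) = x := by
  simp [flipBit]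

lemma cubeGraph_adj_iff {x y : Fin n → Bool} : (cubeGraph n).Adj x y ↔ ∃ i, y = flipBit i x := by
  change hammingDist x y = 1 ↔ _
  simp only [hammingDist, Finset.card_eq_one, eq_flipBit_iff, Finset.ext_iff, Finset.mem_filter,
    Finset.mem_univ, true_and, Finset.mem_singleton]
  refine exists_congr fun i => ⟨fun h => ⟨((h i).2 rfl).symm, fun j hj => ?_⟩, fun h j => ?_⟩
  · by_contra hne
    exact hj ((h j).1 (Ne.symm hne))
  · refine ⟨fun hj => by_contra fun hji => hj (h.2 j hji).symm, ?_⟩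
    rintro rfl
    exact h.1.symm

lemma removeNth_eq_iff {i : Fin (n + 1)} {x y : Fin (n + 1) → Bool} :
    i.removeNth x = i.removeNth y ↔ x = y ∨ x = flipBit i y := by
  constructor
  · intro h
    by_cases hi : x i = y i
    · left
      rw [← i.insertNth_self_removeNth x, ← i.insertNth_self_removeNth y, hi, h]
    · right
      rw [eq_flipBit_iff]
      refine ⟨hi, fun j hj => ?_⟩
      obtain ⟨k, rfl⟩ := Fin.exists_succAbove_eq hj
      exact congrFun h k
  · rintro (rfl | rfl)
    · rfl
    · funext k
      exact flipBit_apply_of_ne (Fin.succAbove_ne i k) y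

lemma cubeLike_cubeGraph (hn : 2 ≤ n) : (cubeGraph n).CubeLike n := by
  induction n, hn using Nat.le_induction with
  | succ n hn ih => exact ih.prism.of_iso (cubeSplit 0).symm
  | base =>
    have hflip : ∀ x, flipBit 0 x ≠ flipBit (1 : Fin 2) x := by decide
    have hnear : ∀ x i y, y = x ∨ y = flipBit i x ∨ (∃ j, y = flipBit j x) ∨
      ∃ j, y = flipBit j (flipBit (i : Fin 2) x) := by decide
    have htri : ∀ x i j k, flipBit j (flipBit i x) ≠ flipBit (k : Fin 2) x := by decide
    refine ⟨le_rfl, by simp, fun x S hS => ?_, ?_, ?_⟩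
    · by_contra! h
      have h0 := h (flipBit 0 x) (cubeGraph_adj_iff.2 ⟨_, rfl⟩)
      have h1 := h (flipBit 1 x) (cubeGraph_adj_iff.2 ⟨_, rfl⟩)
      exact hflip x (Finset.card_le_one.1 (by omega) _ h0 _ h1)
    · simp only [cubeGraph_adj_iff]
      rintro x _ _ ⟨i, rfl⟩ ⟨j, rfl⟩ ⟨k, h⟩
      exact htri x i j k h
    · rintro S - s t hs ht ⟨u, hsu, hu⟩ -
      obtain ⟨i, rfl⟩ := cubeGraph_adj_iff.1 hsu
      rcases hnear s i t with rfl | rfl | h | h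
      · exact .refl hs
      · exact .of_adj hsu hs hu
      · exact .of_adj (cubeGraph_adj_iff.2 h) hs ht
      · exact .trans (.of_adj hsu hs hu) (.of_adj (cubeGraph_adj_iff.2 h) hu ht)

lemma twoLinked_cubeGraph_four {s t x y v : Fin 4 → Bool} (hst : s ≠ t) (hxy : x ≠ y)
    (hsx : s ≠ x) (hsy : s ≠ y) (htx : t ≠ x) (hty : t ≠ y) (hsv : s ≠ v) (htv : t ≠ v)
    (hxv : x ≠ v) (hyv : y ≠ v) : (cubeGraph 4).TwoLinked v s t x y := by
  classical
  have h3 := cubeLike_cubeGraph (n := 3) (by norm_num)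
  have h4 := cubeLike_cubeGraph (n := 4) (by norm_num)
  have of_adj : ∀ {s t x y : Fin 4 → Bool}, s ≠ x → s ≠ y → t ≠ x → t ≠ y → s ≠ v → t ≠ v →
      x ≠ v → y ≠ v → (cubeGraph 4).Adj x y → (cubeGraph 4).TwoLinked v s t x y := by
    intro s t x y hsx hsy htx hty hsv htv hxv hyv hadj
    refine ⟨(↑({x, y, v} : Finset (Fin 4 → Bool)))ᶜ, {x, y}, ?_, by simp,
      by simp [hxv.symm, hyv.symm], h4.reachIn_of_card_lt
        (Finset.card_le_three.trans_lt (by norm_num)) (by simp [hsx, hsy, hsv])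
        (by simp [htx, hty, htv]), .of_adj hadj (by simp) (by simp)⟩
    refine Set.disjoint_left.2 fun w hw hw' => hw ?_
    rcases hw' with rfl | rfl <;> simp
  by_cases hadj : (cubeGraph 4).Adj x y
  · exact of_adj hsx hsy htx hty hsv htv hxv hyv hadj
  by_cases hadj' : (cubeGraph 4).Adj s t
  · exact (of_adj hsx.symm htx.symm hsy.symm hty.symm hxv hyv hsv htv hadj').swap
  have same : ∀ {s t x y : Fin 4 → Bool} (i : Fin 4), s i = t i → s ≠ t → x ≠ y → s ≠ x → s ≠ y →
      t ≠ x → t ≠ y → s ≠ v → t ≠ v → x ≠ v → y ≠ v → ¬ (cubeGraph 4).Adj s t →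
      ¬ (cubeGraph 4).Adj x y → (cubeGraph 4).TwoLinked v s t x y := by
    intro s t x y i hi hst hxy hsx hsy htx hty hsv htv hxv hyv hadj hadj'
    have e := (cubeSplit i).injective
    have ht : cubeSplit i t = (s i, i.removeNth t) := by rw [hi]; rfl
    refine .of_iso (cubeSplit i) ?_
    have := h3.twoLinked_of_same_side (s i) (s := i.removeNth s) (t := i.removeNth t)
      (x := cubeSplit i x) (y := cubeSplit i y) (v := cubeSplit i v)
    rw [← ht, ← cubeSplit_apply] at this
    refine this ?_ (e.ne hsx) (e.ne htx) (e.ne hsy) (e.ne hty) (e.ne hsv) (e.ne htv)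
      (e.ne hxy) (e.ne hxv) (e.ne hyv) (by rwa [(cubeSplit i).map_adj_iff]) ?_
    · intro h
      exact hst (e (Prod.ext hi h))
    · exact fun h => hadj ((cubeGraph_adj_iff_insertNth i s t).2 (Or.inr ⟨h, hi⟩))
  by_cases hi : ∃ i, s i = t i
  · obtain ⟨i, hi⟩ := hi
    exact same i hi hst hxy hsx hsy htx hty hsv htv hxv hyv hadj' hadj
  by_cases hj : ∃ i, x i = y i
  · obtain ⟨i, hi⟩ := hj
    exact (same i hi hxy hst hsx.symm htx.symm hsy.symm hty.symm hxv hyv hsv htv hadj hadj').swap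
  push Not at hi hj
  obtain ⟨u, hu, hu'⟩ := h4.exists_adj s {x, y} (Finset.card_le_two.trans_lt (by norm_num))
  obtain ⟨i, rfl⟩ := cubeGraph_adj_iff.1 hu
  simp only [Finset.mem_insert, Finset.mem_singleton, not_or] at hu'
  have anti : ∀ {s t x y : Fin 4 → Bool}, (∀ i, s i ≠ t i) → (∀ i, x i ≠ y i) →
      x ≠ flipBit i s → y ≠ flipBit i t := by
    intro s t x y hst hxy hne h
    refine hne (eq_flipBit_iff.2 ⟨fun h' => ?_, fun j hj => ?_⟩)
    · have h1 := (eq_flipBit_iff.1 h).1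
      have h2 := hst i
      have h3 := hxy i
      revert h1 h2 h3 h'
      cases s i <;> cases t i <;> cases x i <;> cases y i <;> simp
    · have h1 := (eq_flipBit_iff.1 h).2 j hj
      have h2 := hst j
      have h3 := hxy j
      revert h1 h2 h3
      cases s j <;> cases t j <;> cases x j <;> cases y j <;> simp
  have opp : ∀ {s t x y : Fin 4 → Bool}, s i = v i → x i = v i → (∀ i, s i ≠ t i) →
      (∀ i, x i ≠ y i) → s ≠ x → s ≠ y → t ≠ x → t ≠ y → s ≠ v → x ≠ v →
      x ≠ flipBit i s → y ≠ flipBit i s → (cubeGraph 4).TwoLinked v s t x y := by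
    intro s t x y hsi hxi hst hxy hsx hsy htx hty hsv hxv hx hy
    have hst' : (!v i) = t i := by
      have := hst i
      rw [hsi] at this
      revert this
      cases v i <;> cases t i <;> simp
    have hxy' : (!v i) = y i := by
      have := hxy i
      rw [hxi] at this
      revert this
      cases v i <;> cases y i <;> simp
    have hne : ∀ {p q : Fin 4 → Bool}, p ≠ q → q ≠ flipBit i p → i.removeNth p ≠ i.removeNth q :=
      fun h h' heq => (removeNth_eq_iff.1 heq.symm).elim (fun h'' => h h''.symm) h'
    have hv : ∀ {p : Fin 4 → Bool}, p i = v i → p ≠ v → i.removeNth p ≠ i.removeNth v := by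
      intro p hp hpv h
      exact hpv ((cubeSplit i).injective (Prod.ext hp h))
    refine .of_iso (cubeSplit i) ?_
    have := h3.twoLinked_of_opposite_sides (v i) (hne hsx hx) (hne hsy hy)
      (hne htx (anti hst (fun j => (hxy j).symm) hy)) (hne hty (anti hst hxy hx))
      (hv hsi hsv) (hv hxi hxv)
    simpa only [cubeSplit_apply, hsi, hxi, ← hst', ← hxy'] using this
  have hor : ∀ p q : Fin 4 → Bool, p i ≠ q i → p i = v i ∨ q i = v i := by
    intro p q
    cases p i <;> cases q i <;> cases v i <;> simp
  have hi' := fun j => (hi j).symm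
  have hj' := fun j => (hj j).symm
  have hx : x ≠ flipBit i s := fun h => hu'.1 h.symm
  have hy : y ≠ flipBit i s := fun h => hu'.2 h.symm
  have hx' : x ≠ flipBit i t := anti hi hj' hy
  have hy' : y ≠ flipBit i t := anti hi hj hx
  rcases hor s t (hi i) with hs | ht <;> rcases hor x y (hj i) with hx1 | hy1
  · exact opp hs hx1 hi hj hsx hsy htx hty hsv hxv hx hy
  · exact (opp hs hy1 hi hj' hsy hsx hty htx hsv hyv hy hx).symm_right
  · exact (opp ht hx1 hi' hj htx hty hsx hsy htv hxv hx' hy').symm_left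
  · exact (opp ht hy1 hi' hj' hty htx hsy hsx htv hyv hy' hx').symm_right.symm_left

lemma card_image_add_card_le {α β : Type*} [Fintype α] [DecidableEq α] [DecidableEq β] (g : α → β)
    (D : Finset α) (h : ∀ d ∈ D, ∃ e ∉ D, g e = g d) :
    (Finset.univ.image g).card + D.card ≤ Fintype.card α := by
  have hsub : Finset.univ.image g ⊆ Dᶜ.image g := by
    intro y hy
    obtain ⟨d, -, rfl⟩ := Finset.mem_image.1 hy
    by_cases hd : d ∈ D
    · obtain ⟨e, he, heq⟩ := h d hd
      exact Finset.mem_image.2 ⟨e, Finset.mem_compl.2 he, heq⟩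
    · exact Finset.mem_image_of_mem g (Finset.mem_compl.2 hd)
  have h1 := (Finset.card_le_card hsub).trans Finset.card_image_le
  have h2 := Finset.card_compl_add_card D
  omega

/-- Any `k` disjoint pairs of terminals are linked, whichever further vertex has to be avoided. -/
def SimpleGraph.StronglyLinked {V : Type} (G : SimpleGraph V) (k : ℕ) : Prop :=
  ∀ (κ : Type) [Fintype κ], Fintype.card κ = k → ∀ f : κ × Bool → V, Function.Injective f →
    ∀ v, (∀ j, f j ≠ v) → G.HasLinkage {v} f

lemma SimpleGraph.HasLinkage.of_ne {V κ : Type} {G : SimpleGraph V} {f : κ × Bool → V} (p : κ)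
    {C : Set V} {D : {k // k ≠ p} → Set V} (hC : G.ReachIn C (f (p, false)) (f (p, true)))
    (hD : Pairwise (Function.onFun Disjoint D)) (hCD : ∀ k, Disjoint C (D k))
    (hDf : ∀ k, G.ReachIn (D k) (f (k, false)) (f (k, true))) : G.HasLinkage ∅ f := by
  classical
  refine ⟨fun k => if h : k = p then C else D ⟨k, h⟩, fun k l hkl => ?_, fun k => by simp,
    fun k => ?_⟩
  · by_cases hk : k = p <;> by_cases hl : l = p <;>
      simp only [Function.onFun, hk, hl, dite_true, dite_false]
    · exact absurd (hk.trans hl.symm) hkl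
    · exact hCD _
    · exact (hCD _).symm
    · exact hD fun h => hkl (congrArg Subtype.val h)
  · by_cases hk : k = p
    · subst hk
      simpa using hC
    · simpa [hk] using hDf ⟨k, hk⟩

section Linked

variable {κ : Type} [Fintype κ] {f : κ × Bool → (Fin (n + 1) → Bool)}

lemma card_ne_mul_two (hκ : Fintype.card κ * 2 = n + 2) (p : κ) [Fintype {k // k ≠ p}] :
    Fintype.card {k // k ≠ p} * 2 = n := by
  classical
  have : Fintype.card {k // k ≠ p} = Fintype.card κ - 1 := by
    rw [Fintype.card_subtype_compl, Fintype.card_subtype_eq]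
  omega

lemma exists_split_linkage (hn : 2 ≤ n) (hlink : (cubeGraph n).StronglyLinked (n / 2))
    (hκ : Fintype.card κ * 2 = n + 2) (hf : Function.Injective f) (p : κ) (i : Fin (n + 1))
    (a : Bool) {s t : Fin n → Bool} (hs : ∀ j, j.1 ≠ p → cubeSplit i (f j) ≠ (a, s))
    (ht : ∀ j, j.1 ≠ p → cubeSplit i (f j) ≠ (a, t))
    (hfree : ∀ j l, j.1 ≠ p → f j i = a → f l = flipBit i (f j) →
      ∃ y, (cubeGraph n).Adj (i.removeNth (f j)) y ∧
        (∀ q, q.1 ≠ p → i.removeNth (f q) ≠ y) ∧ y ≠ s ∧ y ≠ t)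
    (hns : (∀ j, j.1 ≠ p → f j i = a) →
      ∃ y, (cubeGraph n).Adj s y ∧ ∀ j, j.1 ≠ p → i.removeNth (f j) ≠ y)
    (hnt : (∀ j, j.1 ≠ p → f j i = a) →
      ∃ y, (cubeGraph n).Adj t y ∧ ∀ j, j.1 ≠ p → i.removeNth (f j) ≠ y) :
    ∃ (C : Set (Bool × (Fin n → Bool))) (D : {k // k ≠ p} → Set (Bool × (Fin n → Bool))),
      (cubeGraph n).prism.ReachIn C (a, s) (a, t) ∧
      (∀ w ∈ C, w.1 = a) ∧ Pairwise (Function.onFun Disjoint D) ∧ (∀ k, Disjoint C (D k)) ∧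
      (∀ k, (cubeGraph n).prism.ReachIn (D k) (cubeSplit i (f (k, false)))
        (cubeSplit i (f (k, true)))) ∧
      ((∀ j, j.1 ≠ p → cubeSplit i (f j) ≠ (!a, s)) → ∀ k, (!a, s) ∉ D k) := by
  classical
  have hcard := card_ne_mul_two hκ p
  have toAll : ∀ {P : κ × Bool → Prop},
      (∀ j : {k // k ≠ p} × Bool, P (j.1, j.2)) → ∀ j, j.1 ≠ p → P j :=
    fun h j hj => h (⟨j.1, hj⟩, j.2)
  have hX : Function.Injective fun j : {k // k ≠ p} × Bool => cubeSplit i (f (j.1, j.2)) := by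
    rintro ⟨j, b⟩ ⟨l, c⟩ h
    have := hf ((cubeSplit i).injective h)
    simp only [Prod.mk.injEq] at this
    exact Prod.ext (Subtype.ext this.1) this.2
  obtain ⟨C, D, h1, h2, h3, h4, h5, h6⟩ := (cubeLike_cubeGraph hn).exists_path_and_linkage a
    (s := s) (t := t) hX (fun j => hs _ j.1.2) (fun j => ht _ j.1.2) hcard.le
    (fun j l hj hl hjl => by
      rcases removeNth_eq_iff.1 hjl with h | h
      · exact absurd (by rw [← hj]; exact congrFun h i) hl
      · obtain ⟨y, hy, hy1, hy2⟩ := hfree _ _ j.1.2 hj h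
        exact ⟨y, hy, fun q => hy1 _ q.1.2, hy2⟩)
    (fun h => (hns (toAll h)).imp fun y hy => ⟨hy.1, fun j => hy.2 _ j.1.2⟩)
    (fun h => (hnt (toAll h)).imp fun y hy => ⟨hy.1, fun j => hy.2 _ j.1.2⟩)
    (fun g hg => hlink _ (by omega) g hg)
  exact ⟨C, D, h1, h2, h3, h4, h5, fun h => h6 fun j => h _ j.1.2⟩

lemma hasLinkage_of_apply_eq (hn : 2 ≤ n) (hlink : (cubeGraph n).StronglyLinked (n / 2))
    (hκ : Fintype.card κ * 2 = n + 2) (hf : Function.Injective f) (p : κ) (i : Fin (n + 1))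
    (hp : f (p, false) i = f (p, true) i)
    (hfree : ∀ j l, j.1 ≠ p → f j i = f (p, false) i → f l = flipBit i (f j) →
      ∃ y, (cubeGraph n).Adj (i.removeNth (f j)) y ∧ ∀ q, i.removeNth (f q) ≠ y)
    (hnbr : (∀ j, j.1 ≠ p → f j i = f (p, false) i) → ∀ c,
      ∃ y, (cubeGraph n).Adj (i.removeNth (f (p, c))) y ∧ ∀ j, j.1 ≠ p → i.removeNth (f j) ≠ y) :
    (cubeGraph (n + 1)).HasLinkage ∅ f := by
  have hne : ∀ c j, j.1 ≠ p → cubeSplit i (f j) ≠ cubeSplit i (f (p, c)) := fun c j hj h =>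
    hj (congrArg Prod.fst (hf ((cubeSplit i).injective h)))
  have ht : cubeSplit i (f (p, true)) = (f (p, false) i, i.removeNth (f (p, true))) := by
    rw [hp]; rfl
  obtain ⟨C, D, h1, h2, h3, h4, h5, -⟩ := exists_split_linkage hn hlink hκ hf p i (f (p, false) i)
    (s := i.removeNth (f (p, false))) (t := i.removeNth (f (p, true))) (hne false)
    (ht ▸ hne true) (fun j l hj hji hl => by
      obtain ⟨y, hy, hyq⟩ := hfree j l hj hji hl
      exact ⟨y, hy, fun q _ => hyq q, (hyq _).symm, (hyq _).symm⟩)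
    (fun h => hnbr h false) (fun h => hnbr h true)
  refine .of_iso (cubeSplit i) ?_
  rw [Set.image_empty]
  refine .of_ne p (C := C) (D := D) ?_ h3 h4 h5
  rw [Function.comp_apply, Function.comp_apply, ht]
  exact h1

lemma hasLinkage_of_forall_apply_eq (hn : 4 ≤ n) (hlink : (cubeGraph n).StronglyLinked (n / 2))
    (hκ : Fintype.card κ * 2 = n + 2) (hf : Function.Injective f) (i : Fin (n + 1)) (a : Bool)
    (hi : ∀ q, f q i = a) : (cubeGraph (n + 1)).HasLinkage ∅ f := by
  classical
  have hG := cubeLike_cubeGraph (n := n) (by omega)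
  have hadj : ∀ p, (cubeGraph (n + 1)).HasLinkage ∅ f ∨
      ∃ c, ∀ j, j.1 ≠ p → (cubeGraph n).Adj (i.removeNth (f (p, c))) (i.removeNth (f j)) := by
    intro p
    rw [or_iff_not_imp_right]
    intro h
    push Not at h
    refine hasLinkage_of_apply_eq (by omega) hlink hκ hf p i (by rw [hi, hi])
      (fun j l _ _ hl => ?_) fun _ c => ?_
    · have := hi l
      rw [hl, flipBit_apply_self, hi] at this
      simp at this
    · obtain ⟨j, hj, hadj⟩ := h c
      obtain ⟨y, hy, hyS⟩ := hG.exists_adj_of_not_adj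
        (S := Finset.univ.image fun q : {k // k ≠ p} × Bool => i.removeNth (f (q.1, q.2)))
        (Finset.card_image_le.trans (by simpa using (card_ne_mul_two hκ p).le))
        (Finset.mem_image.2 ⟨(⟨j.1, hj⟩, j.2), Finset.mem_univ _, rfl⟩) hadj
      exact ⟨y, hy, fun q hq h => hyS (Finset.mem_image.2 ⟨(⟨q.1, hq⟩, q.2), Finset.mem_univ _, h⟩)⟩
  obtain ⟨p₁, p₂, p₃, h12, h13, h23⟩ := Fintype.two_lt_card_iff.1 (by omega : 2 < Fintype.card κ)
  rcases hadj p₁ with h | ⟨c, hc⟩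
  · exact h
  rcases hadj p₂ with h | ⟨c', hc'⟩
  · exact h
  exact absurd (hc (p₃, false) h13.symm)
    (hG.no_triangle _ _ _ (hc (p₂, c') h12.symm) (hc' (p₃, false) h23.symm))

lemma hasLinkage_of_apply_eq_of_eq_flipBit (hn : 2 ≤ n)
    (hlink : (cubeGraph n).StronglyLinked (n / 2))
    (hκ : Fintype.card κ * 2 = n + 2) (hf : Function.Injective f) (i : Fin (n + 1)) {r q : κ × Bool}
    (hr : f r i = f (r.1, !r.2) i) (hq : f q = flipBit i (f r)) :
    (cubeGraph (n + 1)).HasLinkage ∅ f := by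
  classical
  have hG := cubeLike_cubeGraph hn
  obtain ⟨p, c⟩ := r
  have hside : ∀ b, f (p, b) i = f (p, c) i := by
    intro b
    cases b <;> cases c <;> simp_all
  have hqi : f q i ≠ f (p, c) i := (eq_flipBit_iff.1 hq).1
  have hqp : q.1 ≠ p := by
    rintro rfl
    exact hqi (hside q.2)
  refine hasLinkage_of_apply_eq hn hlink hκ hf p i ((hside _).trans (hside _).symm)
    (fun j l hj hji hl => ?_)
    fun h => absurd (h q hqp) (by rwa [hside])
  rw [hside] at hji
  have hli := (eq_flipBit_iff.1 hl).1
  have hql : q ≠ l := by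
    rintro rfl
    rw [hq] at hl
    have := congrArg (flipBit i) hl
    rw [flipBit_flipBit, flipBit_flipBit] at this
    exact hj (congrArg Prod.fst (hf this)).symm
  have hcard := card_image_add_card_le (fun q => i.removeNth (f q)) {q, l} (by
    intro d hd
    rcases Finset.mem_insert.1 hd with rfl | hd
    · refine ⟨(p, c), ?_, (removeNth_eq_iff.2 (Or.inr hq)).symm⟩
      simp only [Finset.mem_insert, Finset.mem_singleton, not_or]
      refine ⟨fun h => hqp (by rw [← h]), ?_⟩
      rintro rfl
      exact hli hji.symm
    · rw [Finset.mem_singleton] at hd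
      subst hd
      refine ⟨j, ?_, (removeNth_eq_iff.2 (Or.inr hl)).symm⟩
      simp only [Finset.mem_insert, Finset.mem_singleton, not_or]
      exact ⟨fun h => hqi (h ▸ hji), fun h => hli (by rw [h])⟩)
  rw [Finset.card_pair hql, Fintype.card_prod, Fintype.card_bool] at hcard
  obtain ⟨y, hy, hyS⟩ := hG.exists_adj_of_not_adj (by omega)
    (Finset.mem_image_of_mem (fun q => i.removeNth (f q)) (Finset.mem_univ j))
    (SimpleGraph.irrefl _)
  exact ⟨y, hy, fun q h => hyS (Finset.mem_image.2 ⟨q, Finset.mem_univ _, h⟩)⟩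

lemma hasLinkage_of_antipodal (hn : 2 ≤ n) (hlink : (cubeGraph n).StronglyLinked (n / 2))
    (hκ : Fintype.card κ * 2 = n + 2) (hf : Function.Injective f)
    (hanti : ∀ q i, f (q.1, !q.2) i = !f q i) : (cubeGraph (n + 1)).HasLinkage ∅ f := by
  classical
  have hG := cubeLike_cubeGraph hn
  obtain ⟨p, p', hpp'⟩ := Fintype.one_lt_card_iff.1 (by omega : 1 < Fintype.card κ)
  obtain ⟨i, hi⟩ : ∃ i, ∀ j, j.1 ≠ p → f j ≠ flipBit i (f (p, false)) := by
    obtain ⟨y, hy, hyS⟩ := (cubeLike_cubeGraph (n := n + 1) (by omega)).exists_adj (f (p, false))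
      (Finset.univ.image fun q : {k // k ≠ p} × Bool => f (q.1, q.2))
      (Finset.card_image_le.trans_lt (by
        have := card_ne_mul_two hκ p
        rw [Finset.card_univ, Fintype.card_prod, Fintype.card_bool]
        omega))
    obtain ⟨i, rfl⟩ := cubeGraph_adj_iff.1 hy
    exact ⟨i, fun j hj h => hyS (Finset.mem_image.2 ⟨(⟨j.1, hj⟩, j.2), Finset.mem_univ _, h⟩)⟩
  have hti : f (p, true) i = !f (p, false) i := hanti (p, false) i
  have hsplit : cubeSplit i (flipBit i (f (p, false))) =
      (f (p, true) i, i.removeNth (f (p, false))) := by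
    rw [cubeSplit_apply, flipBit_apply_self, hti, removeNth_eq_iff.2 (Or.inr rfl)]
  have hs : cubeSplit i (f (p, false)) = (!f (p, true) i, i.removeNth (f (p, false))) := by
    rw [cubeSplit_apply, hti, Bool.not_not]
  have hne : ∀ c j, j.1 ≠ p → cubeSplit i (f j) ≠ cubeSplit i (f (p, c)) := fun c j hj h =>
    hj (congrArg Prod.fst (hf ((cubeSplit i).injective h)))
  have hsides : ¬ ∀ j, j.1 ≠ p → f j i = f (p, true) i := fun h => by
    have h1 := h (p', false) hpp'.symm
    have h2 := h (p', true) hpp'.symm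
    have h3 := hanti (p', false) i
    rw [Bool.not_false, h2, h1] at h3
    simp at h3
  have hfree : ∀ j l, j.1 ≠ p → f j i = f (p, true) i → f l = flipBit i (f j) →
      ∃ y, (cubeGraph n).Adj (i.removeNth (f j)) y ∧ (∀ q, q.1 ≠ p → i.removeNth (f q) ≠ y) ∧
        y ≠ i.removeNth (f (p, false)) ∧ y ≠ i.removeNth (f (p, true)) := by
    intro j l _ _ hl
    obtain ⟨hli, hl'⟩ := eq_flipBit_iff.1 hl
    have hjl : j.1 ≠ l.1 := by
      intro h
      rcases Bool.eq_or_eq_not l.2 j.2 with h' | h'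
      · exact hli (by rw [show l = j from Prod.ext h.symm h'])
      · obtain ⟨u, hu⟩ : ∃ u, u ≠ i := by
          have : Nontrivial (Fin (n + 1)) := Fin.nontrivial_iff_two_le.2 (by omega)
          exact exists_ne i
        have h1 := hanti j u
        rw [show (j.1, !j.2) = l from Prod.ext h h'.symm, hl' u hu] at h1
        simp at h1
    have hcard := card_image_add_card_le (fun q => i.removeNth (f q)) {l, (l.1, !l.2)} (by
      intro d hd
      rcases Finset.mem_insert.1 hd with rfl | hd
      · refine ⟨j, ?_, (removeNth_eq_iff.2 (Or.inr hl)).symm⟩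
        simp only [Finset.mem_insert, Finset.mem_singleton, not_or]
        exact ⟨fun h => hjl (by rw [h]), fun h => hjl (by rw [h])⟩
      · rw [Finset.mem_singleton] at hd
        subst hd
        refine ⟨(j.1, !j.2), ?_, ?_⟩
        · simp only [Finset.mem_insert, Finset.mem_singleton, not_or]
          exact ⟨fun h => hjl (by rw [← h]), fun h => hjl (Prod.mk.inj h).1⟩
        · funext u
          change f (j.1, !j.2) _ = f (l.1, !l.2) _
          rw [hanti, hanti, hl' _ (Fin.succAbove_ne i u)])
    rw [Finset.card_pair (fun h => by simpa using congrArg Prod.snd h), Fintype.card_prod,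
      Fintype.card_bool] at hcard
    obtain ⟨y, hy, hyS⟩ := hG.exists_adj_of_not_adj (by omega)
      (Finset.mem_image_of_mem (fun q => i.removeNth (f q)) (Finset.mem_univ j))
      (SimpleGraph.irrefl _)
    have hyF : ∀ q, i.removeNth (f q) ≠ y := fun q h =>
      hyS (Finset.mem_image.2 ⟨q, Finset.mem_univ _, h⟩)
    exact ⟨y, hy, fun q _ => hyF q, (hyF _).symm, (hyF _).symm⟩
  obtain ⟨C, D, h1, h2, h3, h4, h5, h6⟩ := exists_split_linkage hn hlink hκ hf p i (f (p, true) i)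
    (s := i.removeNth (f (p, false))) (t := i.removeNth (f (p, true)))
    (fun j hj h => hi j hj ((cubeSplit i).injective (h.trans hsplit.symm)))
    (hne true) hfree (fun h => absurd h hsides) (fun h => absurd h hsides)
  refine .of_iso (cubeSplit i) ?_
  rw [Set.image_empty]
  refine .of_ne p (C := insert (cubeSplit i (f (p, false))) C) (D := D) ?_ h3 (fun k => ?_) h5
  · refine .trans (.of_adj (v := (f (p, true) i, i.removeNth (f (p, false)))) ?_
      (Set.mem_insert _ _) (Set.mem_insert_of_mem _ h1.mem_left)) (h1.mono (Set.subset_insert _ _))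
    rw [Function.comp_apply, hs]
    exact SimpleGraph.prism_adj_cross (by simp) _
  · rw [Set.disjoint_insert_left]
    rw [hs]
    exact ⟨h6 (hs ▸ hne false) k, h4 k⟩

lemma hasLinkage_succ (hn : 4 ≤ n) (hlink : (cubeGraph n).StronglyLinked (n / 2))
    (hκ : Fintype.card κ * 2 = n + 2) (hf : Function.Injective f) :
    (cubeGraph (n + 1)).HasLinkage ∅ f := by
  classical
  have hG := cubeLike_cubeGraph (n := n) (by omega)
  by_cases h0 : ∃ i a, ∀ q, f q i = a
  · obtain ⟨i, a, hi⟩ := h0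
    exact hasLinkage_of_forall_apply_eq hn hlink hκ hf i a hi
  by_cases h1 : ∃ (i : Fin (n + 1)) (r q : κ × Bool),
      f r i = f (r.1, !r.2) i ∧ f q = flipBit i (f r)
  · obtain ⟨i, r, q, hr, hq⟩ := h1
    exact hasLinkage_of_apply_eq_of_eq_flipBit (by omega) hlink hκ hf i hr hq
  by_cases h2 : ∃ p i, f (p, false) i = f (p, true) i
  · push Not at h0 h1
    obtain ⟨p, i, hp⟩ := h2
    have hside : ∀ c, f (p, c) i = f (p, false) i := fun c => by cases c <;> simp [hp]
    refine hasLinkage_of_apply_eq (by omega) hlink hκ hf p i hp (fun j l hj hji hl => ?_)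
      fun h => ?_
    · have hli := (eq_flipBit_iff.1 hl).1
      have hcard := card_image_add_card_le (fun q => i.removeNth (f q)) {l} (by
        intro d hd
        rw [Finset.mem_singleton] at hd
        subst hd
        refine ⟨j, ?_, (removeNth_eq_iff.2 (Or.inr hl)).symm⟩
        rw [Finset.mem_singleton]
        rintro rfl
        exact hli rfl)
      rw [Finset.card_singleton, Fintype.card_prod, Fintype.card_bool] at hcard
      have hmem := Finset.mem_image_of_mem (fun q => i.removeNth (f q)) (Finset.mem_univ j)
      obtain ⟨z, hzj, hz⟩ : ∃ z, i.removeNth (f z) ≠ i.removeNth (f j) ∧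
          ¬ (cubeGraph n).Adj (i.removeNth (f j)) (i.removeNth (f z)) := by
        by_contra! hall
        have hflip : ∀ c, ∃ u ≠ i, f (p, c) = flipBit u (f j) := by
          intro c
          have hci : f (p, c) i = f j i := by rw [hside, hji]
          have hne : i.removeNth (f (p, c)) ≠ i.removeNth (f j) := by
            intro h
            rcases removeNth_eq_iff.1 h with h | h
            · exact hj (congrArg Prod.fst (hf h)).symm
            · exact (eq_flipBit_iff.1 h).1 hci
          obtain ⟨u, hu⟩ := cubeGraph_adj_iff.1 ((cubeGraph_adj_iff_insertNth i _ _).2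
            (Or.inr ⟨hall _ hne, hci.symm⟩))
          refine ⟨u, ?_, hu⟩
          rintro rfl
          exact (eq_flipBit_iff.1 hu).1 hci
        obtain ⟨u, hui, hu⟩ := hflip false
        obtain ⟨w, hwi, hw⟩ := hflip true
        have huw : u ≠ w := by
          rintro rfl
          have := hf (hu.trans hw.symm)
          simp at this
        have hzu : f (j.1, !j.2) u ≠ f j u := fun h => h1 u j _ h.symm hu
        have hzw : f (j.1, !j.2) w ≠ f j w := fun h => h1 w j _ h.symm hw
        obtain ⟨u, rfl⟩ := Fin.exists_succAbove_eq hui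
        obtain ⟨w, rfl⟩ := Fin.exists_succAbove_eq hwi
        obtain ⟨e, he⟩ := cubeGraph_adj_iff.1 (hall (j.1, !j.2) fun h => hzu (congrFun h u))
        have hue : u = e := by_contra fun h => hzu ((eq_flipBit_iff.1 he).2 u h)
        have hwe : w = e := by_contra fun h => hzw ((eq_flipBit_iff.1 he).2 w h)
        exact huw (by rw [hue, hwe])
      obtain ⟨y, hy, hyS⟩ := hG.exists_adj_of_not_adj
        (S := (Finset.univ.image fun q => i.removeNth (f q)).erase (i.removeNth (f j)))
        (by rw [Finset.card_erase_of_mem hmem]; omega)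
        (Finset.mem_erase.2 ⟨hzj, Finset.mem_image_of_mem _ (Finset.mem_univ z)⟩) hz
      exact ⟨y, hy, fun q h => hyS
        (Finset.mem_erase.2 ⟨hy.ne', Finset.mem_image.2 ⟨q, Finset.mem_univ _, h⟩⟩)⟩
    · obtain ⟨q, hq⟩ := h0 i (f (p, false) i)
      refine absurd ?_ hq
      by_cases hqp : q.1 = p
      · subst hqp
        exact hside q.2
      · exact h q hqp
  · push Not at h2
    refine hasLinkage_of_antipodal (by omega) hlink hκ hf fun q i => ?_
    obtain ⟨k, b⟩ := q
    have := h2 k i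
    cases b
    · exact Bool.eq_not.2 this.symm
    · exact Bool.eq_not.2 this

lemma hasLinkage_singleton_succ (hn : 2 ≤ n) (hκ : Fintype.card κ * 2 = n + 1)
    (hlink : ∀ g : κ × Bool → (Fin n → Bool), Function.Injective g → (cubeGraph n).HasLinkage ∅ g)
    (hf : Function.Injective f) {v : Fin (n + 1) → Bool} (hv : ∀ j, f j ≠ v) :
    (cubeGraph (n + 1)).HasLinkage {v} f := by
  classical
  have hG := cubeLike_cubeGraph hn
  obtain ⟨i, hi⟩ : ∃ i, (∃ q, f q = flipBit i v) ∨ ∀ j, ¬ (cubeGraph (n + 1)).Adj (f j) v := by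
    by_cases h : ∃ i q, f q = flipBit i v
    · obtain ⟨i, h⟩ := h
      exact ⟨i, Or.inl h⟩
    · push Not at h
      refine ⟨0, Or.inr fun j hj => ?_⟩
      obtain ⟨i, hi⟩ := cubeGraph_adj_iff.1 hj.symm
      exact h i j hi
  refine .of_iso (cubeSplit i) ?_
  rw [Set.image_singleton]
  refine hG.hasLinkage_prism (v i) (i.removeNth v) ((cubeSplit i).injective.comp hf)
    (fun j h => hv j ((cubeSplit i).injective h)) hκ.le (fun j l hj hl hjl => ?_) hlink
  simp only [Function.comp_apply, cubeSplit_apply] at hj hl hjl ⊢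
  have hcard := card_image_add_card_le (fun q => i.removeNth (f q)) {l} (by
    intro d hd
    rw [Finset.mem_singleton] at hd
    subst hd
    refine ⟨j, ?_, hjl.symm⟩
    rw [Finset.mem_singleton]
    rintro rfl
    exact hl hj)
  rw [Finset.card_singleton, Fintype.card_prod, Fintype.card_bool] at hcard
  obtain ⟨y, hy, hyS⟩ := hG.exists_adj_of_not_adj (by omega)
    (Finset.mem_image_of_mem (fun q => i.removeNth (f q)) (Finset.mem_univ j))
    (SimpleGraph.irrefl _)
  have hyF : ∀ q, i.removeNth (f q) ≠ y := fun q h =>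
    hyS (Finset.mem_image.2 ⟨q, Finset.mem_univ _, h⟩)
  refine ⟨y, hy, hyF, ?_⟩
  rintro rfl
  rcases hi with ⟨q, hq⟩ | h
  · exact hyF q (removeNth_eq_iff.2 (Or.inr hq))
  · exact h j ((cubeGraph_adj_iff_insertNth i _ _).2 (Or.inr ⟨hy, hj⟩))

end Linked

lemma stronglyLinked_cubeGraph_four : (cubeGraph 4).StronglyLinked 2 := by
  classical
  intro κ _ hκ f hf v hv
  obtain ⟨p, q, hpq, huniv⟩ := Nat.card_eq_two_iff.1 (Nat.card_eq_fintype_card.trans hκ)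
  obtain ⟨C, D, hCD, hvC, hvD, hC, hD⟩ := twoLinked_cubeGraph_four (s := f (p, false))
    (t := f (p, true)) (x := f (q, false)) (y := f (q, true)) (v := v) (hf.ne (by simp))
    (hf.ne (by simp)) (hf.ne (by simp [hpq])) (hf.ne (by simp [hpq])) (hf.ne (by simp [hpq]))
    (hf.ne (by simp [hpq])) (hv _) (hv _) (hv _) (hv _)
  have hcases : ∀ k, k = p ∨ k = q := fun k => by
    simpa using huniv.ge (Set.mem_univ k)
  refine ⟨fun k => if k = p then C else D, fun k l hkl => ?_, fun k => ?_, fun k => ?_⟩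
  · rcases hcases k with rfl | rfl <;> rcases hcases l with rfl | rfl
    · exact absurd rfl hkl
    · simpa [Function.onFun, hkl.symm] using hCD
    · simpa [Function.onFun, hkl] using hCD.symm
    · exact absurd rfl hkl
  · rw [Set.disjoint_singleton_right]
    dsimp only
    split_ifs <;> assumption
  · rcases hcases k with rfl | rfl
    · simpa using hC
    · simpa [hpq.symm] using hD

lemma stronglyLinked_cubeGraph {m : ℕ} (hm : 2 ≤ m) : (cubeGraph (2 * m)).StronglyLinked m := by
  induction m, hm using Nat.le_induction with
  | base => exact stronglyLinked_cubeGraph_four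
  | succ m hm ih =>
    intro κ _ hκ f hf v hv
    exact hasLinkage_singleton_succ (n := 2 * m + 1) (by omega) (by omega)
      (fun g hg => hasLinkage_succ (n := 2 * m) (by omega)
        (by rwa [Nat.mul_div_cancel_left m two_pos]) (by omega) hg) hf hv

lemma isLinked_of_hasLinkage {V : Type} {G : SimpleGraph V} {k : ℕ} (hcard : 2 * k ≤ Nat.card V)
    (h : ∀ f : Fin k × Bool → V, Function.Injective f → G.HasLinkage ∅ f) : IsLinked G k := by
  classical
  refine ⟨hcard, fun s t hst => ?_⟩
  have hf : Function.Injective fun q : Fin k × Bool =>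
      Sum.elim s t (if q.2 then .inr q.1 else .inl q.1) := by
    refine hst.comp ?_
    rintro ⟨i, b⟩ ⟨j, c⟩
    cases b <;> cases c <;> simp
  obtain ⟨C, hC, -, hr⟩ := h _ hf
  have hr' : ∀ i, ∃ p : G.Walk (s i) (t i), ∀ x ∈ p.support, x ∈ C i := hr
  choose P hP using hr'
  refine ⟨fun i => (P i).bypass, fun i => (P i).bypass_isPath, fun i j hij v hi hj => ?_⟩
  exact Set.disjoint_left.1 (hC hij) (hP i v ((P i).support_bypass_subset_support hi))
    (hP j v ((P j).support_bypass_subset_support hj))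

theorem cube_linked (d : ℕ) (hd : 1 ≤ d) (hd3 : d ≠ 3) :
    IsLinked (cubeGraph d) ((d + 1) / 2) := by
  have hpow : d < 2 ^ d := Nat.lt_two_pow_self
  refine isLinked_of_hasLinkage (by simp; omega) fun f hf => ?_
  rcases Nat.lt_or_ge d 4 with h4 | h4
  · have hone : (d + 1) / 2 = 1 := by omega
    have hreach : ∀ x y : Fin d → Bool, (cubeGraph d).ReachIn Set.univ x y := by
      intro x y
      rcases (by omega : d = 1 ∨ d = 2) with rfl | rfl
      · have : ∀ x y : Fin 1 → Bool, x = y ∨ y = flipBit 0 x := by decide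
        rcases this x y with rfl | h
        · exact .refl (Set.mem_univ _)
        · exact .of_adj (cubeGraph_adj_iff.2 ⟨0, h⟩) (Set.mem_univ _) (Set.mem_univ _)
      · exact ((cubeLike_cubeGraph le_rfl).reachIn_of_card_lt (S := ∅) (by simp) (by simp)
          (by simp)).mono (Set.subset_univ _)
    refine ⟨fun _ => Set.univ, fun i j hij => absurd ?_ hij, fun _ => by simp, fun _ => hreach _ _⟩
    apply Fin.ext
    omega
  · rcases Nat.even_or_odd' d with ⟨m, rfl | rfl⟩
    · have hm : (2 * m + 1) / 2 = m := by omega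
      obtain ⟨v, hv⟩ : ∃ v, ∀ j, f j ≠ v := by
        by_contra! h
        have := Fintype.card_le_of_surjective f h
        simp at this
        omega
      exact (stronglyLinked_cubeGraph (by omega) _ (by simp [hm]) f hf v hv).mono
        (Set.empty_subset _)
    · exact hasLinkage_succ (by omega) (by
        rw [Nat.mul_div_cancel_left m two_pos]; exact stronglyLinked_cubeGraph (by omega))
        (by simp; omega) hf
end

section
/- For every integer d ≥ 1, the hypercube graph Q_d is strongly ⌊d/2⌋-linked; that is, Q_d has at least 2⌊d/2⌋+1 vertices and, for every vertex v of Q_d, the subgraph of Q_d induced on the vertices other than v is ⌊d/2⌋-linked. -/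
open Finset

/-- The vertex obtained from `x` by flipping coordinate `i`. -/
def flipAt {n : ℕ} (i : Fin n) (x : Fin n → Bool) : Fin n → Bool :=
  Function.update x i (!x i)

/-- The face of the cube through `b` whose free coordinates are those in `D`. -/
def cubeFace {n : ℕ} (D : Finset (Fin n)) (b : Fin n → Bool) : Finset (Fin n → Bool) :=
  Fintype.piFinset fun j => if j ∈ D then univ else {b j}

/-- `x` and `y` are joined by a walk of the cube staying inside `C`. -/
def WalkIn {n : ℕ} (C : Set (Fin n → Bool)) (x y : Fin n → Bool) : Prop :=
  ∃ w : (cubeGraph n).Walk x y, ∀ v ∈ w.support, v ∈ C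

/-- The pairs `(s j, t j)`, `j ∈ J`, are joined inside pairwise disjoint subsets of the face.
Trivial pairs `s j = t j` act as forbidden vertices for the other pairs. -/
def LinkableIn {n : ℕ} {ι : Type*} (D : Finset (Fin n)) (b : Fin n → Bool) (J : Finset ι)
    (s t : ι → Fin n → Bool) : Prop :=
  ∃ C : ι → Set (Fin n → Bool),
    (∀ j ∈ J, C j ⊆ cubeFace D b ∧ WalkIn (C j) (s j) (t j)) ∧
      ∀ j ∈ J, ∀ k ∈ J, j ≠ k → Disjoint (C j) (C k)

/-- The pairs `(s j, t j)`, `j ∈ J`, lie in the face and are pairwise disjoint. -/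
structure SeparatedPairs {n : ℕ} {ι : Type*} (D : Finset (Fin n)) (b : Fin n → Bool)
    (J : Finset ι) (s t : ι → Fin n → Bool) : Prop where
  left_mem : ∀ j ∈ J, s j ∈ cubeFace D b
  right_mem : ∀ j ∈ J, t j ∈ cubeFace D b
  left_ne_left : ∀ j ∈ J, ∀ k ∈ J, j ≠ k → s j ≠ s k
  left_ne_right : ∀ j ∈ J, ∀ k ∈ J, j ≠ k → s j ≠ t k
  right_ne_right : ∀ j ∈ J, ∀ k ∈ J, j ≠ k → t j ≠ t k

section Flip

variable {n : ℕ}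

@[simp] lemma flipAt_same (i : Fin n) (x : Fin n → Bool) : flipAt i x i = !x i := by
  simp [flipAt]

lemma flipAt_of_ne {i j : Fin n} (h : j ≠ i) (x : Fin n → Bool) : flipAt i x j = x j := by
  simp [flipAt, h]

@[simp] lemma flipAt_flipAt (i : Fin n) (x : Fin n → Bool) : flipAt i (flipAt i x) = x := by
  simp [flipAt]

lemma flipAt_injective (i : Fin n) : Function.Injective (flipAt i) :=
  Function.LeftInverse.injective (flipAt_flipAt i)

lemma flipAt_eq_comm {i : Fin n} {x y : Fin n → Bool} : flipAt i x = y ↔ flipAt i y = x :=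
  ⟨fun h => by rw [← h, flipAt_flipAt], fun h => by rw [← h, flipAt_flipAt]⟩

lemma flipAt_left_injective (x : Fin n → Bool) : Function.Injective fun i => flipAt i x := by
  intro i j h
  by_contra hne
  have := congrFun h i
  simp [flipAt_of_ne hne] at this

lemma flipAt_flipAt_ne_flipAt (i j k : Fin n) (x : Fin n → Bool) :
    flipAt i (flipAt j x) ≠ flipAt k x := by
  intro h
  by_cases hij : i = j
  · subst hij
    have := congrFun h k
    simp at this
  · have hi := congrFun h i
    have hj := congrFun h j
    by_cases hki : k = i
    · subst hki
      simp [flipAt_of_ne (Ne.symm hij)] at hj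
    · simp [flipAt_of_ne hij, flipAt_of_ne (Ne.symm hki)] at hi

lemma adj_flipAt (i : Fin n) (x : Fin n → Bool) : (cubeGraph n).Adj x (flipAt i x) := by
  have : ({j | x j ≠ flipAt i x j} : Finset (Fin n)) = {i} := by
    ext j
    by_cases h : j = i
    · subst h; simp
    · simp [flipAt_of_ne h, h]
  change hammingDist x (flipAt i x) = 1
  rw [hammingDist, this, card_singleton]

end Flip

section Face

variable {n : ℕ} {D : Finset (Fin n)} {b : Fin n → Bool}

lemma mem_cubeFace {x : Fin n → Bool} : x ∈ cubeFace D b ↔ ∀ j ∉ D, x j = b j := by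
  simp only [cubeFace, Fintype.mem_piFinset]
  refine forall_congr' fun j => ?_
  by_cases h : j ∈ D <;> simp [h]

lemma card_cubeFace : #(cubeFace D b) = 2 ^ #D := by
  simp [cubeFace, Fintype.card_piFinset, apply_ite Finset.card]

lemma flipAt_mem_cubeFace {i : Fin n} (hi : i ∈ D) {x : Fin n → Bool}
    (hx : x ∈ cubeFace D b) : flipAt i x ∈ cubeFace D b := by
  rw [mem_cubeFace] at hx ⊢
  intro j hj
  have hji : j ≠ i := fun h => hj (h ▸ hi)
  rw [flipAt_of_ne hji, hx j hj]

lemma mem_cubeFace_erase {i : Fin n} (hi : i ∈ D) {a : Bool} {x : Fin n → Bool} :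
    x ∈ cubeFace (D.erase i) (Function.update b i a) ↔ x ∈ cubeFace D b ∧ x i = a := by
  simp only [mem_cubeFace]
  constructor
  · intro h
    refine ⟨fun j hj => ?_, by simpa using h i (by simp)⟩
    have hji : j ≠ i := fun h => hj (h ▸ hi)
    simpa [hji] using h j (by simp [hj])
  · rintro ⟨h, ha⟩ j hj
    by_cases hji : j = i
    · subst hji; simpa using ha
    · simpa [hji] using h j (by simpa [hji] using hj)

lemma eq_of_mem_cubeFace_empty {x y : Fin n → Bool} (hx : x ∈ cubeFace ∅ b)
    (hy : y ∈ cubeFace ∅ b) : x = y := by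
  rw [mem_cubeFace] at hx hy
  funext j
  rw [hx j (by simp), hy j (by simp)]

/-- A face has many edges in direction `i` avoiding a small set of vertices. -/
lemma exists_free_columns {i : Fin n} (hi : i ∈ D) (a : Bool) (X : Finset (Fin n → Bool))
    {m : ℕ} (hm : #X + m ≤ 2 ^ (#D - 1)) :
    ∃ Y : Finset (Fin n → Bool), #Y = m ∧
      ∀ y ∈ Y, y ∈ cubeFace D b ∧ y i = a ∧ y ∉ X ∧ flipAt i y ∉ X := by
  classical
  set A := cubeFace (D.erase i) (Function.update b i a) with hA
  have hcard : #A = 2 ^ (#D - 1) := by rw [hA, card_cubeFace, card_erase_of_mem hi]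
  let π : (Fin n → Bool) → Fin n → Bool := fun x => if x i = a then x else flipAt i x
  have h1 : m ≤ #(A \ X.image π) := by
    have := le_card_sdiff (X.image π) A
    have := card_image_le (s := X) (f := π)
    omega
  obtain ⟨Y, hY, hYm⟩ := exists_subset_card_eq h1
  refine ⟨Y, hYm, fun y hy => ?_⟩
  have hy' := mem_sdiff.1 (hY hy)
  obtain ⟨hyf, hya⟩ := (mem_cubeFace_erase hi).1 hy'.1
  refine ⟨hyf, hya, fun h => hy'.2 (mem_image.2 ⟨y, h, by simp [π, hya]⟩), fun h => ?_⟩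
  exact hy'.2 (mem_image.2 ⟨_, h, by simp [π, hya]⟩)

end Face

section Joined

variable {n : ℕ} {C C' : Set (Fin n → Bool)} {x y z : Fin n → Bool}

lemma WalkIn.mono (h : WalkIn C x y) (hC : C ⊆ C') : WalkIn C' x y :=
  ⟨h.choose, fun v hv => hC (h.choose_spec v hv)⟩

lemma WalkIn.refl (hx : x ∈ C) : WalkIn C x x :=
  ⟨.nil, by simpa using hx⟩

lemma WalkIn.symm (h : WalkIn C x y) : WalkIn C y x := by
  obtain ⟨w, hw⟩ := h
  exact ⟨w.reverse, by simpa using hw⟩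

lemma WalkIn.trans (h : WalkIn C x y) (h' : WalkIn C y z) : WalkIn C x z := by
  obtain ⟨w, hw⟩ := h
  obtain ⟨w', hw'⟩ := h'
  refine ⟨w.append w', fun v hv => ?_⟩
  rcases (SimpleGraph.Walk.mem_support_append_iff _ _).1 hv with h | h
  exacts [hw v h, hw' v h]

lemma WalkIn.left_mem (h : WalkIn C x y) : x ∈ C := by
  obtain ⟨w, hw⟩ := h
  exact hw _ w.start_mem_support

lemma WalkIn.right_mem (h : WalkIn C x y) : y ∈ C := h.symm.left_mem

lemma walkIn_flipAt (i : Fin n) (hx : x ∈ C) (hy : flipAt i x ∈ C) :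
    WalkIn C x (flipAt i x) :=
  ⟨(adj_flipAt i x).toWalk, by simp [hx, hy]⟩

lemma walkIn_flipAt_sdiff {D : Finset (Fin n)} {b : Fin n → Bool} {F : Finset (Fin n → Bool)}
    {i : Fin n} (hi : i ∈ D) (hx : x ∈ cubeFace D b) (hxF : x ∉ F) (hfF : flipAt i x ∉ F) :
    WalkIn {z | z ∈ cubeFace D b ∧ z ∉ F} x (flipAt i x) :=
  walkIn_flipAt i ⟨hx, hxF⟩ ⟨flipAt_mem_cubeFace hi hx, hfF⟩

end Joined

section Connectivity

variable {n : ℕ}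

/-- A face of dimension `m` stays connected after deleting fewer than `m` vertices. -/
lemma walkIn_cubeFace_sdiff (D : Finset (Fin n)) :
    ∀ (b : Fin n → Bool) (F : Finset (Fin n → Bool)), #F ≤ #D - 1 →
      ∀ x ∈ cubeFace D b, ∀ y ∈ cubeFace D b, x ∉ F → y ∉ F →
        WalkIn {z | z ∈ cubeFace D b ∧ z ∉ F} x y := by
  classical
  induction hd : #D generalizing D with
  | zero =>
    intro b F hF x hx y hy hxF hyF
    obtain rfl := card_eq_zero.1 hd
    obtain rfl := eq_of_mem_cubeFace_empty hx hy
    exact WalkIn.refl ⟨hx, hxF⟩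
  | succ d ih =>
    intro b F hF x hx y hy hxF hyF
    by_cases hxy : x = y
    · subst hxy; exact WalkIn.refl ⟨hx, hxF⟩
    obtain ⟨i, hi⟩ : ∃ i, x i ≠ y i := by
      by_contra! h
      exact hxy (funext h)
    have hiD : i ∈ D := by
      by_contra h
      rw [mem_cubeFace] at hx hy
      exact hi (by rw [hx i h, hy i h])
    have hDi : #(D.erase i) = d := by rw [card_erase_of_mem hiD, hd]; rfl
    -- connectivity inside one half
    have half : ∀ a : Bool, #({z ∈ F | z i = a}) ≤ d - 1 →
        ∀ u ∈ cubeFace D b, ∀ w ∈ cubeFace D b, u i = a → w i = a → u ∉ F → w ∉ F →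
          WalkIn {z | z ∈ cubeFace D b ∧ z ∉ F} u w := by
      intro a ha u hu w hw hua hwa huF hwF
      refine (ih (D.erase i) hDi (Function.update b i a) {z ∈ F | z i = a} (by omega) u
        ((mem_cubeFace_erase hiD).2 ⟨hu, hua⟩) w ((mem_cubeFace_erase hiD).2 ⟨hw, hwa⟩)
        (by simp [huF]) (by simp [hwF])).mono ?_
      rintro z ⟨hz, hzF⟩
      obtain ⟨hz1, hz2⟩ := (mem_cubeFace_erase hiD).1 hz
      exact ⟨hz1, fun h => hzF (by simp [h, hz2])⟩
    have hsum : #{z ∈ F | z i = x i} + #{z ∈ F | z i = y i} ≤ #F := by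
      rw [← card_union_of_disjoint]
      · exact card_le_card (union_subset (filter_subset _ _) (filter_subset _ _))
      · rw [disjoint_filter]
        intro z _ h1 h2
        exact hi (h1.symm.trans h2)
    have hfy : y i = !x i := by revert hi; cases x i <;> cases y i <;> simp
    -- one half contains no deleted vertex
    have easy : ∀ u ∈ cubeFace D b, ∀ w ∈ cubeFace D b, u ∉ F → w ∉ F → w i = !u i →
        #{z ∈ F | z i = w i} = 0 → WalkIn {z | z ∈ cubeFace D b ∧ z ∉ F} u w := by
      intro u hu w hw huF hwF huw h0
      have hfu : flipAt i u ∉ F := fun h => by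
        have : flipAt i u ∈ ({z ∈ F | z i = w i} : Finset _) := by simp [h, huw]
        rw [card_eq_zero.1 h0] at this
        simp at this
      exact (walkIn_flipAt_sdiff hiD hu huF hfu).trans
        (half (w i) (by omega) _ (flipAt_mem_cubeFace hiD hu) _ hw (by simp [huw]) rfl hfu hwF)
    by_cases h1 : #{z ∈ F | z i = x i} ≤ d - 1
    · by_cases h2 : #{z ∈ F | z i = y i} ≤ d - 1
      · obtain ⟨Y, hY1, hY⟩ := exists_free_columns (b := b) hiD (x i) F (m := 1) (by
          rw [hd]
          have : d < 2 ^ d := Nat.lt_two_pow_self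
          simp only [Nat.add_sub_cancel]
          omega)
        obtain ⟨c, rfl⟩ := card_eq_one.1 hY1
        obtain ⟨hc1, hc2, hc3, hc4⟩ := hY c (by simp)
        exact ((half _ h1 x hx c hc1 rfl hc2 hxF hc3).trans
          (walkIn_flipAt_sdiff hiD hc1 hc3 hc4)).trans
          (half _ h2 _ (flipAt_mem_cubeFace hiD hc1) y hy (by simp [hc2, hfy]) rfl hc4 hyF)
      · exact (easy y hy x hx hyF hxF (by simp [hfy]) (by omega)).symm
    · exact easy x hx y hy hxF hyF hfy (by omega)

/-- A set of three vertices separating two vertices of a three-dimensional face contains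
all neighbours of one of them. -/
lemma walkIn_cubeFace_sdiff_of_card_three {D : Finset (Fin n)} (hD : #D = 3)
    (b : Fin n → Bool) (F : Finset (Fin n → Bool)) (hF : #F ≤ 3) {x y : Fin n → Bool}
    (hx : x ∈ cubeFace D b) (hy : y ∈ cubeFace D b) (hxF : x ∉ F) (hyF : y ∉ F)
    (hxn : ∃ j ∈ D, flipAt j x ∉ F) (hyn : ∃ j ∈ D, flipAt j y ∉ F) :
    WalkIn {z | z ∈ cubeFace D b ∧ z ∉ F} x y := by
  classical
  by_cases hxy : x = y
  · subst hxy; exact WalkIn.refl ⟨hx, hxF⟩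
  obtain ⟨i, hi⟩ : ∃ i, x i ≠ y i := by
    by_contra! h
    exact hxy (funext h)
  have hiD : i ∈ D := by
    by_contra h
    rw [mem_cubeFace] at hx hy
    exact hi (by rw [hx i h, hy i h])
  have hfy : y i = !x i := by revert hi; cases x i <;> cases y i <;> simp
  have hsum : #{z ∈ F | z i = x i} + #{z ∈ F | z i = y i} ≤ #F := by
    rw [← card_union_of_disjoint]
    · exact card_le_card (union_subset (filter_subset _ _) (filter_subset _ _))
    · rw [disjoint_filter]
      intro z _ h1 h2
      exact hi (h1.symm.trans h2)
  have key : ∀ u ∈ cubeFace D b, ∀ w ∈ cubeFace D b, u ∉ F → w ∉ F → w i = !u i →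
      (∃ j ∈ D, flipAt j u ∉ F) → #{z ∈ F | z i = w i} ≤ 1 →
        WalkIn {z | z ∈ cubeFace D b ∧ z ∉ F} u w := by
    rintro u hu w hw huF hwF huw ⟨j, hjD, hju⟩ h1
    have half : ∀ v ∈ cubeFace D b, v i = w i → v ∉ F →
        WalkIn {z | z ∈ cubeFace D b ∧ z ∉ F} v w := by
      intro v hv hvw hvF
      refine (walkIn_cubeFace_sdiff (D.erase i) (Function.update b i (w i))
        {z ∈ F | z i = w i} (by rw [card_erase_of_mem hiD, hD]; omega) v
        ((mem_cubeFace_erase hiD).2 ⟨hv, hvw⟩) w ((mem_cubeFace_erase hiD).2 ⟨hw, rfl⟩)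
        (by simp [hvF]) (by simp [hwF])).mono ?_
      rintro z ⟨hz, hzF⟩
      obtain ⟨hz1, hz2⟩ := (mem_cubeFace_erase hiD).1 hz
      exact ⟨hz1, fun h => hzF (by simp [h, hz2])⟩
    by_cases hfu : flipAt i u ∈ F
    · have hji : i ≠ j := by rintro rfl; exact hju hfu
      have hv : flipAt j u ∈ cubeFace D b := flipAt_mem_cubeFace hjD hu
      have hv' : flipAt i (flipAt j u) ∈ cubeFace D b := flipAt_mem_cubeFace hiD hv
      have hvF : flipAt i (flipAt j u) ∉ F := by
        intro h
        have := card_le_one.1 h1 _ (mem_filter.2 ⟨h, by simp [flipAt_of_ne hji, huw]⟩) _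
          (mem_filter.2 ⟨hfu, by simp [huw]⟩)
        exact flipAt_flipAt_ne_flipAt _ _ _ _ this
      exact ((walkIn_flipAt_sdiff hjD hu huF hju).trans
        (walkIn_flipAt_sdiff hiD hv hju hvF)).trans
        (half _ hv' (by simp [flipAt_of_ne hji, huw]) hvF)
    · have hv : flipAt i u ∈ cubeFace D b := flipAt_mem_cubeFace hiD hu
      exact (walkIn_flipAt_sdiff hiD hu huF hfu).trans (half _ hv (by simp [huw]) hfu)
  by_cases h : #{z ∈ F | z i = y i} ≤ 1
  · exact key x hx y hy hxF hyF hfy hxn h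
  · exact (key y hy x hx hyF hxF (by simp [hfy]) hyn (by omega)).symm

end Connectivity

section Directions

variable {n : ℕ}

/-- A nonempty vertex set spans edges in fewer directions than it has vertices. -/
lemma card_directions_lt (D : Finset (Fin n)) :
    ∀ X : Finset (Fin n → Bool), X.Nonempty → (∀ i ∈ D, ∃ x ∈ X, flipAt i x ∈ X) →
      #D < #X := by
  classical
  induction D using Finset.induction_on with
  | empty => intro X hX _; simpa using hX
  | insert i D hi ih =>
    intro X hX h
    obtain ⟨x, hx, hxi⟩ := h i (mem_insert_self _ _)
    have hcol : X.image (fun z => Function.update z i false) =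
        (X.erase x).image fun z => Function.update z i false := by
      refine subset_antisymm (fun z hz => ?_) (image_subset_image (erase_subset _ _))
      obtain ⟨w, hw, rfl⟩ := mem_image.1 hz
      by_cases hwx : w = x
      · refine mem_image.2 ⟨flipAt i x, mem_erase.2 ⟨?_, hxi⟩, by simp [hwx, flipAt]⟩
        exact fun h => by simpa using congrFun h i
      · exact mem_image_of_mem _ (mem_erase.2 ⟨hwx, hw⟩)
    have hlt := ih (X.image fun z => Function.update z i false) (hX.image _) (by
      intro j hj
      obtain ⟨y, hy, hyj⟩ := h j (mem_insert_of_mem hj)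
      refine ⟨_, mem_image_of_mem _ hy, ?_⟩
      have hji : j ≠ i := fun h => hi (h ▸ hj)
      refine mem_image.2 ⟨_, hyj, ?_⟩
      simp [flipAt, hji, Function.update_comm hji])
    rw [hcol] at hlt
    have h1 := card_image_le (s := X.erase x) (f := fun z => Function.update z i false)
    rw [card_erase_of_mem hx] at h1
    have := card_pos.2 hX
    rw [card_insert_of_notMem hi]
    omega

/-- A small vertex set spans at most one edge in some direction. -/
lemma exists_direction {D : Finset (Fin n)} (hD : D.Nonempty) {X : Finset (Fin n → Bool)}
    (hX : #X ≤ #D + 1) :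
    ∃ i ∈ D, ∀ x ∈ X, ∀ y ∈ X, flipAt i x ∈ X → flipAt i y ∈ X → y = x ∨ y = flipAt i x := by
  classical
  by_contra! h
  obtain ⟨i, hi⟩ := hD
  obtain ⟨x, hx, y, hy, hxi, hyi, hyx, hyx'⟩ := h i hi
  let f : (Fin n → Bool) → Fin n → Bool := fun z => Function.update z i false
  have hf : ∀ z, f (flipAt i z) = f z := fun z => by simp [f, flipAt]
  have hne : ∀ z, flipAt i z ≠ z := fun z h => by simpa using congrFun h i
  have hcol : X.image f = ((X.erase x).erase y).image f := by
    refine subset_antisymm (fun z hz => ?_)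
      (image_subset_image ((erase_subset _ _).trans (erase_subset _ _)))
    obtain ⟨w, hw, rfl⟩ := mem_image.1 hz
    by_cases hwx : w = x
    · refine mem_image.2 ⟨flipAt i x, ?_, by rw [hf, hwx]⟩
      simp only [mem_erase]
      exact ⟨Ne.symm hyx', hne x, hxi⟩
    · by_cases hwy : w = y
      · refine mem_image.2 ⟨flipAt i y, ?_, by rw [hf, hwy]⟩
        simp only [mem_erase]
        exact ⟨hne y, fun h => hyx' (by rw [← h, flipAt_flipAt]), hyi⟩
      · exact mem_image_of_mem _ (by simp [hwx, hwy, hw])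
  have hlt := card_directions_lt (D.erase i) (X.image f) ⟨_, mem_image_of_mem _ hx⟩ (by
    intro j hj
    obtain ⟨hji, hjD⟩ := mem_erase.1 hj
    obtain ⟨z, hz, _, _, hzj, _⟩ := h j hjD
    refine ⟨_, mem_image_of_mem _ hz, mem_image.2 ⟨_, hzj, ?_⟩⟩
    simp [f, flipAt, hji, Function.update_comm hji])
  rw [hcol] at hlt
  have h1 := card_image_le (s := (X.erase x).erase y) (f := f)
  rw [card_erase_of_mem (by simp [hyx, hy]), card_erase_of_mem hx] at h1
  have h2 : 1 < #X := one_lt_card.2 ⟨x, hx, y, hy, Ne.symm hyx⟩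
  rw [card_erase_of_mem hi] at hlt
  have := card_pos.2 ⟨i, hi⟩
  omega

end Directions

section FourDim

variable {n : ℕ} {D : Finset (Fin n)} {b : Fin n → Bool}

/-- The pairs `(s₁, t₁)` and `(s₂, t₂)` can be linked in the face avoiding `v`. -/
def TwoLinkableAvoiding (D : Finset (Fin n)) (b v s₁ t₁ s₂ t₂ : Fin n → Bool) : Prop :=
  ∃ C₁ C₂ : Set (Fin n → Bool), C₁ ⊆ cubeFace D b ∧ C₂ ⊆ cubeFace D b ∧ Disjoint C₁ C₂ ∧
    v ∉ C₁ ∧ v ∉ C₂ ∧ WalkIn C₁ s₁ t₁ ∧ WalkIn C₂ s₂ t₂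

lemma TwoLinkableAvoiding.symm {v s₁ t₁ s₂ t₂ : Fin n → Bool}
    (h : TwoLinkableAvoiding D b v s₁ t₁ s₂ t₂) : TwoLinkableAvoiding D b v s₂ t₂ s₁ t₁ := by
  obtain ⟨C₁, C₂, h1, h2, h3, h4, h5, h6, h7⟩ := h
  exact ⟨C₂, C₁, h2, h1, h3.symm, h5, h4, h7, h6⟩

lemma walkIn_half {i : Fin n} (hD : #D = 4) (hi : i ∈ D) (a : Bool)
    {F : Finset (Fin n → Bool)} (hF : #F ≤ 3) {x y : Fin n → Bool}
    (hx : x ∈ cubeFace D b) (hy : y ∈ cubeFace D b) (hxF : x ∉ F) (hyF : y ∉ F)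
    (hxa : x i = a ∨ flipAt i x ∉ F) (hya : y i = a ∨ flipAt i y ∉ F)
    (hFa : ∃ z ∈ F, z i ≠ a) :
    WalkIn ({z | z ∈ cubeFace D b ∧ z i = a ∧ z ∉ F} ∪ {x, y}) x y := by
  classical
  have key : ∀ u ∈ cubeFace D b, u ∉ F → (u i = a ∨ flipAt i u ∉ F) → (u = x ∨ u = y) →
      ∃ u' ∈ cubeFace D b, u' i = a ∧ u' ∉ F ∧
        WalkIn ({z | z ∈ cubeFace D b ∧ z i = a ∧ z ∉ F} ∪ {x, y}) u u' := by
    intro u hu huF hua huxy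
    by_cases h : u i = a
    · exact ⟨u, hu, h, huF, WalkIn.refl (Or.inl ⟨hu, h, huF⟩)⟩
    · have hf := hua.resolve_left h
      have hfa : flipAt i u i = a := by rw [flipAt_same]; revert h; cases u i <;> cases a <;> simp
      have hfu := flipAt_mem_cubeFace hi hu
      exact ⟨_, hfu, hfa, hf, walkIn_flipAt i (Or.inr huxy) (Or.inl ⟨hfu, hfa, hf⟩)⟩
  obtain ⟨x', hx', hx'a, hx'F, hxx'⟩ := key x hx hxF hxa (Or.inl rfl)
  obtain ⟨y', hy', hy'a, hy'F, hyy'⟩ := key y hy hyF hya (Or.inr rfl)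
  refine (hxx'.trans ?_).trans hyy'.symm
  obtain ⟨z, hzF, hza⟩ := hFa
  have hcard : #{z ∈ F | z i = a} ≤ 2 := by
    have : #{z ∈ F | z i = a} < #F := card_lt_card (filter_ssubset.2 ⟨z, hzF, hza⟩)
    omega
  refine (walkIn_cubeFace_sdiff (D.erase i) (Function.update b i a) {z ∈ F | z i = a}
    (by rw [card_erase_of_mem hi, hD]; omega) x' ((mem_cubeFace_erase hi).2 ⟨hx', hx'a⟩) y'
    ((mem_cubeFace_erase hi).2 ⟨hy', hy'a⟩) (by simp [hx'F]) (by simp [hy'F])).mono ?_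
  rintro z ⟨hz, hzF⟩
  obtain ⟨hz1, hz2⟩ := (mem_cubeFace_erase hi).1 hz
  exact Or.inl ⟨hz1, hz2, fun h => hzF (by simp [h, hz2])⟩

lemma exists_side_of_bits (s₁ t₁ s₂ t₂ v : Bool) (a b c d e : Prop)
    (hab : ¬(a ∧ b)) (hcd : ¬(c ∧ d))
    (hac : a ∧ c → s₁ ≠ s₂) (had : a ∧ d → s₁ ≠ t₂) (hae : a ∧ e → s₁ ≠ v)
    (hbc : b ∧ c → t₁ ≠ s₂) (hbd : b ∧ d → t₁ ≠ t₂) (hbe : b ∧ e → t₁ ≠ v)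
    (hce : c ∧ e → s₂ ≠ v) (hde : d ∧ e → t₂ ≠ v)
    (ha : a → c ∨ d ∨ e) (hb : b → c ∨ d ∨ e) (hc : c → a ∨ b ∨ e) (hd : d → a ∨ b ∨ e)
    (hne : ¬(t₁ = s₁ ∧ s₂ = s₁ ∧ t₂ = s₁ ∧ v = s₁)) :
    ∃ x : Bool, (s₁ = x ∨ ¬a) ∧ (t₁ = x ∨ ¬b) ∧ (s₂ = !x ∨ ¬c) ∧ (t₂ = !x ∨ ¬d) ∧
      (s₂ ≠ x ∨ t₂ ≠ x ∨ v ≠ x) ∧ (s₁ ≠ !x ∨ t₁ ≠ !x ∨ v ≠ !x) := by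
  simp only [Bool.exists_bool]
  cases s₁ <;> cases t₁ <;> cases s₂ <;> cases t₂ <;> cases v <;> grind

lemma twoLinkableAvoiding_of_adj {i : Fin n} (hD : #D = 4) (hi : i ∈ D)
    {v s₁ t₁ s₂ t₂ : Fin n → Bool} (hs₁ : s₁ ∈ cubeFace D b) (hs₂ : s₂ ∈ cubeFace D b)
    (ht₂ : t₂ ∈ cubeFace D b) (hss : s₁ ≠ s₂) (hst : s₁ ≠ t₂) (hts : t₁ ≠ s₂) (htt : t₁ ≠ t₂)
    (hv₁ : v ≠ s₁) (hv₁' : v ≠ t₁) (hv₂ : v ≠ s₂) (hv₂' : v ≠ t₂) (h : flipAt i s₁ = t₁) :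
    TwoLinkableAvoiding D b v s₁ t₁ s₂ t₂ := by
  classical
  have ht₁ : t₁ ∈ cubeFace D b := h ▸ flipAt_mem_cubeFace hi hs₁
  refine ⟨{s₁, t₁}, {z | z ∈ cubeFace D b ∧ z ∉ ({s₁, t₁, v} : Finset _)}, ?_, fun z hz => hz.1,
    ?_, ?_, ?_, ?_, ?_⟩
  · rintro z (rfl | rfl)
    exacts [hs₁, ht₁]
  · rw [Set.disjoint_left]
    rintro z (rfl | rfl) hz <;> simp at hz
  · simp [hv₁, hv₁']
  · simp
  · subst h
    exact walkIn_flipAt i (by simp) (by simp)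
  · exact walkIn_cubeFace_sdiff D b _ (card_le_three.trans (by omega)) _ hs₂ _ ht₂
      (by simp [hss.symm, hts.symm, hv₂.symm]) (by simp [hst.symm, htt.symm, hv₂'.symm])

/-- Route the first pair inside a three-dimensional face, and the second one through the
opposite face. -/
lemma twoLinkableAvoiding_of_facet {i : Fin n} (hD : #D = 4) (hi : i ∈ D)
    {v s₁ t₁ s₂ t₂ : Fin n → Bool} (hs₁ : s₁ ∈ cubeFace D b) (ht₁ : t₁ ∈ cubeFace D b)
    (hs₂ : s₂ ∈ cubeFace D b) (ht₂ : t₂ ∈ cubeFace D b)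
    (hss : s₁ ≠ s₂) (hst : s₁ ≠ t₂) (hts : t₁ ≠ s₂) (htt : t₁ ≠ t₂)
    (hv₁ : v ≠ s₁) (hv₁' : v ≠ t₁) (hv₂ : v ≠ s₂) (hv₂' : v ≠ t₂)
    (ht₁i : t₁ i = s₁ i) (hs₂i : s₂ i = s₁ i) (ht₂i : t₂ i = s₁ i) (hvi : v i = s₁ i)
    (h₁ : ∃ j ∈ D.erase i, flipAt j s₁ ∉ ({s₂, t₂, v} : Finset _))
    (h₂ : ∃ j ∈ D.erase i, flipAt j t₁ ∉ ({s₂, t₂, v} : Finset _)) :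
    TwoLinkableAvoiding D b v s₁ t₁ s₂ t₂ := by
  classical
  have hDi : #(D.erase i) = 3 := by rw [card_erase_of_mem hi, hD]
  have hA := walkIn_cubeFace_sdiff_of_card_three hDi (Function.update b i (s₁ i)) {s₂, t₂, v}
    card_le_three ((mem_cubeFace_erase hi).2 ⟨hs₁, rfl⟩) ((mem_cubeFace_erase hi).2 ⟨ht₁, ht₁i⟩)
    (by simp [hss, hst, hv₁.symm]) (by simp [hts, htt, hv₁'.symm]) h₁ h₂
  have hB := walkIn_cubeFace_sdiff (D.erase i) (Function.update b i (!s₁ i)) ∅ (by simp)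
    (flipAt i s₂) ((mem_cubeFace_erase hi).2 ⟨flipAt_mem_cubeFace hi hs₂, by simp [hs₂i]⟩)
    (flipAt i t₂) ((mem_cubeFace_erase hi).2 ⟨flipAt_mem_cubeFace hi ht₂, by simp [ht₂i]⟩)
    (by simp) (by simp)
  refine ⟨_, {z | z ∈ cubeFace D b ∧ z i = !s₁ i} ∪ {s₂, t₂}, ?_, ?_, ?_, ?_, ?_, hA, ?_⟩
  · exact fun z hz => ((mem_cubeFace_erase hi).1 hz.1).1
  · rintro z (hz | rfl | rfl)
    exacts [hz.1, hs₂, ht₂]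
  · rw [Set.disjoint_left]
    rintro z ⟨hz, hzF⟩ (hz' | rfl | rfl)
    · have := ((mem_cubeFace_erase hi).1 hz).2
      rw [hz'.2] at this
      simp at this
    · simp at hzF
    · simp at hzF
  · simp
  · simp [hvi, hv₂, hv₂']
  · have hB' : WalkIn ({z | z ∈ cubeFace D b ∧ z i = !s₁ i} ∪ {s₂, t₂})
        (flipAt i s₂) (flipAt i t₂) :=
      hB.mono fun z hz => Or.inl ((mem_cubeFace_erase hi).1 hz.1)
    exact ((walkIn_flipAt i (by simp) hB'.left_mem).trans hB').trans
      (walkIn_flipAt i (by simp) hB'.right_mem).symm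

lemma mem_of_neighbors_subset_card_three {i : Fin n} (hD : #D = 4) (hi : i ∈ D)
    {F : Finset (Fin n → Bool)} (hF : #F ≤ 3) {x : Fin n → Bool}
    (h : ∀ j ∈ D.erase i, flipAt j x ∈ F) : ∀ z ∈ F, ∃ j, flipAt j x = z := by
  classical
  have hsub : (D.erase i).image (fun j => flipAt j x) ⊆ F := by
    intro z hz
    obtain ⟨j, hj, rfl⟩ := mem_image.1 hz
    exact h j hj
  have hcard : #F ≤ #((D.erase i).image fun j => flipAt j x) := by
    rw [card_image_of_injective _ (flipAt_left_injective x), card_erase_of_mem hi, hD]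
    exact hF
  intro z hz
  rw [← eq_of_subset_of_card_le hsub hcard] at hz
  obtain ⟨j, -, hj⟩ := mem_image.1 hz
  exact ⟨j, hj⟩

/-- Route the first pair mainly through one facet, and the second pair through the other. -/
lemma twoLinkableAvoiding_of_side {i : Fin n} (hD : #D = 4) (hi : i ∈ D) (a : Bool)
    {v s₁ t₁ s₂ t₂ : Fin n → Bool} (hs₁ : s₁ ∈ cubeFace D b) (ht₁ : t₁ ∈ cubeFace D b)
    (hs₂ : s₂ ∈ cubeFace D b) (ht₂ : t₂ ∈ cubeFace D b)
    (hss : s₁ ≠ s₂) (hst : s₁ ≠ t₂) (hts : t₁ ≠ s₂) (htt : t₁ ≠ t₂)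
    (hv₁ : v ≠ s₁) (hv₁' : v ≠ t₁) (hv₂ : v ≠ s₂) (hv₂' : v ≠ t₂)
    (c1 : s₁ i = a ∨ flipAt i s₁ ∉ ({s₁, t₁, s₂, t₂, v} : Finset _))
    (c2 : t₁ i = a ∨ flipAt i t₁ ∉ ({s₁, t₁, s₂, t₂, v} : Finset _))
    (c3 : s₂ i = !a ∨ flipAt i s₂ ∉ ({s₁, t₁, s₂, t₂, v} : Finset _))
    (c4 : t₂ i = !a ∨ flipAt i t₂ ∉ ({s₁, t₁, s₂, t₂, v} : Finset _))
    (c5 : s₂ i ≠ a ∨ t₂ i ≠ a ∨ v i ≠ a) (c6 : s₁ i ≠ !a ∨ t₁ i ≠ !a ∨ v i ≠ !a) :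
    TwoLinkableAvoiding D b v s₁ t₁ s₂ t₂ := by
  classical
  have hsub₁ : ({s₂, t₂, v} : Finset (Fin n → Bool)) ⊆ {s₁, t₁, s₂, t₂, v} := by
    simp [insert_subset_iff]
  have hsub₂ : ({s₁, t₁, v} : Finset (Fin n → Bool)) ⊆ {s₁, t₁, s₂, t₂, v} := by
    simp [insert_subset_iff]
  refine ⟨_, _, ?_, ?_, ?_, ?_, ?_,
    walkIn_half (F := {s₂, t₂, v}) hD hi a card_le_three hs₁ ht₁
      (by simp [hss, hst, hv₁.symm]) (by simp [hts, htt, hv₁'.symm])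
      (c1.imp_right fun h h' => h (hsub₁ h')) (c2.imp_right fun h h' => h (hsub₁ h'))
      (by simpa using c5),
    walkIn_half (F := {s₁, t₁, v}) hD hi (!a) card_le_three hs₂ ht₂
      (by simp [hss.symm, hts.symm, hv₂.symm]) (by simp [hst.symm, htt.symm, hv₂'.symm])
      (c3.imp_right fun h h' => h (hsub₂ h')) (c4.imp_right fun h h' => h (hsub₂ h'))
      (by simpa using c6)⟩
  · rintro z (hz | rfl | rfl)
    exacts [hz.1, hs₁, ht₁]
  · rintro z (hz | rfl | rfl)
    exacts [hz.1, hs₂, ht₂]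
  · clear * - hss hst hts htt
    simp only [mem_insert, mem_singleton, not_or]
    rw [Set.disjoint_left]
    rintro z (⟨-, hz, hzF⟩ | hz | hz) (⟨-, hz', hzF'⟩ | hz' | hz')
    · rw [hz] at hz'; simp at hz'
    · exact hzF.1 hz'
    · exact hzF.2.1 hz'
    · exact hzF'.1 hz
    · exact hss (hz.symm.trans hz')
    · exact hst (hz.symm.trans hz')
    · exact hzF'.2.1 hz
    · exact hts (hz.symm.trans hz')
    · exact htt (hz.symm.trans hz')
  · simp [hv₁, hv₁']
  · simp [hv₂, hv₂']

/-- A four-dimensional face is strongly 2-linked. -/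
lemma twoLinkableAvoiding_of_card_four (hD : #D = 4) {v s₁ t₁ s₂ t₂ : Fin n → Bool}
    (hs₁ : s₁ ∈ cubeFace D b) (ht₁ : t₁ ∈ cubeFace D b)
    (hs₂ : s₂ ∈ cubeFace D b) (ht₂ : t₂ ∈ cubeFace D b) (h₁ : s₁ ≠ t₁) (h₂ : s₂ ≠ t₂)
    (hss : s₁ ≠ s₂) (hst : s₁ ≠ t₂) (hts : t₁ ≠ s₂) (htt : t₁ ≠ t₂)
    (hv₁ : v ≠ s₁) (hv₁' : v ≠ t₁) (hv₂ : v ≠ s₂) (hv₂' : v ≠ t₂) :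
    TwoLinkableAvoiding D b v s₁ t₁ s₂ t₂ := by
  classical
  by_cases hadj₁ : ∃ i ∈ D, flipAt i s₁ = t₁
  · obtain ⟨i, hi, h⟩ := hadj₁
    exact twoLinkableAvoiding_of_adj hD hi hs₁ hs₂ ht₂ hss hst hts htt hv₁ hv₁' hv₂ hv₂' h
  by_cases hadj₂ : ∃ i ∈ D, flipAt i s₂ = t₂
  · obtain ⟨i, hi, h⟩ := hadj₂
    exact (twoLinkableAvoiding_of_adj hD hi hs₂ hs₁ ht₁ hss.symm hts.symm hst.symm htt.symm
      hv₂ hv₂' hv₁ hv₁' h).symm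
  push Not at hadj₁ hadj₂
  obtain ⟨i, hi, hX⟩ := exists_direction (D := D) (card_pos.1 (by omega))
    (X := {s₁, t₁, s₂, t₂, v}) (by rw [hD]; exact card_le_five)
  by_cases hside : t₁ i = s₁ i ∧ s₂ i = s₁ i ∧ t₂ i = s₁ i ∧ v i = s₁ i
  · obtain ⟨ht₁i, hs₂i, ht₂i, hvi⟩ := hside
    by_cases hn : (∃ j ∈ D.erase i, flipAt j s₁ ∉ ({s₂, t₂, v} : Finset _)) ∧
        ∃ j ∈ D.erase i, flipAt j t₁ ∉ ({s₂, t₂, v} : Finset _)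
    · exact twoLinkableAvoiding_of_facet hD hi hs₁ ht₁ hs₂ ht₂ hss hst hts htt hv₁ hv₁' hv₂ hv₂'
        ht₁i hs₂i ht₂i hvi hn.1 hn.2
    by_cases hn' : (∃ j ∈ D.erase i, flipAt j s₂ ∉ ({s₁, t₁, v} : Finset _)) ∧
        ∃ j ∈ D.erase i, flipAt j t₂ ∉ ({s₁, t₁, v} : Finset _)
    · exact (twoLinkableAvoiding_of_facet hD hi hs₂ ht₂ hs₁ ht₁ hss.symm hts.symm hst.symm
        htt.symm hv₂ hv₂' hv₁ hv₁' (by rw [ht₂i, hs₂i]) hs₂i.symm (by rw [ht₁i, hs₂i])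
        (by rw [hvi, hs₂i]) hn'.1 hn'.2).symm
    -- a terminal of each pair is adjacent to everything else: this yields a triangle
    exfalso
    have hx : ∃ x, (x = s₁ ∨ x = t₁) ∧ ∀ z ∈ ({s₂, t₂, v} : Finset _), ∃ j, flipAt j x = z := by
      by_contra! hcon
      refine hn ⟨?_, ?_⟩ <;> by_contra! h
      · obtain ⟨z, hz, hz'⟩ := hcon s₁ (Or.inl rfl)
        obtain ⟨j, hj⟩ := mem_of_neighbors_subset_card_three hD hi card_le_three h z hz
        exact hz' j hj
      · obtain ⟨z, hz, hz'⟩ := hcon t₁ (Or.inr rfl)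
        obtain ⟨j, hj⟩ := mem_of_neighbors_subset_card_three hD hi card_le_three h z hz
        exact hz' j hj
    have hy : ∃ y, (y = s₂ ∨ y = t₂) ∧ ∃ j, flipAt j y = v := by
      by_contra! hcon
      refine hn' ⟨?_, ?_⟩ <;> by_contra! h
      · obtain ⟨j, hj⟩ := mem_of_neighbors_subset_card_three hD hi card_le_three h v (by simp)
        exact hcon s₂ (Or.inl rfl) j hj
      · obtain ⟨j, hj⟩ := mem_of_neighbors_subset_card_three hD hi card_le_three h v (by simp)
        exact hcon t₂ (Or.inr rfl) j hj
    obtain ⟨x, -, hx⟩ := hx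
    obtain ⟨y, hy, j, hj⟩ := hy
    obtain ⟨k, hk⟩ := hx y (by rcases hy with rfl | rfl <;> simp)
    obtain ⟨l, hl⟩ := hx v (by simp)
    exact flipAt_flipAt_ne_flipAt j k l x (by rw [hk, hj, hl])
  · have hbits : ∀ x ∈ ({s₁, t₁, s₂, t₂, v} : Finset _), ∀ y ∈ ({s₁, t₁, s₂, t₂, v} : Finset _),
        x ≠ y → flipAt i x ∈ ({s₁, t₁, s₂, t₂, v} : Finset _) ∧
          flipAt i y ∈ ({s₁, t₁, s₂, t₂, v} : Finset _) → x i ≠ y i ∧ y = flipAt i x := by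
      rintro x hx y hy hxy ⟨hx', hy'⟩
      rcases hX x hx y hy hx' hy' with h | h
      · exact absurd h.symm hxy
      · exact ⟨by rw [h]; simp, h⟩
    have hflip : ∀ x, flipAt i x ≠ x := fun x h => by simpa using congrFun h i
    have h1 := hadj₁ i hi
    have h2 := hadj₂ i hi
    have h1' : flipAt i t₁ ≠ s₁ := fun h => h1 (flipAt_eq_comm.1 h)
    have h2' : flipAt i t₂ ≠ s₂ := fun h => h2 (flipAt_eq_comm.1 h)
    obtain ⟨a, c1, c2, c3, c4, c5, c6⟩ := exists_side_of_bits (s₁ i) (t₁ i) (s₂ i) (t₂ i) (v i)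
      (flipAt i s₁ ∈ ({s₁, t₁, s₂, t₂, v} : Finset _))
      (flipAt i t₁ ∈ ({s₁, t₁, s₂, t₂, v} : Finset _))
      (flipAt i s₂ ∈ ({s₁, t₁, s₂, t₂, v} : Finset _))
      (flipAt i t₂ ∈ ({s₁, t₁, s₂, t₂, v} : Finset _))
      (flipAt i v ∈ ({s₁, t₁, s₂, t₂, v} : Finset _))
      (fun h => h1 (hbits _ (by simp) _ (by simp) h₁ h).2.symm)
      (fun h => h2 (hbits _ (by simp) _ (by simp) h₂ h).2.symm)
      (fun h => (hbits _ (by simp) _ (by simp) hss h).1)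
      (fun h => (hbits _ (by simp) _ (by simp) hst h).1)
      (fun h => (hbits _ (by simp) _ (by simp) hv₁.symm h).1)
      (fun h => (hbits _ (by simp) _ (by simp) hts h).1)
      (fun h => (hbits _ (by simp) _ (by simp) htt h).1)
      (fun h => (hbits _ (by simp) _ (by simp) hv₁'.symm h).1)
      (fun h => (hbits _ (by simp) _ (by simp) hv₂.symm h).1)
      (fun h => (hbits _ (by simp) _ (by simp) hv₂'.symm h).1)
      (by
        intro h
        simp only [mem_insert, mem_singleton, hflip, h1, false_or] at h
        rcases h with h | h | h
        · exact Or.inl (by rw [← h]; simp)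
        · exact Or.inr (Or.inl (by rw [← h]; simp))
        · exact Or.inr (Or.inr (by rw [← h]; simp)))
      (by
        intro h
        simp only [mem_insert, mem_singleton, hflip, h1', false_or] at h
        rcases h with h | h | h
        · exact Or.inl (by rw [← h]; simp)
        · exact Or.inr (Or.inl (by rw [← h]; simp))
        · exact Or.inr (Or.inr (by rw [← h]; simp)))
      (by
        intro h
        simp only [mem_insert, mem_singleton, hflip, h2, false_or] at h
        rcases h with h | h | h
        · exact Or.inl (by rw [← h]; simp)
        · exact Or.inr (Or.inl (by rw [← h]; simp))
        · exact Or.inr (Or.inr (by rw [← h]; simp)))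
      (by
        intro h
        simp only [mem_insert, mem_singleton, hflip, h2', false_or] at h
        rcases h with h | h | h
        · exact Or.inl (by rw [← h]; simp)
        · exact Or.inr (Or.inl (by rw [← h]; simp))
        · exact Or.inr (Or.inr (by rw [← h]; simp)))
      hside
    exact twoLinkableAvoiding_of_side hD hi a hs₁ ht₁ hs₂ ht₂ hss hst hts htt hv₁ hv₁' hv₂ hv₂'
      c1 c2 c3 c4 c5 c6

end FourDim

section Linking

variable {n : ℕ} {ι : Type*} {D : Finset (Fin n)} {b : Fin n → Bool} {J : Finset ι}
  {s t : ι → Fin n → Bool}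

lemma SeparatedPairs.mono {J' : Finset ι} (h : SeparatedPairs D b J s t) (hJ : J' ⊆ J) :
    SeparatedPairs D b J' s t :=
  ⟨fun j hj => h.left_mem j (hJ hj), fun j hj => h.right_mem j (hJ hj),
    fun j hj k hk => h.left_ne_left j (hJ hj) k (hJ hk),
    fun j hj k hk => h.left_ne_right j (hJ hj) k (hJ hk),
    fun j hj k hk => h.right_ne_right j (hJ hj) k (hJ hk)⟩

lemma SeparatedPairs.linkableIn_of_forall_eq (h : SeparatedPairs D b J s t)
    (hst : ∀ j ∈ J, s j = t j) : LinkableIn D b J s t := by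
  refine ⟨fun j => {s j}, fun j hj => ⟨?_, ?_⟩, fun j hj k hk hjk => ?_⟩
  · simpa using h.left_mem j hj
  · rw [← hst j hj]
    exact WalkIn.refl rfl
  · simpa using h.left_ne_left j hj k hk hjk

lemma SeparatedPairs.linkableIn_of_unique (h : SeparatedPairs D b J s t)
    [DecidableEq ι] (hcard : #(J.image s ∪ J.image t) ≤ #D + 1)
    (hst : ∀ j ∈ J, ∀ k ∈ J, s j ≠ t j → s k ≠ t k → j = k) : LinkableIn D b J s t := by
  by_cases hall : ∀ j ∈ J, s j = t j
  · exact h.linkableIn_of_forall_eq hall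
  push Not at hall
  obtain ⟨i, hi, hne⟩ := hall
  have heq : ∀ j ∈ J, j ≠ i → s j = t j := by
    intro j hj hji
    by_contra hj'
    exact hji (hst j hj i hi hj' hne)
  set F := ((J.image s ∪ J.image t).erase (s i)).erase (t i) with hF
  have hsi : s i ∈ J.image s ∪ J.image t := mem_union_left _ (mem_image_of_mem s hi)
  have hti : t i ∈ J.image s ∪ J.image t := mem_union_right _ (mem_image_of_mem t hi)
  have hFc : #F ≤ #D - 1 := by
    rw [hF, card_erase_of_mem (mem_erase.2 ⟨hne.symm, hti⟩), card_erase_of_mem hsi]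
    omega
  have hdisj : ∀ j ∈ J, j ≠ i → s j ∈ F := by
    intro j hj hji
    simp only [hF, mem_erase, mem_union]
    exact ⟨h.left_ne_right j hj i hi hji, h.left_ne_left j hj i hi hji,
      Or.inl (mem_image_of_mem s hj)⟩
  refine ⟨fun j => if j = i then {z | z ∈ cubeFace D b ∧ z ∉ F} else {s j},
    fun j hj => ?_, fun j hj k hk hjk => ?_⟩
  · by_cases hji : j = i
    · subst hji
      simp only [if_true]
      exact ⟨fun z hz => hz.1, walkIn_cubeFace_sdiff D b F hFc _ (h.left_mem j hj) _
        (h.right_mem j hj) (by simp [hF]) (by simp [hF])⟩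
    · simp only [hji, if_false]
      refine ⟨by simpa using h.left_mem j hj, ?_⟩
      rw [← heq j hj hji]
      exact WalkIn.refl rfl
  · by_cases hji : j = i
    · have hki : k ≠ i := fun h => hjk (hji.trans h.symm)
      simp only [hji, hki, if_true, if_false]
      rw [Set.disjoint_singleton_right]
      exact fun hz => hz.2 (hdisj k hk hki)
    · by_cases hki : k = i
      · simp only [hji, hki, if_true, if_false]
        rw [Set.disjoint_singleton_left]
        exact fun hz => hz.2 (hdisj j hj hji)
      · simp only [hji, hki, if_false]
        simpa using h.left_ne_left j hj k hk hjk

lemma SeparatedPairs.linkableIn_of_card_four (h : SeparatedPairs D b J s t)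
    [DecidableEq ι] (hD : #D = 4) (hcard : #(J.image s ∪ J.image t) ≤ 5) :
    LinkableIn D b J s t := by
  by_cases hst : ∀ j ∈ J, ∀ k ∈ J, s j ≠ t j → s k ≠ t k → j = k
  · exact h.linkableIn_of_unique (by omega) hst
  push Not at hst
  obtain ⟨i, hi, j, hj, hi', hj', hij⟩ := hst
  have h1 := h.left_ne_left i hi j hj hij
  have h2 := h.left_ne_right i hi j hj hij
  have h3 := (h.left_ne_right j hj i hi hij.symm).symm
  have h4 := h.right_ne_right i hi j hj hij
  have hfour : #({s i, t i, s j, t j} : Finset (Fin n → Bool)) = 4 := by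
    rw [card_insert_of_notMem (by simp [hi', h1, h2]), card_insert_of_notMem (by simp [h3, h4]),
      card_pair hj']
  have hmem : ∀ k ∈ J, s k ∈ J.image s ∪ J.image t ∧ t k ∈ J.image s ∪ J.image t := by
    intro k hk
    simp [mem_image_of_mem _ hk]
  have hrest : #((J.image s ∪ J.image t) \ {s i, t i, s j, t j}) ≤ 1 := by
    rw [card_sdiff_of_subset, hfour]
    · omega
    · simp [insert_subset_iff, -mem_union, hmem i hi, hmem j hj]
  have hother : ∀ k ∈ J, k ≠ i → k ≠ j → s k ∈ (J.image s ∪ J.image t) \ {s i, t i, s j, t j} ∧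
      t k ∈ (J.image s ∪ J.image t) \ {s i, t i, s j, t j} := by
    intro k hk hki hkj
    simp only [mem_sdiff, hmem k hk, mem_insert, mem_singleton, not_or, true_and]
    exact ⟨⟨h.left_ne_left k hk i hi hki, h.left_ne_right k hk i hi hki,
      h.left_ne_left k hk j hj hkj, h.left_ne_right k hk j hj hkj⟩,
      (h.left_ne_right i hi k hk hki.symm).symm, h.right_ne_right k hk i hi hki,
      (h.left_ne_right j hj k hk hkj.symm).symm, h.right_ne_right k hk j hj hkj⟩
  obtain ⟨v, hv, hvF, hvk⟩ : ∃ v ∈ cubeFace D b, v ∉ ({s i, t i, s j, t j} : Finset _) ∧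
      ∀ k ∈ J, k ≠ i → k ≠ j → s k = v ∧ t k = v := by
    by_cases hk : ∃ k ∈ J, k ≠ i ∧ k ≠ j
    · obtain ⟨k, hk, hki, hkj⟩ := hk
      have hk' := (hother k hk hki hkj).1
      refine ⟨s k, h.left_mem k hk, (mem_sdiff.1 hk').2, fun l hl hli hlj => ?_⟩
      exact ⟨card_le_one.1 hrest _ (hother l hl hli hlj).1 _ hk',
        card_le_one.1 hrest _ (hother l hl hli hlj).2 _ hk'⟩
    · obtain ⟨v, hv, hv'⟩ := exists_mem_notMem_of_card_lt_card
        (s := {s i, t i, s j, t j}) (t := cubeFace D b) (by rw [hfour, card_cubeFace, hD]; norm_num)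
      exact ⟨v, hv, hv', fun k hkJ hki hkj => absurd ⟨k, hkJ, hki, hkj⟩ hk⟩
  simp only [mem_insert, mem_singleton, not_or] at hvF
  obtain ⟨C₁, C₂, hC₁, hC₂, hC, hv₁, hv₂, hw₁, hw₂⟩ := twoLinkableAvoiding_of_card_four hD
    (h.left_mem i hi) (h.right_mem i hi) (h.left_mem j hj) (h.right_mem j hj) hi' hj' h1 h2 h3 h4
    hvF.1 hvF.2.1 hvF.2.2.1 hvF.2.2.2
  have hothers : ∀ k ∈ J, ∀ l ∈ J, k ≠ i → k ≠ j → l ≠ i → l ≠ j → k = l := by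
    intro k hk l hl hki hkj hli hlj
    by_contra hkl
    exact h.left_ne_left k hk l hl hkl ((hvk k hk hki hkj).1.trans (hvk l hl hli hlj).1.symm)
  refine ⟨fun k => if k = i then C₁ else if k = j then C₂ else {v}, fun k hk => ?_,
    fun k hk l hl hkl => ?_⟩
  · by_cases hki : k = i
    · subst hki
      simpa using ⟨hC₁, hw₁⟩
    by_cases hkj : k = j
    · subst hkj
      simpa [hki] using ⟨hC₂, hw₂⟩
    · obtain ⟨e1, e2⟩ := hvk k hk hki hkj
      simp only [hki, hkj, if_false, e1, e2]
      exact ⟨by simpa using hv, WalkIn.refl rfl⟩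
  · have := hothers k hk l hl
    have hC' := hC.symm
    clear * - this hkl hC hC' hv₁ hv₂
    by_cases hki : k = i <;> by_cases hkj : k = j <;> by_cases hli : l = i <;>
      by_cases hlj : l = j <;> simp_all [Set.disjoint_singleton_left, Set.disjoint_singleton_right]

/-- All terminals in one facet: free one terminal, and detour through the opposite facet. -/
lemma SeparatedPairs.linkableIn_of_facet [DecidableEq ι] {i : Fin n} (hi : i ∈ D) (hD : 4 ≤ #D)
    (a : Bool) (h : SeparatedPairs D b J s t) (hside : ∀ j ∈ J, s j i = a ∧ t j i = a)
    (hcard : #(J.image s ∪ J.image t) ≤ #D + 1)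
    (ih : ∀ (b' : Fin n → Bool) (J' : Finset ι) (s' t' : ι → Fin n → Bool),
      SeparatedPairs (D.erase i) b' J' s' t' → #(J'.image s' ∪ J'.image t') ≤ #D →
        LinkableIn (D.erase i) b' J' s' t') :
    LinkableIn D b J s t := by
  classical
  by_cases hall : ∀ j ∈ J, s j = t j
  · exact h.linkableIn_of_forall_eq hall
  push Not at hall
  obtain ⟨p, hp, hne⟩ := hall
  have htp : t p ∈ J.image s ∪ J.image t := mem_union_right _ (mem_image_of_mem t hp)
  have hA : SeparatedPairs (D.erase i) (Function.update b i a) J s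
      (Function.update t p (s p)) := by
    refine ⟨fun j hj => (mem_cubeFace_erase hi).2 ⟨h.left_mem j hj, (hside j hj).1⟩,
      fun j hj => ?_, h.left_ne_left, fun j hj k hk hjk => ?_, fun j hj k hk hjk => ?_⟩
    · by_cases hjp : j = p
      · subst hjp
        simpa using (mem_cubeFace_erase hi).2 ⟨h.left_mem j hj, (hside j hj).1⟩
      · simpa [hjp] using (mem_cubeFace_erase hi).2 ⟨h.right_mem j hj, (hside j hj).2⟩
    · by_cases hkp : k = p
      · subst hkp
        simpa using h.left_ne_left j hj k hk hjk
      · simpa [hkp] using h.left_ne_right j hj k hk hjk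
    · by_cases hjp : j = p
      · subst hjp
        simpa [Ne.symm hjk] using h.left_ne_right j hj k hk hjk
      · by_cases hkp : k = p
        · subst hkp
          simpa [hjp] using (h.left_ne_right k hk j hj hjk.symm).symm
        · simpa [hjp, hkp] using h.right_ne_right j hj k hk hjk
  obtain ⟨CA, hCA, hCAd⟩ := ih _ J s _ hA (by
    have hsub : J.image s ∪ J.image (Function.update t p (s p)) ⊆
        (J.image s ∪ J.image t).erase (t p) := by
      refine union_subset (fun z hz => ?_) fun z hz => ?_
      · obtain ⟨j, hj, rfl⟩ := mem_image.1 hz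
        refine mem_erase.2 ⟨?_, mem_union_left _ hz⟩
        by_cases hjp : j = p
        · exact hjp ▸ hne
        · exact h.left_ne_right j hj p hp hjp
      · obtain ⟨j, hj, rfl⟩ := mem_image.1 hz
        by_cases hjp : j = p
        · subst hjp
          simpa only [Function.update_self] using
            mem_erase.2 ⟨hne, mem_union_left _ (mem_image_of_mem s hj)⟩
        · simpa only [Function.update_of_ne hjp] using
            mem_erase.2 ⟨h.right_ne_right j hj p hp hjp, mem_union_right _ (mem_image_of_mem t hj)⟩
    have := card_le_card hsub
    rw [card_erase_of_mem htp] at this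
    omega)
  set J' := {j ∈ J | j = p ∨ t p ∈ CA j} with hJ'
  have hJ'J : J' ⊆ J := filter_subset _ _
  have hJ'card : #J' ≤ 2 := by
    have h1 : #{j ∈ J | t p ∈ CA j} ≤ 1 := by
      refine card_le_one.2 fun j hj k hk => ?_
      rw [mem_filter] at hj hk
      by_contra hjk
      exact Set.disjoint_left.1 (hCAd j hj.1 k hk.1 hjk) hj.2 hk.2
    have h2 : J' ⊆ insert p {j ∈ J | t p ∈ CA j} := by
      intro j hj
      simp only [hJ', mem_filter] at hj
      simp only [mem_insert, mem_filter]
      tauto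
    have := (card_le_card h2).trans (card_insert_le _ _)
    omega
  have hB : SeparatedPairs (D.erase i) (Function.update b i (!a)) J'
      (fun j => flipAt i (s j)) (fun j => flipAt i (t j)) := by
    have h' := h.mono hJ'J
    refine ⟨fun j hj => (mem_cubeFace_erase hi).2 ⟨flipAt_mem_cubeFace hi (h'.left_mem j hj), ?_⟩,
      fun j hj => (mem_cubeFace_erase hi).2 ⟨flipAt_mem_cubeFace hi (h'.right_mem j hj), ?_⟩,
      fun j hj k hk hjk => (flipAt_injective i).ne (h'.left_ne_left j hj k hk hjk),
      fun j hj k hk hjk => (flipAt_injective i).ne (h'.left_ne_right j hj k hk hjk),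
      fun j hj k hk hjk => (flipAt_injective i).ne (h'.right_ne_right j hj k hk hjk)⟩
    · simp [(hside j (hJ'J hj)).1]
    · simp [(hside j (hJ'J hj)).2]
  obtain ⟨CB, hCB, hCBd⟩ := ih _ J' _ _ hB (by
    have := card_union_le (J'.image fun j => flipAt i (s j)) (J'.image fun j => flipAt i (t j))
    have h1 := card_image_le (s := J') (f := fun j => flipAt i (s j))
    have h2 := card_image_le (s := J') (f := fun j => flipAt i (t j))
    omega)
  have hCAi : ∀ j ∈ J, ∀ z ∈ CA j, z ∈ cubeFace D b ∧ z i = a := fun j hj z hz =>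
    (mem_cubeFace_erase hi).1 ((hCA j hj).1 hz)
  have hCBi : ∀ j ∈ J', ∀ z ∈ CB j, z ∈ cubeFace D b ∧ z i = !a := fun j hj z hz =>
    (mem_cubeFace_erase hi).1 ((hCB j hj).1 hz)
  have hmixed : ∀ k ∈ J', ∀ l ∈ J, l ∉ J' → Disjoint ({s k, t k} ∪ CB k) (CA l) := by
    intro k hk l hl hl'
    have hkl : k ≠ l := fun h => hl' (h ▸ hk)
    rw [Set.disjoint_left]
    rintro z ((rfl | rfl) | hz) hzl
    · exact Set.disjoint_left.1 (hCAd k (hJ'J hk) l hl hkl) (hCA k (hJ'J hk)).2.left_mem hzl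
    · by_cases hkp : k = p
      · subst hkp
        exact hl' (mem_filter.2 ⟨hl, Or.inr hzl⟩)
      · have := (hCA k (hJ'J hk)).2.right_mem
        rw [Function.update_of_ne hkp] at this
        exact Set.disjoint_left.1 (hCAd k (hJ'J hk) l hl hkl) this hzl
    · have h1 := (hCBi k hk z hz).2
      rw [(hCAi l hl z hzl).2] at h1
      simp at h1
  refine ⟨fun k => if k ∈ J' then {s k, t k} ∪ CB k else CA k, fun k hk => ?_,
    fun k hk l hl hkl => ?_⟩
  · by_cases hk' : k ∈ J'
    · simp only [hk', if_true]
      refine ⟨?_, ?_⟩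
      · rintro z ((rfl | rfl) | hz)
        exacts [h.left_mem k hk, h.right_mem k hk, (hCBi k hk' z hz).1]
      · have hw := (hCB k hk').2.mono (Set.subset_union_right (s := {s k, t k}))
        exact ((walkIn_flipAt i (by simp) hw.left_mem).trans hw).trans
          (walkIn_flipAt i (by simp) hw.right_mem).symm
    · simp only [hk', if_false]
      refine ⟨fun z hz => (hCAi k hk z hz).1, ?_⟩
      have hkp : k ≠ p := fun h => hk' (mem_filter.2 ⟨hk, Or.inl h⟩)
      simpa [hkp] using (hCA k hk).2
  · by_cases hk' : k ∈ J' <;> by_cases hl' : l ∈ J' <;> simp only [hk', hl', if_true, if_false]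
    · have hbit : ∀ j ∈ J', ∀ k ∈ J', ∀ z ∈ ({s j, t j} : Set _), z ∉ CB k := by
        rintro j hj k hk z hz hzk
        have h1 := (hCBi k hk z hzk).2
        rcases hz with rfl | rfl
        · simp [(hside j (hJ'J hj)).1] at h1
        · simp [(hside j (hJ'J hj)).2] at h1
      rw [Set.disjoint_left]
      rintro z (hz | hz) (hz' | hz')
      · rcases hz with rfl | rfl <;> rcases hz' with hz' | hz'
        · exact h.left_ne_left k hk l hl hkl hz'
        · exact h.left_ne_right k hk l hl hkl hz'
        · exact h.left_ne_right l hl k hk hkl.symm hz'.symm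
        · exact h.right_ne_right k hk l hl hkl hz'
      · exact hbit k hk' l hl' z hz hz'
      · exact hbit l hl' k hk' z hz' hz
      · exact Set.disjoint_left.1 (hCBd k hk' l hl' hkl) hz hz'
    · exact hmixed k hk' l hl hl'
    · exact (hmixed l hl' k hk hk').symm
    · exact hCAd k hk l hl hkl

/-- The part of a linkage that lies in the facet `x i = a`, the pairs that leave the facet
being rerouted to the crossing points `c j`. -/
lemma SeparatedPairs.linkableIn_half [DecidableEq ι] {i : Fin n} (hi : i ∈ D)
    (a : Bool) (h : SeparatedPairs D b J s t) {c : ι → Fin n → Bool}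
    (hc : ∀ j ∈ J, s j i = a → t j i ≠ a → c j ∈ cubeFace D b ∧ c j i = a ∧
      (c j ∈ J.image s ∪ J.image t → c j = s j))
    (hinj : ∀ j ∈ J, ∀ k ∈ J, s j i = a → t j i ≠ a → s k i = a → t k i ≠ a →
      c j = c k → j = k)
    (hcard : #{x ∈ J.image s ∪ J.image t | x i = a} + #{j ∈ J | s j i = a ∧ t j i ≠ a} ≤ #D + 1)
    (hmark : #{x ∈ J.image s ∪ J.image t | x i = a} + #{j ∈ J | s j i = a ∧ t j i ≠ a} ≤ #D ∨
      ∃ j ∈ J, s j i = a ∧ t j i ≠ a ∧ c j = s j)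
    (ih : ∀ (b' : Fin n → Bool) (J' : Finset ι) (s' t' : ι → Fin n → Bool),
      SeparatedPairs (D.erase i) b' J' s' t' → #(J'.image s' ∪ J'.image t') ≤ #D →
        LinkableIn (D.erase i) b' J' s' t') :
    LinkableIn (D.erase i) (Function.update b i a) {j ∈ J | s j i = a} s
      (fun j => if t j i = a then t j else c j) := by
  have hl : ∀ j ∈ J, s j ∈ J.image s ∪ J.image t := fun j hj =>
    mem_union_left _ (mem_image_of_mem s hj)
  have hr : ∀ j ∈ J, t j ∈ J.image s ∪ J.image t := fun j hj =>
    mem_union_right _ (mem_image_of_mem t hj)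
  refine ih _ _ _ _ ⟨fun j hj => ?_, fun j hj => ?_, fun j hj k hk => ?_, fun j hj k hk hjk => ?_,
    fun j hj k hk hjk => ?_⟩ ?_
  · rw [mem_filter] at hj
    exact (mem_cubeFace_erase hi).2 ⟨h.left_mem j hj.1, hj.2⟩
  · rw [mem_filter] at hj
    by_cases htj : t j i = a
    · simpa only [htj, if_true] using (mem_cubeFace_erase hi).2 ⟨h.right_mem j hj.1, htj⟩
    · have := hc j hj.1 hj.2 htj
      simpa only [htj, if_false] using (mem_cubeFace_erase hi).2 ⟨this.1, this.2.1⟩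
  · rw [mem_filter] at hj hk
    exact h.left_ne_left j hj.1 k hk.1
  · rw [mem_filter] at hj hk
    by_cases htk : t k i = a
    · simpa only [htk, if_true] using h.left_ne_right j hj.1 k hk.1 hjk
    · simp only [htk, if_false]
      intro heq
      refine h.left_ne_left j hj.1 k hk.1 hjk (heq.trans ((hc k hk.1 hk.2 htk).2.2 ?_))
      exact heq ▸ hl j hj.1
  · rw [mem_filter] at hj hk
    have key : ∀ j ∈ J, ∀ k ∈ J, j ≠ k → s k i = a → t k i ≠ a → t j ≠ c k := by
      intro j hj k hk hjk hsk htk heq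
      refine h.left_ne_right k hk j hj hjk.symm
        ((heq.trans ((hc k hk hsk htk).2.2 (heq ▸ hr j hj))).symm)
    by_cases htj : t j i = a <;> by_cases htk : t k i = a <;> simp only [htj, htk, if_true, if_false]
    · exact h.right_ne_right j hj.1 k hk.1 hjk
    · exact key j hj.1 k hk.1 hjk hk.2 htk
    · exact (key k hk.1 j hj.1 hjk.symm hj.2 htj).symm
    · exact fun heq => hjk (hinj j hj.1 k hk.1 hj.2 htj hk.2 htk heq)
  · set Sp := {j ∈ J | s j i = a ∧ t j i ≠ a} with hSp
    have key : ∀ S : Finset ι, (∀ j ∈ Sp, j ∉ S → c j = s j) →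
        #({j ∈ J | s j i = a}.image s ∪ {j ∈ J | s j i = a}.image
          fun j => if t j i = a then t j else c j) ≤
            #{x ∈ J.image s ∪ J.image t | x i = a} + #S := by
      intro S hS
      refine (card_le_card (t := {x ∈ J.image s ∪ J.image t | x i = a} ∪ S.image c)
        (union_subset (fun z hz => ?_) fun z hz => ?_)).trans
          ((card_union_le _ _).trans (by gcongr; exact card_image_le))
      · obtain ⟨j, hj, rfl⟩ := mem_image.1 hz
        rw [mem_filter] at hj
        exact mem_union_left _ (mem_filter.2 ⟨hl j hj.1, hj.2⟩)
      · obtain ⟨j, hj, rfl⟩ := mem_image.1 hz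
        rw [mem_filter] at hj
        by_cases htj : t j i = a
        · simp only [htj, if_true]
          exact mem_union_left _ (mem_filter.2 ⟨hr j hj.1, htj⟩)
        · simp only [htj, if_false]
          by_cases hjS : j ∈ S
          · exact mem_union_right _ (mem_image_of_mem c hjS)
          · rw [hS j (mem_filter.2 ⟨hj.1, hj.2, htj⟩) hjS]
            exact mem_union_left _ (mem_filter.2 ⟨hl j hj.1, hj.2⟩)
    rcases hmark with hmark | ⟨j, hj, hsj, htj, hcj⟩
    · exact (key Sp fun j hj hj' => absurd hj hj').trans hmark
    · have hjSp : j ∈ Sp := mem_filter.2 ⟨hj, hsj, htj⟩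
      have h1 := key (Sp.erase j) fun k hk hk' => by
        have : k = j := by
          by_contra hkj
          exact hk' (mem_erase.2 ⟨hkj, hk⟩)
        rw [this, hcj]
      have h2 := card_pos.2 ⟨j, hjSp⟩
      rw [card_erase_of_mem hjSp] at h1
      omega

lemma exists_marks [DecidableEq ι] (S : Finset ι) (g₁ g₂ w : ι → Prop) {α β d : ℕ} (hd : 5 ≤ d)
    (hsum : α + β ≤ d + 1) (hSα : #S ≤ α) (hSβ : #S ≤ β) (hα : 0 < α) (hβ : 0 < β)
    (h₁ : ∀ j ∈ S, ∀ k ∈ S, g₁ j → g₁ k → j = k) (h₂ : ∀ j ∈ S, ∀ k ∈ S, g₂ j → g₂ k → j = k)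
    (hβ₁ : β ≤ 1 → ∀ j ∈ S, g₁ j → w j) (hα₁ : α ≤ 1 → ∀ j ∈ S, g₂ j → w j) :
    ∃ M₁ M₂ : ι → Prop, (∀ j ∈ S, M₁ j → g₁ j → w j) ∧ (∀ j ∈ S, M₂ j → g₂ j → w j) ∧
      (∀ j ∈ S, M₁ j → M₂ j → w j) ∧ (α + #S ≤ d ∨ ∃ j ∈ S, M₁ j) ∧
        (β + #S ≤ d ∨ ∃ j ∈ S, M₂ j) := by
  have hgood : ∀ (g : ι → Prop) (T : Finset ι), (∀ j ∈ T, ∀ k ∈ T, g j → g k → j = k) →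
      2 ≤ #T → ∃ j ∈ T, ¬g j := by
    intro g T hg hT
    by_contra! hcon
    have : #T ≤ 1 := card_le_one.2 fun j hj k hk => hg j hj k hk (hcon j hj) (hcon k hk)
    omega
  by_cases hw : ∃ j ∈ S, w j
  · obtain ⟨j, hj, hwj⟩ := hw
    exact ⟨(· = j), (· = j), by rintro k - rfl -; exact hwj, by rintro k - rfl -; exact hwj,
      by rintro k - rfl -; exact hwj, Or.inr ⟨j, hj, rfl⟩, Or.inr ⟨j, hj, rfl⟩⟩
  rcases Nat.lt_or_ge 1 #S with hS | hS
  · by_cases hα' : α + #S ≤ d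
    · obtain ⟨j, hj, hgj⟩ := hgood g₂ S h₂ hS
      exact ⟨fun _ => False, (· = j), by simp, by rintro k - rfl h; exact absurd h hgj, by simp,
        Or.inl hα', Or.inr ⟨j, hj, rfl⟩⟩
    by_cases hβ' : β + #S ≤ d
    · obtain ⟨j, hj, hgj⟩ := hgood g₁ S h₁ hS
      exact ⟨(· = j), fun _ => False, by rintro k - rfl h; exact absurd h hgj, by simp, by simp,
        Or.inr ⟨j, hj, rfl⟩, Or.inl hβ'⟩
    obtain ⟨j, hj, hgj⟩ := hgood g₁ S h₁ hS
    obtain ⟨k, hk, hgk⟩ := hgood g₂ (S.erase j)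
      (fun k hk l hl => h₂ k (mem_of_mem_erase hk) l (mem_of_mem_erase hl))
      (by rw [card_erase_of_mem hj]; omega)
    refine ⟨(· = j), (· = k), by rintro k - rfl h; exact absurd h hgj,
      by rintro k - rfl h; exact absurd h hgk, ?_, Or.inr ⟨j, hj, rfl⟩,
      Or.inr ⟨k, mem_of_mem_erase hk, rfl⟩⟩
    rintro l - rfl rfl
    exact absurd rfl (mem_erase.1 hk).1
  rcases Nat.eq_zero_or_pos #S with h0 | h0
  · exact ⟨fun _ => False, fun _ => False, by simp, by simp, by simp, Or.inl (by omega),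
      Or.inl (by omega)⟩
  obtain ⟨j, hj⟩ := card_pos.1 h0
  by_cases hα' : α + #S ≤ d
  · by_cases hβ' : β + #S ≤ d
    · exact ⟨fun _ => False, fun _ => False, by simp, by simp, by simp, Or.inl hα', Or.inl hβ'⟩
    · exact ⟨fun _ => False, (· = j), by simp, fun k hk _ => hα₁ (by omega) k hk, by simp,
        Or.inl hα', Or.inr ⟨j, hj, rfl⟩⟩
  · exact ⟨(· = j), fun _ => False, fun k hk _ => hβ₁ (by omega) k hk, by simp, by simp,
      Or.inr ⟨j, hj, rfl⟩, Or.inl (by omega)⟩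

lemma SeparatedPairs.exists_crossings [DecidableEq ι] {i : Fin n} (hi : i ∈ D) (hD : 5 ≤ #D)
    (h : SeparatedPairs D b J s t) (hcard : #(J.image s ∪ J.image t) ≤ #D + 1)
    (hX : ∀ x ∈ J.image s ∪ J.image t, ∀ y ∈ J.image s ∪ J.image t,
      flipAt i x ∈ J.image s ∪ J.image t → flipAt i y ∈ J.image s ∪ J.image t →
        y = x ∨ y = flipAt i x)
    (hfalse : ∃ x ∈ J.image s ∪ J.image t, x i = false)
    (htrue : ∃ x ∈ J.image s ∪ J.image t, x i = true) :
    ∃ c : ι → Fin n → Bool,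
      (∀ j ∈ J, s j i = false → t j i = true → c j ∈ cubeFace D b ∧ c j i = false ∧
        (c j ∈ J.image s ∪ J.image t → c j = s j) ∧
        (flipAt i (c j) ∈ J.image s ∪ J.image t → flipAt i (c j) = t j)) ∧
      (∀ j ∈ J, ∀ k ∈ J, s j i = false → t j i = true → s k i = false → t k i = true →
        c j = c k → j = k) ∧
      (#{x ∈ J.image s ∪ J.image t | x i = false} + #{j ∈ J | s j i = false ∧ t j i = true} ≤ #D ∨
        ∃ j ∈ J, s j i = false ∧ t j i = true ∧ c j = s j) ∧
      (#{x ∈ J.image s ∪ J.image t | x i = true} + #{j ∈ J | s j i = false ∧ t j i = true} ≤ #D ∨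
        ∃ j ∈ J, s j i = false ∧ t j i = true ∧ flipAt i (c j) = t j) ∧
      #{x ∈ J.image s ∪ J.image t | x i = false} + #{j ∈ J | s j i = false ∧ t j i = true} ≤
        #D + 1 ∧
      #{x ∈ J.image s ∪ J.image t | x i = true} + #{j ∈ J | s j i = false ∧ t j i = true} ≤
        #D + 1 := by
  classical
  have hl : ∀ j ∈ J, s j ∈ J.image s ∪ J.image t := fun j hj =>
    mem_union_left _ (mem_image_of_mem s hj)
  have hr : ∀ j ∈ J, t j ∈ J.image s ∪ J.image t := fun j hj =>
    mem_union_right _ (mem_image_of_mem t hj)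
  generalize J.image s ∪ J.image t = X at *
  set S := {j ∈ J | s j i = false ∧ t j i = true} with hS
  have hmemS : ∀ j, j ∈ S ↔ j ∈ J ∧ s j i = false ∧ t j i = true := fun j => by
    simp [hS]
  have hsum : #{x ∈ X | x i = false} + #{x ∈ X | x i = true} = #X := by
    rw [← card_filter_add_card_filter_not (s := X) (fun x => x i = false)]
    simp
  have hSα : #S ≤ #{x ∈ X | x i = false} := by
    refine card_le_card_of_injOn s (fun j hj => ?_) fun j hj k hk hjk => ?_
    · obtain ⟨hj, hj', -⟩ := (hmemS j).1 hj
      simp [hl j hj, hj']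
    · by_contra hne
      exact h.left_ne_left j ((hmemS j).1 hj).1 k ((hmemS k).1 hk).1 hne hjk
  have hSβ : #S ≤ #{x ∈ X | x i = true} := by
    refine card_le_card_of_injOn t (fun j hj => ?_) fun j hj k hk hjk => ?_
    · obtain ⟨hj, -, hj'⟩ := (hmemS j).1 hj
      simp [hr j hj, hj']
    · by_contra hne
      exact h.right_ne_right j ((hmemS j).1 hj).1 k ((hmemS k).1 hk).1 hne hjk
  have hpow : #X + #S ≤ 2 ^ (#D - 1) := by
    have h2 : ∀ m, 2 * (m + 6) ≤ 2 ^ (m + 4) := by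
      intro m
      induction m with
      | zero => norm_num
      | succ m ih => rw [show m + 1 + 4 = (m + 4) + 1 by ring, pow_succ]; omega
    have h3 := h2 (#D - 5)
    rw [show #D - 5 + 4 = #D - 1 by omega] at h3
    omega
  obtain ⟨Y, hY, hYc⟩ := exists_free_columns (b := b) hi false X hpow
  obtain ⟨f, hfY, hfinj⟩ : ∃ f : ι → Fin n → Bool, (∀ j ∈ S, f j ∈ Y) ∧ Set.InjOn f S := by
    let e := S.equivOfCardEq hY.symm
    refine ⟨fun j => if hj : j ∈ S then e ⟨j, hj⟩ else b, fun j hj => by simp [hj],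
      fun j hj k hk hjk => ?_⟩
    rw [mem_coe] at hj hk
    simpa [hj, hk] using hjk
  obtain ⟨M₁, M₂, hM₁, hM₂, hM, hα, hβ⟩ := exists_marks S (fun j => flipAt i (s j) ∈ X)
    (fun j => flipAt i (t j) ∈ X) (fun j => flipAt i (s j) = t j) hD (hsum.trans_le hcard) hSα hSβ
    (card_pos.2 (by simpa [Finset.Nonempty] using hfalse))
    (card_pos.2 (by simpa [Finset.Nonempty] using htrue))
    (fun j hj k hk hgj hgk => by
      obtain ⟨hj, hj', -⟩ := (hmemS j).1 hj
      obtain ⟨hk, hk', -⟩ := (hmemS k).1 hk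
      by_contra hne
      rcases hX _ (hl j hj) _ (hl k hk) hgj hgk with heq | heq
      · exact h.left_ne_left j hj k hk hne heq.symm
      · rw [heq, flipAt_same, hj'] at hk'
        simp at hk')
    (fun j hj k hk hgj hgk => by
      obtain ⟨hj, -, hj'⟩ := (hmemS j).1 hj
      obtain ⟨hk, -, hk'⟩ := (hmemS k).1 hk
      by_contra hne
      rcases hX _ (hr j hj) _ (hr k hk) hgj hgk with heq | heq
      · exact h.right_ne_right j hj k hk hne heq.symm
      · rw [heq, flipAt_same, hj'] at hk'
        simp at hk')
    (fun hle j hj hgj => by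
      obtain ⟨hj, hj', hj''⟩ := (hmemS j).1 hj
      exact card_le_one.1 hle _ (by simp [hgj, hj']) _ (by simp [hr j hj, hj'']))
    (fun hle j hj hgj => by
      obtain ⟨hj, hj', hj''⟩ := (hmemS j).1 hj
      exact flipAt_eq_comm.1 (card_le_one.1 hle _ (by simp [hgj, hj'']) _ (by simp [hl j hj, hj'])))
  let c : ι → Fin n → Bool := fun j => if M₁ j then s j else if M₂ j then flipAt i (t j) else f j
  have hc : ∀ j ∈ S, c j = s j ∧ M₁ j ∨ c j = flipAt i (t j) ∧ M₂ j ∨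
      c j = f j ∧ c j ∉ X ∧ flipAt i (c j) ∉ X := by
    intro j hj
    have hfj := hYc _ (hfY j hj)
    by_cases h1 : M₁ j
    · simp [c, h1]
    by_cases h2 : M₂ j
    · simp [c, h1, h2]
    · simp [c, h1, h2, hfj]
  have hc₁ : ∀ j ∈ S, c j ∈ X → c j = s j := by
    intro j hj hcj
    rcases hc j hj with h1 | ⟨h1, h2⟩ | ⟨-, h1, -⟩
    · exact h1.1
    · rw [h1] at hcj ⊢
      exact flipAt_eq_comm.1 (hM₂ j hj h2 hcj)
    · exact absurd hcj h1
  have hc₂ : ∀ j ∈ S, flipAt i (c j) ∈ X → flipAt i (c j) = t j := by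
    intro j hj hcj
    rcases hc j hj with ⟨h1, h2⟩ | ⟨h1, -⟩ | ⟨-, -, h1⟩
    · rw [h1] at hcj ⊢
      exact hM₁ j hj h2 hcj
    · rw [h1, flipAt_flipAt]
    · exact absurd hcj h1
  refine ⟨c, fun j hj hsj htj => ?_, fun j hj k hk hsj htj hsk htk hjk => ?_, ?_, ?_, by omega,
    by omega⟩
  · have hjS := (hmemS j).2 ⟨hj, hsj, htj⟩
    have hmem : c j ∈ cubeFace D b ∧ c j i = false := by
      rcases hc j hjS with ⟨h1, -⟩ | ⟨h1, -⟩ | ⟨h1, -⟩ <;> rw [h1]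
      · exact ⟨h.left_mem j hj, hsj⟩
      · exact ⟨flipAt_mem_cubeFace hi (h.right_mem j hj), by simp [htj]⟩
      · exact ⟨(hYc _ (hfY j hjS)).1, (hYc _ (hfY j hjS)).2.1⟩
    exact ⟨hmem.1, hmem.2, hc₁ j hjS, hc₂ j hjS⟩
  · have hjS := (hmemS j).2 ⟨hj, hsj, htj⟩
    have hkS := (hmemS k).2 ⟨hk, hsk, htk⟩
    by_contra hne
    by_cases h1 : c j ∈ X
    · exact h.left_ne_left j hj k hk hne
        ((hc₁ j hjS h1).symm.trans (hjk.trans (hc₁ k hkS (hjk ▸ h1))))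
    by_cases h2 : flipAt i (c j) ∈ X
    · refine h.right_ne_right j hj k hk hne ((hc₂ j hjS h2).symm.trans ?_)
      rw [hjk]
      exact hc₂ k hkS (hjk ▸ h2)
    have hfree : ∀ l ∈ S, c l ∉ X → flipAt i (c l) ∉ X → c l = f l := by
      intro l hlS hl1 hl2
      have hlJ := ((hmemS l).1 hlS).1
      rcases hc l hlS with ⟨h1, -⟩ | ⟨h1, -⟩ | ⟨h1, -⟩
      · exact absurd (h1 ▸ hl l hlJ) hl1
      · rw [h1, flipAt_flipAt] at hl2
        exact absurd (hr l hlJ) hl2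
      · exact h1
    exact hne (hfinj hjS hkS ((hfree j hjS h1 h2).symm.trans
      (hjk.trans (hfree k hkS (hjk ▸ h1) (hjk ▸ h2)))))
  · refine hα.imp_right fun ⟨j, hjS, hj⟩ => ?_
    obtain ⟨hjJ, hsj, htj⟩ := (hmemS j).1 hjS
    exact ⟨j, hjJ, hsj, htj, by simp [c, hj]⟩
  · refine hβ.imp_right fun ⟨j, hjS, hj⟩ => ?_
    obtain ⟨hjJ, hsj, htj⟩ := (hmemS j).1 hjS
    refine ⟨j, hjJ, hsj, htj, ?_⟩
    by_cases h1 : M₁ j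
    · simpa [c, h1] using hM j hjS h1 hj
    · simp [c, h1, hj]

/-- Terminals in both facets: pairs with terminals in different facets cross at `c j`. -/
lemma SeparatedPairs.linkableIn_of_split [DecidableEq ι] {i : Fin n} (hi : i ∈ D) (hD : 5 ≤ #D)
    (h : SeparatedPairs D b J s t) (hcard : #(J.image s ∪ J.image t) ≤ #D + 1)
    (hX : ∀ x ∈ J.image s ∪ J.image t, ∀ y ∈ J.image s ∪ J.image t,
      flipAt i x ∈ J.image s ∪ J.image t → flipAt i y ∈ J.image s ∪ J.image t →
        y = x ∨ y = flipAt i x)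
    (hfalse : ∃ x ∈ J.image s ∪ J.image t, x i = false)
    (htrue : ∃ x ∈ J.image s ∪ J.image t, x i = true)
    (horient : ∀ j ∈ J, s j i = true → t j i = true)
    (ih : ∀ (b' : Fin n → Bool) (J' : Finset ι) (s' t' : ι → Fin n → Bool),
      SeparatedPairs (D.erase i) b' J' s' t' → #(J'.image s' ∪ J'.image t') ≤ #D →
        LinkableIn (D.erase i) b' J' s' t') :
    LinkableIn D b J s t := by
  obtain ⟨c, hc, hinj, hα, hβ, hα', hβ'⟩ := h.exists_crossings hi hD hcard hX hfalse htrue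
  obtain ⟨CA, hCA, hCAd⟩ := h.linkableIn_half hi false (c := c)
    (fun j hj hsj htj => by
      have := hc j hj hsj (by simpa using htj)
      exact ⟨this.1, this.2.1, this.2.2.1⟩)
    (fun j hj k hk h1 h2 h3 h4 => hinj j hj k hk h1 (by simpa using h2) h3 (by simpa using h4))
    (by simpa using hα') (by simpa using hα) ih
  have h' : SeparatedPairs D b J t s := ⟨h.right_mem, h.left_mem, h.right_ne_right,
    fun j hj k hk hjk => (h.left_ne_right k hk j hj hjk.symm).symm, h.left_ne_left⟩
  obtain ⟨CB, hCB, hCBd⟩ := h'.linkableIn_half hi true (c := fun j => flipAt i (c j))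
    (fun j hj htj hsj => by
      have := hc j hj (by simpa using hsj) htj
      refine ⟨flipAt_mem_cubeFace hi this.1, by simp [this.2.1], ?_⟩
      rw [union_comm]
      exact this.2.2.2)
    (fun j hj k hk h1 h2 h3 h4 hjk => hinj j hj k hk (by simpa using h2) h1 (by simpa using h4) h3
      (flipAt_injective i hjk))
    (by simpa [union_comm, and_comm] using hβ')
    (by simpa [union_comm, and_comm, and_left_comm] using hβ) ih
  have hCAi : ∀ j ∈ J, s j i = false → ∀ z ∈ CA j, z ∈ cubeFace D b ∧ z i = false :=
    fun j hj hsj z hz => (mem_cubeFace_erase hi).1 ((hCA j (mem_filter.2 ⟨hj, hsj⟩)).1 hz)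
  have hCBi : ∀ j ∈ J, t j i = true → ∀ z ∈ CB j, z ∈ cubeFace D b ∧ z i = true :=
    fun j hj htj z hz => (mem_cubeFace_erase hi).1 ((hCB j (mem_filter.2 ⟨hj, htj⟩)).1 hz)
  refine ⟨fun j => {z | s j i = false ∧ z ∈ CA j ∨ t j i = true ∧ z ∈ CB j}, fun j hj => ⟨?_, ?_⟩,
    fun j hj k hk hjk => ?_⟩
  · rintro z (⟨hsj, hz⟩ | ⟨htj, hz⟩)
    exacts [(hCAi j hj hsj z hz).1, (hCBi j hj htj z hz).1]
  · have hA : s j i = false → WalkIn {z | s j i = false ∧ z ∈ CA j ∨ t j i = true ∧ z ∈ CB j}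
        (s j) (if t j i = false then t j else c j) := fun hsj =>
      (hCA j (mem_filter.2 ⟨hj, hsj⟩)).2.mono fun z hz => Or.inl ⟨hsj, hz⟩
    have hB : t j i = true → WalkIn {z | s j i = false ∧ z ∈ CA j ∨ t j i = true ∧ z ∈ CB j}
        (t j) (if s j i = true then s j else flipAt i (c j)) := fun htj =>
      (hCB j (mem_filter.2 ⟨hj, htj⟩)).2.mono fun z hz => Or.inr ⟨htj, hz⟩
    cases hsj : s j i
    · cases htj : t j i
      · simpa [hsj, htj] using hA hsj
      · have h1 := hA hsj
        have h2 := hB htj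
        simp only [hsj, htj, Bool.true_eq_false, Bool.false_eq_true, if_false, true_and] at h1 h2 ⊢
        exact (h1.trans (walkIn_flipAt i h1.right_mem h2.right_mem)).trans h2.symm
    · have htj := horient j hj hsj
      simpa [hsj, htj] using (hB htj).symm
  · rw [Set.disjoint_left]
    rintro z (⟨hj', hz⟩ | ⟨hj', hz⟩) (⟨hk', hz'⟩ | ⟨hk', hz'⟩)
    · exact Set.disjoint_left.1
        (hCAd j (mem_filter.2 ⟨hj, hj'⟩) k (mem_filter.2 ⟨hk, hk'⟩) hjk) hz hz'
    · simpa [(hCAi j hj hj' z hz).2] using (hCBi k hk hk' z hz').2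
    · simpa [(hCAi k hk hk' z hz').2] using (hCBi j hj hj' z hz).2
    · exact Set.disjoint_left.1
        (hCBd j (mem_filter.2 ⟨hj, hj'⟩) k (mem_filter.2 ⟨hk, hk'⟩) hjk) hz hz'

lemma SeparatedPairs.of_swap {s' t' : ι → Fin n → Bool} (h : SeparatedPairs D b J s t)
    (hst : ∀ j ∈ J, s' j = s j ∧ t' j = t j ∨ s' j = t j ∧ t' j = s j) :
    SeparatedPairs D b J s' t' := by
  have key : ∀ j ∈ J, ∀ k ∈ J, j ≠ k → s' j ≠ s' k ∧ s' j ≠ t' k ∧ t' j ≠ t' k := by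
    intro j hj k hk hjk
    have h1 := h.left_ne_left j hj k hk hjk
    have h2 := h.left_ne_right j hj k hk hjk
    have h3 := (h.left_ne_right k hk j hj hjk.symm).symm
    have h4 := h.right_ne_right j hj k hk hjk
    rcases hst j hj with ⟨e1, e2⟩ | ⟨e1, e2⟩ <;> rcases hst k hk with ⟨e3, e4⟩ | ⟨e3, e4⟩ <;>
      rw [e1, e2, e3, e4]
    exacts [⟨h1, h2, h4⟩, ⟨h2, h1, h3⟩, ⟨h3, h4, h2⟩, ⟨h4, h3, h1⟩]
  refine ⟨fun j hj => ?_, fun j hj => ?_, fun j hj k hk hjk => (key j hj k hk hjk).1,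
    fun j hj k hk hjk => (key j hj k hk hjk).2.1, fun j hj k hk hjk => (key j hj k hk hjk).2.2⟩
  · rcases hst j hj with ⟨e1, -⟩ | ⟨e1, -⟩ <;> rw [e1]
    exacts [h.left_mem j hj, h.right_mem j hj]
  · rcases hst j hj with ⟨-, e1⟩ | ⟨-, e1⟩ <;> rw [e1]
    exacts [h.right_mem j hj, h.left_mem j hj]

lemma LinkableIn.of_swap {s' t' : ι → Fin n → Bool} (h : LinkableIn D b J s' t')
    (hst : ∀ j ∈ J, s' j = s j ∧ t' j = t j ∨ s' j = t j ∧ t' j = s j) :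
    LinkableIn D b J s t := by
  obtain ⟨C, hC, hCd⟩ := h
  refine ⟨C, fun j hj => ⟨(hC j hj).1, ?_⟩, hCd⟩
  have := (hC j hj).2
  rcases hst j hj with ⟨e1, e2⟩ | ⟨e1, e2⟩ <;> rw [e1, e2] at this
  exacts [this, this.symm]

lemma image_union_image_of_swap [DecidableEq ι] {s' t' : ι → Fin n → Bool}
    (hst : ∀ j ∈ J, s' j = s j ∧ t' j = t j ∨ s' j = t j ∧ t' j = s j) :
    J.image s' ∪ J.image t' = J.image s ∪ J.image t := by
  ext z
  simp only [mem_union, mem_image, ← exists_or, ← and_or_left]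
  refine exists_congr fun j => and_congr_right fun hj => ?_
  rcases hst j hj with ⟨e1, e2⟩ | ⟨e1, e2⟩ <;> rw [e1, e2]
  exact or_comm

/-- In a face of dimension `d ≥ 4`, disjoint pairs using at most `d + 1` vertices altogether can
be linked disjointly. -/
theorem SeparatedPairs.linkableIn [DecidableEq ι] (hD : 4 ≤ #D) (h : SeparatedPairs D b J s t)
    (hcard : #(J.image s ∪ J.image t) ≤ #D + 1) : LinkableIn D b J s t := by
  obtain ⟨m, hm⟩ := Nat.exists_eq_add_of_le hD
  induction m generalizing D b J s t with
  | zero => exact h.linkableIn_of_card_four hm (by omega)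
  | succ m ihm =>
    obtain ⟨i, hi, hX⟩ := exists_direction (card_pos.1 (by omega : 0 < #D)) hcard
    have hDi : #(D.erase i) = #D - 1 := card_erase_of_mem hi
    have ih : ∀ (b' : Fin n → Bool) (J' : Finset ι) (s' t' : ι → Fin n → Bool),
        SeparatedPairs (D.erase i) b' J' s' t' → #(J'.image s' ∪ J'.image t') ≤ #D →
          LinkableIn (D.erase i) b' J' s' t' := fun b' J' s' t' h' hc' =>
      ihm (by omega) h' (by omega) (by omega)
    have hfacet : ∀ a : Bool, (∀ x ∈ J.image s ∪ J.image t, x i = a) → LinkableIn D b J s t :=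
      fun a ha => h.linkableIn_of_facet hi hD a
        (fun j hj => ⟨ha _ (mem_union_left _ (mem_image_of_mem s hj)),
          ha _ (mem_union_right _ (mem_image_of_mem t hj))⟩) hcard ih
    by_cases hfalse : ∃ x ∈ J.image s ∪ J.image t, x i = false
    swap
    · exact hfacet true fun x hx => by
        by_contra hxi
        exact hfalse ⟨x, hx, by simpa using hxi⟩
    by_cases htrue : ∃ x ∈ J.image s ∪ J.image t, x i = true
    swap
    · exact hfacet false fun x hx => by
        by_contra hxi
        exact htrue ⟨x, hx, by simpa using hxi⟩
    let s' : ι → Fin n → Bool := fun j => if s j i then if t j i then s j else t j else s j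
    let t' : ι → Fin n → Bool := fun j => if s j i then if t j i then t j else s j else t j
    have hst : ∀ j ∈ J, s' j = s j ∧ t' j = t j ∨ s' j = t j ∧ t' j = s j := by
      intro j _
      cases h1 : s j i <;> cases h2 : t j i <;> simp [s', t', h1, h2]
    have himage := image_union_image_of_swap hst
    refine LinkableIn.of_swap (s' := s') (t' := t') ?_ hst
    refine (h.of_swap hst).linkableIn_of_split hi (by omega) (by rwa [himage]) (by rwa [himage])
      (by rwa [himage]) (by rwa [himage]) (fun j _ => ?_) ih
    cases h1 : s j i <;> cases h2 : t j i <;> simp [s', t', h1, h2]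

end Linking

/-- Disjoint pairs avoiding a vertex `v` give disjoint paths avoiding `v`. -/
lemma isLinked_induce_compl_singleton {n k : ℕ} (hk : 2 * k ≤ n) (hk' : k ≤ 1 ∨ 4 ≤ n)
    (v : Fin n → Bool) : IsLinked ((cubeGraph n).induce {v}ᶜ) k := by
  classical
  refine ⟨?_, fun s t hst => ?_⟩
  · have hcard : Nat.card ({v}ᶜ : Set (Fin n → Bool)) = 2 ^ n - 1 := by
      rw [Nat.card_coe_set_eq, Set.ncard_compl, Set.ncard_singleton]
      simp
    have := Nat.lt_two_pow_self (n := n)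
    omega
  let s' : Option (Fin k) → Fin n → Bool := fun j => j.elim v fun i => (s i).1
  let t' : Option (Fin k) → Fin n → Bool := fun j => j.elim v fun i => (t i).1
  have hss : ∀ i j, s i = s j → i = j := fun i j h =>
    Sum.inl_injective (hst (a₁ := Sum.inl i) (a₂ := Sum.inl j) h)
  have htt : ∀ i j, t i = t j → i = j := fun i j h =>
    Sum.inr_injective (hst (a₁ := Sum.inr i) (a₂ := Sum.inr j) h)
  have hsv : ∀ i, (s i).1 ≠ v := fun i => (s i).2
  have htv : ∀ i, (t i).1 ≠ v := fun i => (t i).2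
  have hmem : ∀ x : Fin n → Bool, x ∈ cubeFace univ v := fun x => by simp [mem_cubeFace]
  have hsep : SeparatedPairs univ v univ s' t' := by
    refine ⟨fun j _ => hmem _, fun j _ => hmem _, ?_, ?_, ?_⟩ <;>
      rintro (_ | i) - (_ | j) - hij <;> simp only [ne_eq, not_true_eq_false] at hij
    · exact (hsv j).symm
    · exact hsv i
    · exact fun h => hij (congrArg some (hss i j (Subtype.ext h)))
    · exact (htv j).symm
    · exact hsv i
    · exact fun h => nomatch hst (a₁ := Sum.inl i) (a₂ := Sum.inr j) (Subtype.ext h)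
    · exact (htv j).symm
    · exact htv i
    · exact fun h => hij (congrArg some (htt i j (Subtype.ext h)))
  have hcard : #(univ.image s' ∪ univ.image t') ≤ #(univ : Finset (Fin n)) + 1 := by
    have hsub : univ.image s' ∪ univ.image t' ⊆
        insert v ((univ.image fun i => (s i).1) ∪ univ.image fun i => (t i).1) := by
      refine union_subset ?_ ?_ <;> refine fun z hz => ?_ <;>
        obtain ⟨_ | j, -, rfl⟩ := mem_image.1 hz <;> simp [s', t']
    have h1 := (card_le_card hsub).trans (card_insert_le _ _)
    have h2 := card_union_le (univ.image fun i => (s i).1) (univ.image fun i => (t i).1)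
    have h3 := card_image_le (s := (univ : Finset (Fin k))) (f := fun i => (s i).1)
    have h4 := card_image_le (s := (univ : Finset (Fin k))) (f := fun i => (t i).1)
    simp only [card_univ, Fintype.card_fin] at h3 h4 ⊢
    omega
  obtain ⟨C, hC, hCd⟩ : LinkableIn univ v univ s' t' := by
    rcases hk' with hk' | hn
    · refine hsep.linkableIn_of_unique hcard ?_
      rintro (_ | i) - (_ | j) - hi hj
      · rfl
      · exact absurd rfl hi
      · exact absurd rfl hj
      · congr 1
        ext
        omega
    · exact hsep.linkableIn (by simpa using hn) hcard
  have hvC : ∀ i, v ∉ C (some i) := fun i =>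
    Set.disjoint_left.1 (hCd none (mem_univ _) (some i) (mem_univ _) (by simp))
      (hC none (mem_univ _)).2.left_mem
  choose w hw using fun i => (hC (some i) (mem_univ _)).2
  have hwv : ∀ i, ∀ x ∈ (w i).support, x ∈ ({v}ᶜ : Set (Fin n → Bool)) := by
    rintro i x hx rfl
    exact hvC i (hw i _ hx)
  refine ⟨fun i => ((w i).induce _ (hwv i)).bypass, fun i => SimpleGraph.Walk.bypass_isPath _,
    fun i j hij x hx hx' => ?_⟩
  have key : ∀ i, x ∈ ((w i).induce _ (hwv i)).bypass.support → x.1 ∈ C (some i) := by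
    intro i hx
    have := SimpleGraph.Walk.support_bypass_subset_support _ hx
    rw [SimpleGraph.Walk.support_induce] at this
    exact hw i _ (by simpa using this)
  exact Set.disjoint_left.1 (hCd (some i) (mem_univ _) (some j) (mem_univ _)
    (by simpa using hij)) (key i hx) (key j hx')

theorem cube_strongly_linked (d : ℕ) (hd : 1 ≤ d) :
    2 * (d / 2) + 1 ≤ Nat.card (Fin d → Bool) ∧
      ∀ v : Fin d → Bool, IsLinked ((cubeGraph d).induce {v}ᶜ) (d / 2) := by
  refine ⟨?_, fun v => isLinked_induce_compl_singleton (by omega) (by omega) v⟩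
  have := Nat.lt_two_pow_self (n := d)
  simp
  omega
end
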